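/- Let u, p be a smooth solution of -Δu + u·∇u = -∇p, div u = 0 in ℝ³. Let 12/5 < q < 3, 1 ≤ ℓ ≤ ∞, and γ > 1/3 + 1/q. If liminf_{R→∞} R^{γ - 3/q} ‖u‖_{L^{q,ℓ}(B(R)\B(R/2))} < ∞, then u ≡ 0. -/

import Mathlib

open MeasureTheory Metric Filter ENNReal

noncomputable section

abbrev E3 := EuclideanSpace ℝ (Fin 3)

/-- Lorentz quasinorm on a set `Ω` (with `ℓ = ∞` giving the weak norm). -/
noncomputable def lorentzNorm {α F : Type*} [MeasurableSpace α] [NormedAddCommGroup F]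
    (μ : Measure α) (p ℓ : ℝ≥0∞) (f : α → F) (Ω : Set α) : ℝ≥0∞ :=
  if ℓ = ⊤ then
    ⨆ σ : NNReal, (σ : ℝ≥0∞) * (μ {x | x ∈ Ω ∧ (σ : ℝ) < ‖f x‖}) ^ (1 / p).toReal
  else
    (∫⁻ σ in Set.Ioi (0 : ℝ),
        ENNReal.ofReal (σ ^ (ℓ.toReal - 1)) *
          (μ {x | x ∈ Ω ∧ σ < ‖f x‖}) ^ (ℓ / p).toReal) ^ (1 / ℓ).toReal

/-- The annulus `B(R) \ B(R/2)` centered at the origin in `ℝ³`. -/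
def ann (R : ℝ) : Set E3 := Metric.ball (0 : E3) R \ Metric.ball (0 : E3) (R / 2)

/-- Divergence of a vector field on `ℝ³`. -/
noncomputable def divg (u : E3 → E3) (x : E3) : ℝ :=
  ∑ i, fderiv ℝ u x (EuclideanSpace.single i 1) i

/-- Componentwise Laplacian of a vector field on `ℝ³`. -/
noncomputable def lap (u : E3 → E3) (x : E3) : E3 :=
  ∑ i, fderiv ℝ (fun y => fderiv ℝ u y (EuclideanSpace.single i 1)) x (EuclideanSpace.single i 1)

/-- Convective term `(u · ∇) u`. -/
noncomputable def conv (u : E3 → E3) (x : E3) : E3 := fderiv ℝ u x (u x)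

/-- Gradient of a scalar function on `ℝ³`. -/
noncomputable def gradp (p : E3 → ℝ) (x : E3) : E3 :=
  ∑ i, fderiv ℝ p x (EuclideanSpace.single i 1) • EuclideanSpace.single i 1

/-- The steady Navier–Stokes system `-Δu + (u·∇)u + ∇p = 0`, `div u = 0`. -/
def SteadyNS (u : E3 → E3) (p : E3 → ℝ) : Prop :=
  (∀ x, -lap u x + conv u x + gradp p x = 0) ∧ (∀ x, divg u x = 0)

/-- Smooth real functions on `ℝ³`. -/
abbrev Smooth (f : E3 → ℝ) : Prop := ContDiff ℝ (⊤ : ℕ∞) f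

/-- Partial derivative of a scalar function on `ℝ³`. -/
def pd (j : Fin 3) (f : E3 → ℝ) (x : E3) : ℝ := fderiv ℝ f x (EuclideanSpace.single j 1)

lemma Smooth.differentiableAt {f : E3 → ℝ} (hf : Smooth f) (x : E3) : DifferentiableAt ℝ f x :=
  (hf.differentiable (by simp)).differentiableAt

lemma Smooth.pd {f : E3 → ℝ} (hf : Smooth f) (j : Fin 3) : Smooth (pd j f) := by
  have h : ContDiff ℝ (⊤ : ℕ∞) (fderiv ℝ f) := hf.fderiv_right (by simp)
  exact h.clm_apply contDiff_const

lemma pd_add {f g : E3 → ℝ} (hf : Smooth f) (hg : Smooth g) (j : Fin 3) (x : E3) :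
    pd j (fun y => f y + g y) x = pd j f x + pd j g x := by
  simp only [pd]
  rw [fderiv_fun_add (hf.differentiableAt x) (hg.differentiableAt x)]
  rfl

lemma pd_sub {f g : E3 → ℝ} (hf : Smooth f) (hg : Smooth g) (j : Fin 3) (x : E3) :
    pd j (fun y => f y - g y) x = pd j f x - pd j g x := by
  simp only [pd]
  rw [fderiv_fun_sub (hf.differentiableAt x) (hg.differentiableAt x)]
  rfl

lemma pd_mul {f g : E3 → ℝ} (hf : Smooth f) (hg : Smooth g) (j : Fin 3) (x : E3) :
    pd j (fun y => f y * g y) x = pd j f x * g x + f x * pd j g x := by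
  simp only [pd]
  rw [fderiv_fun_mul (hf.differentiableAt x) (hg.differentiableAt x)]
  simp
  ring

lemma pd_sum {ι : Type*} (s : Finset ι) {f : ι → E3 → ℝ} (hf : ∀ i, Smooth (f i)) (j : Fin 3)
    (x : E3) : pd j (fun y => ∑ i ∈ s, f i y) x = ∑ i ∈ s, pd j (f i) x := by
  simp only [pd]
  rw [fderiv_fun_sum fun i _ => (hf i).differentiableAt x]
  simp

lemma fderiv_eq_sum_pd (f : E3 → ℝ) (x v : E3) : fderiv ℝ f x v = ∑ i, v i * pd i f x := by
  have : v = ∑ i, v i • EuclideanSpace.single i (1 : ℝ) := by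
    ext k
    simp [Fin.sum_univ_three]
    fin_cases k <;> simp
  conv_lhs => rw [this]
  simp [pd]

lemma norm_fderiv_le_sum (f : E3 → ℝ) (x : E3) : ‖fderiv ℝ f x‖ ≤ ∑ i, |pd i f x| := by
  refine ContinuousLinearMap.opNorm_le_bound _ (by positivity) fun v => ?_
  rw [fderiv_eq_sum_pd, Real.norm_eq_abs, Finset.sum_mul]
  refine (Finset.abs_sum_le_sum_abs _ _).trans (Finset.sum_le_sum fun i _ => ?_)
  rw [abs_mul, mul_comm]
  gcongr
  exact EuclideanSpace.norm_eq v ▸ (by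
    rw [← Real.sqrt_sq (abs_nonneg (v i))]
    apply Real.sqrt_le_sqrt
    simpa using Finset.single_le_sum (f := fun i => ‖v i‖ ^ 2) (fun _ _ => sq_nonneg _)
      (Finset.mem_univ i))

lemma Smooth.integrable {f : E3 → ℝ} (hf : Smooth f) (hc : HasCompactSupport f) :
    Integrable f := hf.continuous.integrable_of_hasCompactSupport hc

lemma HasCompactSupport.pd {f : E3 → ℝ} (hc : HasCompactSupport f) (j : Fin 3) :
    HasCompactSupport (pd j f) :=
  (hc.fderiv_apply (𝕜 := ℝ) (EuclideanSpace.single j 1))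

lemma integral_pd_eq_zero {f : E3 → ℝ} (hf : Smooth f) (hc : HasCompactSupport f) (j : Fin 3) :
    ∫ x, pd j f x = 0 := by
  have := integral_mul_fderiv_eq_neg_fderiv_mul_of_integrable (μ := (volume : Measure E3))
    (f := fun _ => (1 : ℝ)) (g := f) (v := EuclideanSpace.single j 1)
    (by simp) (by simp only [one_mul]; exact (hf.pd j).integrable (hc.pd j)) (by simpa using hf.integrable hc)
    (fun _ _ => differentiableAt_const _) (fun x _ => hf.differentiableAt x)
  simpa [pd] using this

lemma Smooth.comp_sub_smul {f : E3 → ℝ} (hf : Smooth f) (y : E3) (t : ℝ) :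
    Smooth (fun z => f (y - t • z)) :=
  ContDiff.comp hf (contDiff_const.sub (contDiff_id.const_smul t))

lemma pd_comp_sub_smul {f : E3 → ℝ} (hf : Smooth f) (y : E3) (t : ℝ) (j : Fin 3) (z : E3) :
    pd j (fun z => f (y - t • z)) z = - t * pd j f (y - t • z) := by
  have h1 : HasFDerivAt (fun z : E3 => y - t • z) (-(t • ContinuousLinearMap.id ℝ E3)) z := by
    simpa using ((hasFDerivAt_id z).const_smul t).const_sub y
  have h2 := (hf.differentiableAt (y - t • z)).hasFDerivAt.comp z h1
  simp only [pd]
  have h3 : fderiv ℝ (fun z => f (y - t • z)) z =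
    (fderiv ℝ f (y - t • z)).comp (-(t • ContinuousLinearMap.id ℝ E3)) := h2.fderiv
  rw [h3]
  simp

lemma Smooth.sub_const {f : E3 → ℝ} (hf : Smooth f) (y : E3) :
    Smooth (fun z => f (z - y)) :=
  ContDiff.comp hf (contDiff_id.sub contDiff_const)

lemma pd_comp_sub {f : E3 → ℝ} (y : E3) (j : Fin 3) (z : E3) :
    pd j (fun z => f (z - y)) z = pd j f (z - y) := by
  simp only [pd]
  rw [fderiv_comp_sub]

lemma sub_eq_integral_pd {f : E3 → ℝ} (hf : Smooth f) (x v : E3) (a : ℝ) :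
    f (x + a • v) - f x = ∫ t in (0 : ℝ)..a, ∑ i, v i * pd i f (x + t • v) := by
  symm
  have hd : ∀ t : ℝ, HasDerivAt (fun t : ℝ => f (x + t • v)) (∑ i, v i * pd i f (x + t • v)) t := by
    intro t
    rw [← fderiv_eq_sum_pd]
    have h1 : HasDerivAt (fun t : ℝ => x + t • v) v t := by
      simpa using ((hasDerivAt_id t).smul_const v).const_add x
    exact (hf.differentiableAt (x + t • v)).hasFDerivAt.comp_hasDerivAt t h1
  have hc : Continuous fun t : ℝ => ∑ i, v i * pd i f (x + t • v) := by
    refine continuous_finsetSum _ fun i _ => continuous_const.mul ?_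
    exact (hf.pd i).continuous.comp (by fun_prop)
  rw [intervalIntegral.integral_eq_sub_of_hasDerivAt (fun t _ => hd t)
    (hc.intervalIntegrable _ _)]
  simp

/-- The `i`-th component of a vector field. -/
def coord (u : E3 → E3) (i : Fin 3) (x : E3) : ℝ := u x i

/-- The squared Frobenius norm of the gradient of a vector field. -/
def gradSq (u : E3 → E3) (x : E3) : ℝ := ∑ i, ∑ j, pd j (coord u i) x ^ 2

/-- The tensor `∇u - u ⊗ u`, whose divergence is the pressure gradient. -/
def stress (u : E3 → E3) (i j : Fin 3) (x : E3) : ℝ :=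
  pd j (coord u i) x - coord u i x * coord u j x

/-- The steady Navier–Stokes system for smooth fields, written in components. -/
structure SmoothNS (u : E3 → E3) (p : E3 → ℝ) : Prop where
  smooth : ∀ i, Smooth (coord u i)
  smooth_p : Smooth p
  div : ∀ x, ∑ i, pd i (coord u i) x = 0
  mom : ∀ i x, ∑ j, pd j (pd j (coord u i)) x = ∑ j, coord u j x * pd j (coord u i) x + pd i p x

lemma smooth_coord {u : E3 → E3} (hu : ContDiff ℝ (⊤ : ℕ∞) u) (i : Fin 3) : Smooth (coord u i) :=
  (contDiff_euclidean.1 hu) i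

lemma fderiv_coord {u : E3 → E3} {x : E3} (hu : DifferentiableAt ℝ u x) (i : Fin 3) :
    fderiv ℝ (coord u i) x = (EuclideanSpace.proj i).comp (fderiv ℝ u x) :=
  ((EuclideanSpace.proj (𝕜 := ℝ) i).hasFDerivAt.comp x hu.hasFDerivAt).fderiv

lemma pd_coord {u : E3 → E3} {x : E3} (hu : DifferentiableAt ℝ u x) (i j : Fin 3) :
    pd j (coord u i) x = fderiv ℝ u x (EuclideanSpace.single j 1) i := by
  rw [pd, fderiv_coord hu]
  rfl

lemma SteadyNS.smoothNS {u : E3 → E3} {p : E3 → ℝ} (h : SteadyNS u p)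
    (hu : ContDiff ℝ (⊤ : ℕ∞) u) (hp : ContDiff ℝ (⊤ : ℕ∞) p) : SmoothNS u p := by
  have hd : Differentiable ℝ u := hu.differentiable (by simp)
  refine ⟨smooth_coord hu, hp, fun x => ?_, fun i x => ?_⟩
  · rw [← h.2 x, divg]
    exact Finset.sum_congr rfl fun i _ => pd_coord (hd x) i i
  · have h1 := congrArg (fun v : E3 => v i) (h.1 x)
    have hl : lap u x i = ∑ j, pd j (pd j (coord u i)) x := by
      rw [lap]
      simp only [WithLp.ofLp_sum, Finset.sum_apply]
      refine Finset.sum_congr rfl fun j _ => ?_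
      have e : pd j (coord u i) = coord (fun y => fderiv ℝ u y (EuclideanSpace.single j 1)) i := by
        funext y
        exact pd_coord (hd y) i j
      have hdd : DifferentiableAt ℝ (fun y => fderiv ℝ u y (EuclideanSpace.single j 1)) x := by
        have h : ContDiff ℝ (⊤ : ℕ∞) (fderiv ℝ u) := hu.fderiv_right (by simp)
        exact ((h.clm_apply contDiff_const).differentiable (by simp)).differentiableAt
      rw [e, pd_coord hdd]
    have hc : conv u x i = ∑ j, coord u j x * pd j (coord u i) x := by
      rw [show ∑ j, coord u j x * pd j (coord u i) x = fderiv ℝ (coord u i) x (u x) from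
        (fderiv_eq_sum_pd _ _ _).symm, conv, fderiv_coord (hd x)]
      rfl
    have hg : gradp p x i = pd i p x := by
      rw [gradp]
      simp only [WithLp.ofLp_sum, Finset.sum_apply]
      simp [pd]
    simp only [PiLp.add_apply, PiLp.neg_apply, PiLp.zero_apply] at h1
    rw [hl, hc, hg] at h1
    linarith

namespace SmoothNS

variable {u : E3 → E3} {p : E3 → ℝ}

lemma smooth_stress (h : SmoothNS u p) (i j : Fin 3) : Smooth (stress u i j) :=
  ((h.smooth i).pd j).sub ((h.smooth i).mul (h.smooth j))

lemma pd_pressure (h : SmoothNS u p) (i : Fin 3) (x : E3) :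
    pd i p x = ∑ j, pd j (stress u i j) x := by
  have e : ∀ j, pd j (stress u i j) x = pd j (pd j (coord u i)) x
      - (pd j (coord u i) x * coord u j x + coord u i x * pd j (coord u j) x) := by
    intro j
    rw [← pd_mul (h.smooth i) (h.smooth j)]
    exact pd_sub ((h.smooth i).pd j) ((h.smooth i).mul (h.smooth j)) j x
  have h1 := h.div x
  have h2 := h.mom i x
  simp only [e, Fin.sum_univ_three] at *
  linear_combination -h2 + coord u i x * h1

/-- Smoothness of the vector field `u · ∇φ`. -/
lemma smooth_flux (h : SmoothNS u p) {φ : E3 → ℝ} (hφ : Smooth φ) :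
    Smooth (fun x => ∑ i, pd i φ x * coord u i x) :=
  ContDiff.sum fun i _ => (hφ.pd i).mul (h.smooth i)

lemma hasCompactSupport_flux {φ : E3 → ℝ} (hc : HasCompactSupport φ) :
    HasCompactSupport (fun x => ∑ i, pd i φ x * coord u i x) := by
  simp only [Fin.sum_univ_three]
  exact (((hc.pd 0).mul_right).add ((hc.pd 1).mul_right)).add ((hc.pd 2).mul_right)

lemma integral_flux_eq_zero (h : SmoothNS u p) {φ : E3 → ℝ} (hφ : Smooth φ)
    (hc : HasCompactSupport φ) : ∫ x, ∑ i, pd i φ x * coord u i x = 0 := by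
  have e : ∀ x, ∑ i, pd i φ x * coord u i x = ∑ i, pd i (fun y => φ y * coord u i y) x := by
    intro x
    have h1 := h.div x
    simp only [pd_mul hφ (h.smooth _), Fin.sum_univ_three] at *
    linear_combination - φ x * h1
  simp only [e]
  rw [integral_finsetSum]
  · exact Finset.sum_eq_zero fun i _ =>
      integral_pd_eq_zero (hφ.mul (h.smooth i)) (hc.mul_right) i
  · intro i _
    have hs : Smooth (fun y => φ y * coord u i y) := hφ.mul (h.smooth i)
    exact (hs.pd i).integrable ((HasCompactSupport.mul_right hc).pd i)

/-- The local energy identity. -/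
lemma energy_identity (h : SmoothNS u p) {φ : E3 → ℝ} (hφ : Smooth φ)
    (hc : HasCompactSupport φ) :
    ∫ x, φ x * gradSq u x = ∫ x, ((∑ i, pd i φ x * coord u i x) * p x
      + ((∑ i, pd i φ x * coord u i x) * (∑ i, coord u i x ^ 2) / 2
        - ∑ j, pd j φ x * ∑ i, coord u i x * pd j (coord u i) x)) := by
  set Φ : Fin 3 → E3 → ℝ := fun j x => φ x * ((∑ i, coord u i x * pd j (coord u i) x)
    - coord u j x * ((∑ i, coord u i x * coord u i x) * (1 / 2) + p x)) with hΦ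
  have s1 : ∀ j, Smooth (fun x => ∑ i, coord u i x * pd j (coord u i) x) := fun j =>
    ContDiff.sum fun i _ => (h.smooth i).mul ((h.smooth i).pd j)
  have s2 : Smooth (fun x => ∑ i, coord u i x * coord u i x) :=
    ContDiff.sum fun i _ => (h.smooth i).mul (h.smooth i)
  have s3 : Smooth (fun x => (∑ i, coord u i x * coord u i x) * (1 / 2)) := s2.mul contDiff_const
  have s4 : Smooth (fun x => (∑ i, coord u i x * coord u i x) * (1 / 2) + p x) := s3.add h.smooth_p
  have s5 : ∀ j, Smooth (fun x => coord u j x * ((∑ i, coord u i x * coord u i x) * (1 / 2) + p x)) :=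
    fun j => (h.smooth j).mul s4
  have s6 : ∀ j, Smooth (fun x => (∑ i, coord u i x * pd j (coord u i) x)
    - coord u j x * ((∑ i, coord u i x * coord u i x) * (1 / 2) + p x)) := fun j => (s1 j).sub (s5 j)
  have sΦ : ∀ j, Smooth (Φ j) := fun j => hφ.mul (s6 j)
  have cΦ : ∀ j, HasCompactSupport (Φ j) := fun j => hc.mul_right
  have e : ∀ x, φ x * gradSq u x = ((∑ i, pd i φ x * coord u i x) * p x
      + ((∑ i, pd i φ x * coord u i x) * (∑ i, coord u i x ^ 2) / 2
        - ∑ j, pd j φ x * ∑ i, coord u i x * pd j (coord u i) x)) + ∑ j, pd j (Φ j) x := by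
    intro x
    have d : ∀ j, pd j (Φ j) x = pd j φ x * ((∑ i, coord u i x * pd j (coord u i) x)
        - coord u j x * ((∑ i, coord u i x * coord u i x) * (1 / 2) + p x))
        + φ x * ((∑ i, (pd j (coord u i) x * pd j (coord u i) x + coord u i x * pd j (pd j (coord u i)) x))
          - (pd j (coord u j) x * ((∑ i, coord u i x * coord u i x) * (1 / 2) + p x)
            + coord u j x * ((∑ i, (pd j (coord u i) x * coord u i x + coord u i x * pd j (coord u i) x))
              * (1 / 2) + pd j p x))) := by
      intro j
      simp only [hΦ]
      rw [pd_mul hφ (s6 j), pd_sub (s1 j) (s5 j), pd_mul (h.smooth j) s4, pd_add s3 h.smooth_p,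
        pd_mul s2 contDiff_const,
        pd_sum _ (fun i => (h.smooth i).mul ((h.smooth i).pd j)),
        pd_sum _ (fun i => (h.smooth i).mul (h.smooth i))]
      simp only [pd_mul (h.smooth _) ((h.smooth _).pd j), pd_mul (h.smooth _) (h.smooth _)]
      have : pd j (fun _ => (1 / 2 : ℝ)) x = 0 := by simp [pd]
      rw [this]
      ring
    have h1 := h.div x
    have h2 := fun i => h.mom i x
    have h20 := h2 0
    have h21 := h2 1
    have h22 := h2 2
    simp only [d, gradSq, Fin.sum_univ_three] at *
    linear_combination (-φ x) * (coord u 0 x * h20 + coord u 1 x * h21 + coord u 2 x * h22)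
      + φ x * ((coord u 0 x * coord u 0 x + coord u 1 x * coord u 1 x + coord u 2 x * coord u 2 x) * (1 / 2)
        + p x) * h1
  have iΦ : ∀ j, Integrable (pd j (Φ j)) := fun j => ((sΦ j).pd j).integrable ((cΦ j).pd j)
  have cf := hasCompactSupport_flux (u := u) hc
  have sf := h.smooth_flux hφ
  have i1 : Integrable fun x => ((∑ i, pd i φ x * coord u i x) * p x
      + ((∑ i, pd i φ x * coord u i x) * (∑ i, coord u i x ^ 2) / 2
        - ∑ j, pd j φ x * ∑ i, coord u i x * pd j (coord u i) x)) := by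
    have i2 : Integrable fun x => (∑ i, pd i φ x * coord u i x) * p x :=
      Smooth.integrable (sf.mul h.smooth_p) cf.mul_right
    have i3 : Integrable fun x => (∑ i, pd i φ x * coord u i x) * (∑ i, coord u i x ^ 2) / 2 :=
      (Smooth.integrable (sf.mul (ContDiff.sum fun i _ => (h.smooth i).pow 2))
        cf.mul_right).div_const 2
    have i4 : Integrable fun x => ∑ j, pd j φ x * ∑ i, coord u i x * pd j (coord u i) x :=
      integrable_finsetSum _ fun j _ =>
        Smooth.integrable ((hφ.pd j).mul (s1 j)) (HasCompactSupport.mul_right (hc.pd j))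
    exact i2.add (i3.sub i4)
  simp_rw [e]
  rw [integral_add i1 (integrable_finsetSum _ fun j _ => iΦ j),
    integral_finsetSum _ fun j _ => iΦ j]
  simp [integral_pd_eq_zero (sΦ _) (cΦ _)]

end SmoothNS

lemma pd_eq_zero_of_eventuallyEq {f : E3 → ℝ} {x : E3} {c : ℝ} (h : f =ᶠ[nhds x] fun _ => c)
    (j : Fin 3) : pd j f x = 0 := by
  rw [pd, h.fderiv_eq]
  simp

lemma pd_eventuallyEq_zero {f : E3 → ℝ} {x : E3} {c : ℝ} (h : f =ᶠ[nhds x] fun _ => c)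
    (j : Fin 3) : pd j f =ᶠ[nhds x] fun _ => 0 :=
  h.eventuallyEq_nhds.mono fun _ hy => pd_eq_zero_of_eventuallyEq hy j

lemma pd_comp_real {S : ℝ → ℝ} (hS : ContDiff ℝ (⊤ : ℕ∞) S) {h : E3 → ℝ} (hh : Smooth h)
    (j : Fin 3) (x : E3) : pd j (fun y => S (h y)) x = deriv S (h x) * pd j h x := by
  have h1 : HasDerivAt S (deriv S (h x)) (h x) :=
    (hS.differentiable (by simp)).differentiableAt.hasDerivAt
  have h2 := h1.comp_hasFDerivAt x (hh.differentiableAt x).hasFDerivAt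
  have h3 : fderiv ℝ (fun y => S (h y)) x = _ := h2.fderiv
  rw [pd, h3]
  simp [pd]

lemma pd_sub_norm_sq_div (b m : ℝ) (j : Fin 3) (x : E3) :
    pd j (fun y => (b ^ 2 - ‖y‖ ^ 2) / m) x = -(2 / m) * x j := by
  have h1 : HasFDerivAt (fun y : E3 => ‖y‖ ^ 2) (2 • (innerSL ℝ x)) x :=
    (hasStrictFDerivAt_norm_sq x).hasFDerivAt
  have h2 := (h1.const_sub (b ^ 2)).mul_const (m⁻¹)
  have h3 : fderiv ℝ (fun y : E3 => (b ^ 2 - ‖y‖ ^ 2) / m) x = _ := h2.fderiv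
  rw [pd, h3]
  simp [EuclideanSpace.inner_single_right]
  ring

lemma pd_const_mul_coord (c : ℝ) (i j : Fin 3) (x : E3) :
    |pd i (fun y : E3 => c * y j) x| ≤ |c| := by
  have h1 := ((EuclideanSpace.proj (𝕜 := ℝ) j : E3 →L[ℝ] ℝ).hasFDerivAt (x := x)).const_mul c
  have h2 : fderiv ℝ (fun y : E3 => c * y j) x = _ := h1.fderiv
  rw [pd, h2]
  by_cases h : i = j
  · subst h; simp
  · simp [Ne.symm h]

lemma abs_coord_le_norm (x : E3) (j : Fin 3) : |x j| ≤ ‖x‖ := by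
  simpa using PiLp.norm_apply_le x j

/-- Radial cutoff functions with scale-invariant derivative bounds. -/
lemma exists_cutoff : ∃ C : ℝ, 0 < C ∧ ∀ a δ : ℝ, 1 / 2 ≤ a → 0 < δ → a + δ ≤ 1 →
    ∃ φ : E3 → ℝ, Smooth φ ∧ (∀ x, 0 ≤ φ x) ∧ (∀ x, φ x ≤ 1) ∧ (∀ x, ‖x‖ ≤ a → φ x = 1) ∧
      (∀ x, a + δ ≤ ‖x‖ → φ x = 0) ∧ (∀ j x, |pd j φ x| ≤ C / δ) ∧
      (∀ i j x, |pd i (pd j φ) x| ≤ C / δ ^ 2) ∧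
      (∀ j x, pd j φ x ≠ 0 → a ≤ ‖x‖ ∧ ‖x‖ ≤ a + δ) ∧
      (∀ i j x, pd i (pd j φ) x ≠ 0 → a ≤ ‖x‖ ∧ ‖x‖ ≤ a + δ) := by
  have hS : ContDiff ℝ (⊤ : ℕ∞) Real.smoothTransition := Real.smoothTransition.contDiff
  have hS1 : ContDiff ℝ (⊤ : ℕ∞) (deriv Real.smoothTransition) :=
    (contDiff_infty_iff_deriv.1 hS).2
  have hS2 : ContDiff ℝ (⊤ : ℕ∞) (deriv (deriv Real.smoothTransition)) :=
    (contDiff_infty_iff_deriv.1 hS1).2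
  obtain ⟨K1, hK1⟩ := isCompact_Icc.exists_bound_of_continuousOn
    (s := Set.Icc (0 : ℝ) 1) hS1.continuous.continuousOn
  obtain ⟨K2, hK2⟩ := isCompact_Icc.exists_bound_of_continuousOn
    (s := Set.Icc (0 : ℝ) 1) hS2.continuous.continuousOn
  have hK10 : 0 ≤ K1 := (norm_nonneg _).trans (hK1 0 (by simp))
  have hK20 : 0 ≤ K2 := (norm_nonneg _).trans (hK2 0 (by simp))
  refine ⟨1 + 2 * K1 + 4 * K2, by positivity, fun a δ ha hδ hb => ?_⟩
  set b := a + δ with hbdef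
  set m := b ^ 2 - a ^ 2 with hm
  have hmδ : δ ≤ m := by rw [hm, hbdef]; nlinarith
  have hm0 : 0 < m := hδ.trans_le hmδ
  set h : E3 → ℝ := fun y => (b ^ 2 - ‖y‖ ^ 2) / m with hh
  have hsm : Smooth h := (contDiff_const.sub (contDiff_norm_sq ℝ)).div_const m
  have hsφ : Smooth (fun x => Real.smoothTransition (h x)) := hS.comp hsm
  have one : ∀ x, ‖x‖ ≤ a → Real.smoothTransition (h x) = 1 := by
    intro x hx
    apply Real.smoothTransition.one_of_one_le
    rw [hh, le_div_iff₀ hm0]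
    nlinarith [norm_nonneg x]
  have zero : ∀ x, b ≤ ‖x‖ → Real.smoothTransition (h x) = 0 := by
    intro x hx
    apply Real.smoothTransition.zero_of_nonpos
    apply div_nonpos_of_nonpos_of_nonneg _ hm0.le
    nlinarith
  have loc : ∀ x, ¬ (a ≤ ‖x‖ ∧ ‖x‖ ≤ b) →
      ∃ c, (fun x => Real.smoothTransition (h x)) =ᶠ[nhds x] fun _ => c := by
    intro x hx
    rw [not_and_or, not_le, not_le] at hx
    rcases hx with hx | hx
    · exact ⟨1, (continuous_norm.continuousAt.eventually_lt continuousAt_const hx).mono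
        fun y hy => one y hy.le⟩
    · exact ⟨0, (continuousAt_const.eventually_lt continuous_norm.continuousAt hx).mono
        fun y hy => zero y hy.le⟩
  have z1 : ∀ j x, ¬ (a ≤ ‖x‖ ∧ ‖x‖ ≤ b) → pd j (fun x => Real.smoothTransition (h x)) x = 0 := by
    intro j x hx
    obtain ⟨c, hc⟩ := loc x hx
    exact pd_eq_zero_of_eventuallyEq hc j
  have z2 : ∀ i j x, ¬ (a ≤ ‖x‖ ∧ ‖x‖ ≤ b) →
      pd i (pd j (fun x => Real.smoothTransition (h x))) x = 0 := by
    intro i j x hx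
    obtain ⟨c, hc⟩ := loc x hx
    exact pd_eq_zero_of_eventuallyEq (pd_eventuallyEq_zero hc j) i
  have hmem : ∀ x, (a ≤ ‖x‖ ∧ ‖x‖ ≤ b) → h x ∈ Set.Icc (0 : ℝ) 1 := by
    intro x hx
    constructor
    · apply div_nonneg _ hm0.le
      nlinarith [hx.1, hx.2, norm_nonneg x]
    · rw [hh, div_le_one hm0]
      nlinarith [hx.1, hx.2, norm_nonneg x]
  have hpd : ∀ j, pd j h = fun x => -(2 / m) * x j := fun j => funext fun x =>
    pd_sub_norm_sq_div b m j x
  have hpdb : ∀ j x, ‖x‖ ≤ b → |pd j h x| ≤ 2 / δ := by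
    intro j x hx
    rw [hpd, abs_mul, abs_neg, abs_of_pos (by positivity)]
    have : |x j| ≤ 1 := (abs_coord_le_norm x j).trans (hx.trans hb)
    calc 2 / m * |x j| ≤ 2 / m * 1 := by gcongr
      _ ≤ 2 / δ := by rw [mul_one]; gcongr
  have hpdpd : ∀ i j x, |pd i (pd j h) x| ≤ 2 / δ := by
    intro i j x
    rw [hpd]
    refine (pd_const_mul_coord _ i j x).trans ?_
    rw [abs_neg, abs_of_pos (by positivity)]
    gcongr
  have hδ1 : δ ≤ 1 := by linarith
  refine ⟨_, hsφ, fun x => Real.smoothTransition.nonneg _, fun x => Real.smoothTransition.le_one _,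
    one, zero, fun j x => ?_, fun i j x => ?_, fun j x hx => ?_, fun i j x hx => ?_⟩
  · by_cases hx : a ≤ ‖x‖ ∧ ‖x‖ ≤ b
    · rw [pd_comp_real hS hsm, abs_mul]
      calc _ ≤ K1 * (2 / δ) := mul_le_mul (hK1 _ (hmem x hx)) (hpdb j x hx.2) (abs_nonneg _) hK10
        _ = 2 * K1 / δ := by ring
        _ ≤ _ := by gcongr; linarith
    · rw [z1 j x hx]; simp; positivity
  · by_cases hx : a ≤ ‖x‖ ∧ ‖x‖ ≤ b
    · have e : pd j (fun x => Real.smoothTransition (h x)) =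
          fun x => deriv Real.smoothTransition (h x) * pd j h x :=
        funext fun x => pd_comp_real hS hsm j x
      have hs1 : Smooth (fun x => deriv Real.smoothTransition (h x)) := hS1.comp hsm
      rw [e, pd_mul hs1 (hsm.pd j), pd_comp_real hS1 hsm]
      have t1 : |deriv (deriv Real.smoothTransition) (h x) * pd i h x * pd j h x| ≤
          K2 * (2 / δ) * (2 / δ) := by
        rw [abs_mul, abs_mul]
        have := hpdb i x hx.2
        have := hpdb j x hx.2
        have := hK2 _ (hmem x hx)
        rw [Real.norm_eq_abs] at this
        gcongr
      have t2 : |deriv Real.smoothTransition (h x) * pd i (pd j h) x| ≤ K1 * (2 / δ) := by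
        rw [abs_mul]
        exact mul_le_mul (hK1 _ (hmem x hx)) (hpdpd i j x) (abs_nonneg _) hK10
      calc _ ≤ K2 * (2 / δ) * (2 / δ) + K1 * (2 / δ) := (abs_add_le _ _).trans (add_le_add t1 t2)
        _ = 4 * K2 / δ ^ 2 + 2 * K1 * δ / δ ^ 2 := by field_simp; ring
        _ ≤ 4 * K2 / δ ^ 2 + 2 * K1 * 1 / δ ^ 2 := by gcongr
        _ = (2 * K1 + 4 * K2) / δ ^ 2 := by ring
        _ ≤ _ := by gcongr; linarith
    · rw [z2 i j x hx]; simp; positivity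
  · by_contra hc; exact hx (z1 j x hc)
  · by_contra hc; exact hx (z2 i j x hc)

/-- A fixed smooth mollifier supported in the unit ball. -/
lemma exists_mollifier : ∃ η : E3 → ℝ, Smooth η ∧ HasCompactSupport η ∧ (∫ z, η z = 1) ∧
    (∀ z, 1 < ‖z‖ → η z = 0) ∧ (∀ j z, 1 < ‖z‖ → pd j η z = 0) := by
  let B : ContDiffBump (0 : E3) := ⟨1 / 2, 1, by norm_num, by norm_num⟩
  have h0 : ∀ z, 1 < ‖z‖ → B.normed volume =ᶠ[nhds z] fun _ => 0 := by
    intro z hz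
    have h : ∀ᶠ y : E3 in nhds z, 1 < ‖y‖ :=
      continuousAt_const.eventually_lt continuous_norm.continuousAt hz
    refine h.mono fun y hy => ?_
    by_contra hc
    have : y ∈ Function.support (B.normed volume) := hc
    rw [B.support_normed_eq] at this
    simp only [mem_ball, dist_zero_right] at this
    exact absurd (this : ‖y‖ < 1) (not_lt.2 hy.le)
  exact ⟨B.normed volume, B.contDiff_normed, B.hasCompactSupport_normed, B.integral_normed,
    fun z hz => (h0 z hz).eq_of_nhds, fun j z hz => pd_eq_zero_of_eventuallyEq (h0 z hz) j⟩

lemma integrable_restrict_prod_of_isCompact {X Y : Type*} [TopologicalSpace X] [TopologicalSpace Y]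
    [MeasurableSpace X] [MeasurableSpace Y] [BorelSpace X] [BorelSpace Y]
    [SecondCountableTopology X] [SecondCountableTopology Y] [T2Space X] [T2Space Y]
    {μ : Measure X} {ν : Measure Y} [SigmaFinite μ] [SigmaFinite ν]
    [IsFiniteMeasureOnCompacts μ] [IsFiniteMeasureOnCompacts ν] {K : Set X} {L : Set Y}
    (hK : IsCompact K) (hL : IsCompact L) {g : X → Y → ℝ} (hg : Continuous (Function.uncurry g)) :
    Integrable (Function.uncurry g) ((μ.restrict K).prod (ν.restrict L)) := by
  rw [Measure.prod_restrict]
  obtain ⟨M, hM⟩ := (hK.prod hL).exists_bound_of_continuousOn hg.continuousOn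
  refine Measure.integrableOn_of_bounded (M := M) ?_ hg.aestronglyMeasurable ?_
  · rw [Measure.prod_prod]
    exact ENNReal.mul_ne_top hK.measure_lt_top.ne hL.measure_lt_top.ne
  · exact (ae_restrict_iff' (hK.prod hL).measurableSet).2 (ae_of_all _ hM)

lemma setIntegral_setIntegral_swap {X Y : Type*} [TopologicalSpace X] [TopologicalSpace Y]
    [MeasurableSpace X] [MeasurableSpace Y] [BorelSpace X] [BorelSpace Y]
    [SecondCountableTopology X] [SecondCountableTopology Y] [T2Space X] [T2Space Y]
    {μ : Measure X} {ν : Measure Y} [SigmaFinite μ] [SigmaFinite ν]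
    [IsFiniteMeasureOnCompacts μ] [IsFiniteMeasureOnCompacts ν] {K : Set X} {L : Set Y}
    (hK : IsCompact K) (hL : IsCompact L) {g : X → Y → ℝ} (hg : Continuous (Function.uncurry g)) :
    ∫ x in K, ∫ y in L, g x y ∂ν ∂μ = ∫ y in L, ∫ x in K, g x y ∂μ ∂ν :=
  integral_integral_swap (integrable_restrict_prod_of_isCompact hK hL hg)

lemma continuous_setIntegral {X Y : Type*} [TopologicalSpace X] [TopologicalSpace Y]
    [FirstCountableTopology X] [LocallyCompactSpace X]
    [MeasurableSpace Y] [BorelSpace Y] [SecondCountableTopology Y]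
    {ν : Measure Y} [IsLocallyFiniteMeasure ν] {L : Set Y}
    (hL : IsCompact L) {g : X → Y → ℝ} (hg : Continuous (Function.uncurry g)) :
    Continuous fun x => ∫ y in L, g x y ∂ν :=
  continuous_parametric_integral_of_continuous hg hL

/-- The closed spherical shell of radii `ρ` and `r`. -/
def shell (ρ r : ℝ) : Set E3 := {x | ρ ≤ ‖x‖ ∧ ‖x‖ ≤ r}

lemma isCompact_shell (ρ r : ℝ) : IsCompact (shell ρ r) := by
  refine (isCompact_closedBall (0 : E3) r).of_isClosed_subset ?_ fun x hx => by simpa using hx.2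
  exact (isClosed_le continuous_const continuous_norm).inter
    (isClosed_le continuous_norm continuous_const)

lemma sub_smul_mem_shell {ρ r t δ : ℝ} {x z : E3} (hx : x ∈ shell ρ r) (hz : ‖z‖ ≤ 1)
    (ht : 0 ≤ t) (htδ : t ≤ δ) : x - t • z ∈ shell (ρ - δ) (r + δ) := by
  have h1 : ‖t • z‖ ≤ δ := by
    rw [norm_smul, Real.norm_eq_abs, abs_of_nonneg ht]
    nlinarith [norm_nonneg z]
  have h2 := norm_sub_norm_le x (t • z)
  have h3 := norm_sub_le x (t • z)
  exact ⟨by linarith [hx.1], by linarith [hx.2]⟩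

lemma setIntegral_comp_sub_le {e : E3 → ℝ} (he : Continuous e) (he0 : ∀ x, 0 ≤ e x) {A B : Set E3}
    (hA : IsCompact A) (hB : IsCompact B) (w : E3) (hAB : ∀ x ∈ A, x - w ∈ B) :
    ∫ x in A, e (x - w) ≤ ∫ x in B, e x := by
  have h1 : ∫ x in A, e (x - w) = ∫ x, (A.indicator fun x => e (x - w)) x :=
    (integral_indicator hA.measurableSet).symm
  have h2 : ∫ x in B, e x = ∫ x, (B.indicator e) (x - w) := by
    rw [integral_sub_right_eq_self (μ := (volume : Measure E3)) (B.indicator e) w,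
      integral_indicator hB.measurableSet]
  rw [h1, h2]
  have iB : Integrable (B.indicator e) :=
    (integrable_indicator_iff hB.measurableSet).2 (he.continuousOn.integrableOn_compact hB)
  refine integral_mono ?_ (iB.comp_sub_right w) fun x => ?_
  · exact (integrable_indicator_iff hA.measurableSet).2
      ((he.comp (continuous_id.sub continuous_const)).continuousOn.integrableOn_compact hA)
  · by_cases hx : x ∈ A
    · simp [hx, hAB x hx]
    · simp only [hx, not_false_eq_true, Set.indicator_of_notMem]
      exact Set.indicator_nonneg (fun y _ => he0 y) _

/-- A double integral with kernel controlled by `e x + e (x - t z)`. -/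
lemma abs_setIntegral_shell_le {e : E3 → ℝ} (he : Continuous e) (he0 : ∀ x, 0 ≤ e x)
    {ρ r t δ c : ℝ} (hρ : ρ - δ ≤ ρ) (ht : 0 ≤ t) (htδ : t ≤ δ) (hc : 0 ≤ c) {Φ : E3 → E3 → ℝ}
    (hb : ∀ x ∈ shell ρ r, ∀ z, ‖z‖ ≤ 1 → |Φ x z| ≤ c * (e x + e (x - t • z))) :
    |∫ x in shell ρ r, ∫ z in closedBall (0 : E3) 1, Φ x z| ≤
      c * (2 * volume.real (closedBall (0 : E3) 1)) * ∫ x in shell (ρ - δ) (r + δ), e x := by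
  have hS := isCompact_shell ρ r
  have hB := isCompact_closedBall (0 : E3) 1
  have hg : Continuous (Function.uncurry fun x z : E3 => c * (e x + e (x - t • z))) := by
    simp only [Function.uncurry_def]
    fun_prop
  have hδ : 0 ≤ δ := by linarith
  have step : |∫ x in shell ρ r, ∫ z in closedBall (0 : E3) 1, Φ x z| ≤
      ∫ x in shell ρ r, ∫ z in closedBall (0 : E3) 1, c * (e x + e (x - t • z)) := by
    rw [← Real.norm_eq_abs]
    have hcg := continuous_setIntegral (ν := (volume : Measure E3)) hB hg
    refine norm_integral_le_of_norm_le (hcg.continuousOn.integrableOn_compact hS) ?_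
    refine (ae_restrict_iff' hS.measurableSet).2 (ae_of_all _ fun x hx => ?_)
    have hcx : Continuous fun z => c * (e x + e (x - t • z)) := by fun_prop
    refine norm_integral_le_of_norm_le (hcx.continuousOn.integrableOn_compact hB) ?_
    · refine (ae_restrict_iff' hB.measurableSet).2 (ae_of_all _ fun z hz => hb x hx z ?_)
      simpa using hz
  refine step.trans ?_
  rw [setIntegral_setIntegral_swap hS hB hg]
  have hI : 0 ≤ ∫ x in shell (ρ - δ) (r + δ), e x := integral_nonneg he0
  have each : ∀ z ∈ closedBall (0 : E3) 1, ∫ x in shell ρ r, c * (e x + e (x - t • z)) ≤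
      c * (2 * ∫ x in shell (ρ - δ) (r + δ), e x) := by
    intro z hz
    have hz' : ‖z‖ ≤ 1 := by simpa using hz
    have he' : Continuous fun x => e (x - t • z) := by fun_prop
    rw [integral_const_mul, integral_add (he.continuousOn.integrableOn_compact hS)
      (he'.continuousOn.integrableOn_compact hS)]
    have b1 : ∫ x in shell ρ r, e x ≤ ∫ x in shell (ρ - δ) (r + δ), e x := by
      refine setIntegral_mono_set (he.continuousOn.integrableOn_compact (isCompact_shell _ _))
        (ae_of_all _ he0) (LE.le.eventuallyLE fun x hx => ?_)
      exact ⟨by linarith [hx.1], by linarith [hx.2]⟩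
    have b2 : ∫ x in shell ρ r, e (x - t • z) ≤ ∫ x in shell (ρ - δ) (r + δ), e x :=
      setIntegral_comp_sub_le he he0 hS (isCompact_shell _ _) (t • z)
        fun x hx => sub_smul_mem_shell hx hz' ht htδ
    gcongr
    linarith
  have hg' : Continuous (Function.uncurry fun z x : E3 => c * (e x + e (x - t • z))) := by
    simp only [Function.uncurry_def]
    fun_prop
  calc _ ≤ ∫ z in closedBall (0 : E3) 1, c * (2 * ∫ x in shell (ρ - δ) (r + δ), e x) :=
        setIntegral_mono_on ((continuous_setIntegral hS hg').continuousOn.integrableOn_compact hB)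
          (continuousOn_const.integrableOn_compact hB) hB.measurableSet each
    _ = _ := by
        rw [setIntegral_const, smul_eq_mul]
        ring

namespace SmoothNS

variable {u : E3 → E3} {p : E3 → ℝ}

/-- Integration by parts of the pressure gradient against a rescaled kernel. -/
lemma integral_mul_pd_pressure (h : SmoothNS u p) {k : E3 → ℝ} (hk : Smooth k)
    (hc : HasCompactSupport k) (i : Fin 3) (y : E3) {t : ℝ} (ht : t ≠ 0) :
    ∫ z, k z * pd i p (y - t • z) = ∫ z, t⁻¹ * ∑ j, pd j k z * stress u i j (y - t • z) := by
  have hs : ∀ j, Smooth fun z => k z * stress u i j (y - t • z) := fun j =>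
    hk.mul ((h.smooth_stress i j).comp_sub_smul y t)
  have hcs : ∀ j, HasCompactSupport fun z => k z * stress u i j (y - t • z) := fun j =>
    hc.mul_right
  have i1 : Integrable fun z => k z * pd i p (y - t • z) :=
    Smooth.integrable (hk.mul ((h.smooth_p.pd i).comp_sub_smul y t)) hc.mul_right
  have i2 : Integrable fun z => t⁻¹ * ∑ j, pd j (fun z => k z * stress u i j (y - t • z)) z :=
    (integrable_finsetSum _ fun j _ => ((hs j).pd j).integrable ((hcs j).pd j)).const_mul _
  have i3 : ∫ z, t⁻¹ * ∑ j, pd j (fun z => k z * stress u i j (y - t • z)) z = 0 := by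
    rw [integral_const_mul,
      integral_finsetSum _ fun j _ => ((hs j).pd j).integrable ((hcs j).pd j)]
    simp [integral_pd_eq_zero (hs _) (hcs _)]
  rw [← add_zero (∫ z, k z * pd i p (y - t • z)), ← i3, ← integral_add i1 i2]
  congr 1
  funext z
  simp only [pd_mul hk ((h.smooth_stress _ _).comp_sub_smul y t),
    pd_comp_sub_smul (h.smooth_stress _ _), h.pd_pressure, Fin.sum_univ_three]
  field_simp
  ring

lemma integral_mul_pd_pressure_sub (h : SmoothNS u p) {f : E3 → ℝ} (hf : Smooth f)
    (hc : HasCompactSupport f) (i : Fin 3) (w : E3) :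
    ∫ x, f x * pd i p (x - w) = ∫ x, - ∑ j, pd j f x * stress u i j (x - w) := by
  have hs : ∀ j, Smooth fun x => f x * stress u i j (x - w) := fun j =>
    hf.mul ((h.smooth_stress i j).sub_const w)
  have hcs : ∀ j, HasCompactSupport fun x => f x * stress u i j (x - w) := fun j =>
    hc.mul_right
  have i1 : Integrable fun x => - ∑ j, pd j f x * stress u i j (x - w) :=
    (integrable_finsetSum _ fun j _ => Smooth.integrable
      ((hf.pd j).mul ((h.smooth_stress i j).sub_const w))
      (HasCompactSupport.mul_right (hc.pd j))).neg
  have i2 : Integrable fun x => ∑ j, pd j (fun x => f x * stress u i j (x - w)) x :=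
    integrable_finsetSum _ fun j _ => ((hs j).pd j).integrable ((hcs j).pd j)
  have i3 : ∫ x, ∑ j, pd j (fun x => f x * stress u i j (x - w)) x = 0 := by
    rw [integral_finsetSum _ fun j _ => ((hs j).pd j).integrable ((hcs j).pd j)]
    simp [integral_pd_eq_zero (hs _) (hcs _)]
  rw [← add_zero (∫ x, - ∑ j, pd j f x * stress u i j (x - w)), ← i3, ← integral_add i1 i2]
  congr 1
  funext x
  simp only [pd_mul hf ((h.smooth_stress _ _).sub_const w),
    pd_comp_sub, h.pd_pressure, Fin.sum_univ_three]
  ring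

end SmoothNS

lemma abs_setIntegral_Icc_le {B : ℝ → ℝ} {a b δ ε : ℝ} (hδ : 0 < δ) (hδ1 : δ ≤ 1) (hε : 0 < ε)
    (hε1 : ε ≤ 1) (ha : 0 ≤ a) (hb : 0 ≤ b) (h1 : ∀ t, 0 < t → t ≤ δ → |B t| ≤ a / t)
    (h2 : ∀ t, 0 < t → t ≤ δ → |B t| ≤ b) :
    |∫ t in Set.Icc 0 δ, B t| ≤ a ^ (1 - ε) * b ^ ε / ε := by
  rw [integral_Icc_eq_integral_Ioc, ← Real.norm_eq_abs]
  have hpt : ∀ t ∈ Set.Ioc 0 δ, ‖B t‖ ≤ a ^ (1 - ε) * b ^ ε * t ^ (ε - 1) := by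
    intro t ht
    rw [Real.norm_eq_abs]
    have k1 := h1 t ht.1 ht.2
    have k2 := h2 t ht.1 ht.2
    calc |B t| = |B t| ^ (1 - ε) * |B t| ^ ε := by
          rw [← Real.rpow_add_of_nonneg (abs_nonneg _) (by linarith) hε.le]
          simp
      _ ≤ (a / t) ^ (1 - ε) * b ^ ε := by
          have k3 : 0 ≤ a / t := (abs_nonneg _).trans k1
          gcongr
      _ = _ := by
          rw [Real.div_rpow ha ht.1.le, div_eq_mul_inv, ← Real.rpow_neg ht.1.le]
          rw [show -(1 - ε) = ε - 1 by ring]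
          ring
  have hi : IntervalIntegrable (fun t : ℝ => a ^ (1 - ε) * b ^ ε * t ^ (ε - 1)) volume 0 δ :=
    (intervalIntegral.intervalIntegrable_rpow' (by linarith)).const_mul _
  refine (norm_integral_le_of_norm_le ((intervalIntegrable_iff_integrableOn_Ioc_of_le hδ.le).1 hi)
    ((ae_restrict_iff' measurableSet_Ioc).2 (ae_of_all _ hpt))).trans ?_
  rw [← intervalIntegral.integral_of_le hδ.le, intervalIntegral.integral_const_mul,
    integral_rpow (Or.inl (by linarith))]
  simp only [sub_add_cancel, Real.zero_rpow hε.ne', sub_zero]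
  have : δ ^ ε ≤ 1 := Real.rpow_le_one hδ.le hδ1 hε.le
  rw [← mul_div_assoc]
  exact div_le_div_of_nonneg_right (mul_le_of_le_one_right (by positivity) this) hε.le

/-- Energy density with a weight balancing the gradient against the velocity. -/
def energyDensity (κ : ℝ) (u : E3 → E3) (x : E3) : ℝ :=
  κ * gradSq u x + κ⁻¹ * ‖u x‖ ^ 2 + ‖u x‖ ^ 3

def highDensity (u : E3 → E3) (x : E3) : ℝ := ‖u x‖ ^ 2 + gradSq u x + ‖u x‖ ^ 4

def stressAbs (u : E3 → E3) (x : E3) : ℝ := ∑ i, ∑ j, |stress u i j x|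

lemma gradSq_nonneg (u : E3 → E3) (x : E3) : 0 ≤ gradSq u x :=
  Finset.sum_nonneg fun _ _ => Finset.sum_nonneg fun _ _ => sq_nonneg _

lemma pd_sq_le_gradSq (u : E3 → E3) (x : E3) (i j : Fin 3) :
    pd j (coord u i) x ^ 2 ≤ gradSq u x :=
  (Finset.single_le_sum (f := fun j => pd j (coord u i) x ^ 2) (fun _ _ => sq_nonneg _)
    (Finset.mem_univ j)).trans
  (Finset.single_le_sum (f := fun i => ∑ j, pd j (coord u i) x ^ 2)
    (fun _ _ => Finset.sum_nonneg fun _ _ => sq_nonneg _) (Finset.mem_univ i))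

lemma abs_pd_le_sqrt (u : E3 → E3) (x : E3) (i j : Fin 3) :
    |pd j (coord u i) x| ≤ √(gradSq u x) := by
  rw [← Real.sqrt_sq_eq_abs]
  exact Real.sqrt_le_sqrt (pd_sq_le_gradSq u x i j)

lemma abs_stress_le (u : E3 → E3) (x : E3) (i j : Fin 3) :
    |stress u i j x| ≤ √(gradSq u x) + ‖u x‖ ^ 2 := by
  refine (abs_sub _ _).trans (add_le_add (abs_pd_le_sqrt u x i j) ?_)
  rw [abs_mul, sq]
  exact mul_le_mul (abs_coord_le_norm _ _) (abs_coord_le_norm _ _) (abs_nonneg _) (norm_nonneg _)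

lemma stressAbs_nonneg (u : E3 → E3) (x : E3) : 0 ≤ stressAbs u x :=
  Finset.sum_nonneg fun _ _ => Finset.sum_nonneg fun _ _ => abs_nonneg _

lemma stressAbs_le (u : E3 → E3) (x : E3) : stressAbs u x ≤ 9 * (√(gradSq u x) + ‖u x‖ ^ 2) := by
  calc stressAbs u x ≤ ∑ _i : Fin 3, ∑ _j : Fin 3, (√(gradSq u x) + ‖u x‖ ^ 2) :=
        Finset.sum_le_sum fun i _ => Finset.sum_le_sum fun j _ => abs_stress_le u x i j
    _ = _ := by simp; ring

lemma energyDensity_nonneg {κ : ℝ} (hκ : 0 < κ) (u : E3 → E3) (x : E3) :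
    0 ≤ energyDensity κ u x := by
  have := gradSq_nonneg u x
  unfold energyDensity
  positivity

lemma highDensity_nonneg (u : E3 → E3) (x : E3) : 0 ≤ highDensity u x := by
  have := gradSq_nonneg u x
  unfold highDensity
  positivity

lemma mul_sq_le_cube_add_cube {a b : ℝ} (ha : 0 ≤ a) (hb : 0 ≤ b) : a * b ^ 2 ≤ a ^ 3 + b ^ 3 := by
  rcases le_total a b with h | h
  · nlinarith [pow_nonneg ha 3, mul_nonneg (sub_nonneg.2 h) (sq_nonneg b)]
  · have : a * b ^ 2 ≤ a * a ^ 2 := by gcongr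
    nlinarith [pow_nonneg hb 3]

lemma mul_sqrt_le {κ a g : ℝ} (hκ : 0 < κ) (hg : 0 ≤ g) : a * √g ≤ κ * g + κ⁻¹ * a ^ 2 := by
  have h1 := Real.sq_sqrt hg
  have h2 : 0 ≤ κ⁻¹ * (κ * √g - a) ^ 2 := by positivity
  have h3 : 0 ≤ κ⁻¹ * a ^ 2 := by positivity
  have h4 : κ⁻¹ * (κ * √g - a) ^ 2 = κ * g - 2 * (a * √g) + κ⁻¹ * a ^ 2 := by
    rw [← h1, Real.sqrt_sq (Real.sqrt_nonneg g)]
    field_simp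
    ring
  have h5 : 0 ≤ κ * g := by positivity
  linarith

lemma norm_mul_stressAbs_le {κ : ℝ} (hκ : 0 < κ) (u : E3 → E3) (x y : E3) :
    ‖u x‖ * stressAbs u y ≤ 9 * (energyDensity κ u x + energyDensity κ u y) := by
  have h0 := mul_le_mul_of_nonneg_left (stressAbs_le u y) (norm_nonneg (u x))
  have h1 := mul_sqrt_le (a := ‖u x‖) hκ (gradSq_nonneg u y)
  have h2 := mul_sq_le_cube_add_cube (norm_nonneg (u x)) (norm_nonneg (u y))
  have h3 : 0 ≤ κ * gradSq u x := mul_nonneg hκ.le (gradSq_nonneg u x)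
  have h4 : 0 ≤ κ⁻¹ * ‖u y‖ ^ 2 := by positivity
  unfold energyDensity
  linarith

lemma add_sqrt_mul_stressAbs_le (u : E3 → E3) (x y : E3) :
    (‖u x‖ + √(gradSq u x)) * stressAbs u y ≤ 9 * (highDensity u x + highDensity u y) := by
  have h0 := mul_le_mul_of_nonneg_left (stressAbs_le u y)
    (add_nonneg (norm_nonneg (u x)) (Real.sqrt_nonneg (gradSq u x)))
  have h1 := Real.sq_sqrt (gradSq_nonneg u x)
  have h2 := Real.sq_sqrt (gradSq_nonneg u y)
  unfold highDensity
  nlinarith [sq_nonneg (‖u x‖ + √(gradSq u x) - (√(gradSq u y) + ‖u y‖ ^ 2)),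
    sq_nonneg (‖u x‖ - √(gradSq u x)), sq_nonneg (√(gradSq u y) - ‖u y‖ ^ 2), sq_nonneg (‖u y‖),
    pow_nonneg (norm_nonneg (u x)) 4]

namespace SmoothNS

variable {u : E3 → E3} {p : E3 → ℝ}

lemma continuous (h : SmoothNS u p) : Continuous u :=
  (contDiff_euclidean.2 h.smooth : ContDiff ℝ (⊤ : ℕ∞) u).continuous

lemma continuous_pd_coord (h : SmoothNS u p) (i j : Fin 3) : Continuous (pd j (coord u i)) :=
  ((h.smooth i).pd j).continuous

lemma continuous_gradSq (h : SmoothNS u p) : Continuous (gradSq u) := by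
  unfold gradSq
  exact continuous_finsetSum _ fun i _ => continuous_finsetSum _ fun j _ =>
    (h.continuous_pd_coord i j).pow 2

lemma continuous_stress (h : SmoothNS u p) (i j : Fin 3) : Continuous (stress u i j) :=
  (h.smooth_stress i j).continuous

lemma continuous_stressAbs (h : SmoothNS u p) : Continuous (stressAbs u) := by
  unfold stressAbs
  exact continuous_finsetSum _ fun i _ => continuous_finsetSum _ fun j _ =>
    (h.continuous_stress i j).abs

lemma continuous_energyDensity (h : SmoothNS u p) (κ : ℝ) : Continuous (energyDensity κ u) := by
  have := h.continuous
  have := h.continuous_gradSq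
  unfold energyDensity
  fun_prop

lemma continuous_highDensity (h : SmoothNS u p) : Continuous (highDensity u) := by
  have := h.continuous
  have := h.continuous_gradSq
  unfold highDensity
  fun_prop

end SmoothNS

lemma setIntegral_closedBall_eq {g : E3 → ℝ} (hg : ∀ z, 1 < ‖z‖ → g z = 0) :
    ∫ z in closedBall (0 : E3) 1, g z = ∫ z, g z :=
  setIntegral_eq_integral_of_forall_compl_eq_zero fun z hz => hg z (by simpa using hz)

lemma abs_sum_sum_mul_stress_le {u : E3 → E3} {y : E3} {a : Fin 3 → Fin 3 → ℝ} {M : ℝ}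
    (ha : ∀ i j, |a i j| ≤ M) : |∑ i, ∑ j, a i j * stress u i j y| ≤ M * stressAbs u y := by
  rw [stressAbs, Finset.mul_sum]
  refine (Finset.abs_sum_le_sum_abs _ _).trans (Finset.sum_le_sum fun i _ => ?_)
  rw [Finset.mul_sum]
  refine (Finset.abs_sum_le_sum_abs _ _).trans (Finset.sum_le_sum fun j _ => ?_)
  rw [abs_mul]
  exact mul_le_mul_of_nonneg_right (ha i j) (abs_nonneg _)

lemma smooth_apply (i : Fin 3) : Smooth (fun y : E3 => y i) :=
  (EuclideanSpace.proj (𝕜 := ℝ) i : E3 →L[ℝ] ℝ).contDiff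

lemma abs_pd_apply_le (i j : Fin 3) (x : E3) : |pd j (fun y : E3 => y i) x| ≤ 1 := by
  simpa using pd_const_mul_coord 1 j i x

/-- A smooth kernel supported in the unit ball, bounded by `M` together with its gradient. -/
structure BallKernel (η : E3 → ℝ) (M : ℝ) : Prop where
  smooth : Smooth η
  compact : HasCompactSupport η
  zero : ∀ z, 1 < ‖z‖ → η z = 0
  pd_zero : ∀ j z, 1 < ‖z‖ → pd j η z = 0
  bound : ∀ z, |η z| ≤ M
  pd_bound : ∀ j z, |pd j η z| ≤ M

lemma exists_ballKernel : ∃ (η : E3 → ℝ) (M : ℝ), 0 < M ∧ BallKernel η M ∧ ∫ z, η z = 1 := by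
  obtain ⟨η, h1, h2, h3, h4, h5⟩ := exists_mollifier
  obtain ⟨M0, hM0⟩ := h1.continuous.bounded_above_of_compact_support h2
  have : ∀ j, ∃ M, ∀ z, ‖pd j η z‖ ≤ M := fun j =>
    (h1.pd j).continuous.bounded_above_of_compact_support (h2.pd j)
  choose M1 hM1 using this
  refine ⟨η, 1 + |M0| + ∑ j, |M1 j|, by positivity, ⟨h1, h2, h4, h5, fun z => ?_, fun j z => ?_⟩, h3⟩
  · have := (hM0 z).trans (le_abs_self _)
    have h' : 0 ≤ ∑ j, |M1 j| := by positivity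
    rw [Real.norm_eq_abs] at this
    linarith
  · have := (hM1 j z).trans (le_abs_self _)
    have h' := Finset.single_le_sum (f := fun j => |M1 j|) (fun _ _ => abs_nonneg _)
      (Finset.mem_univ j)
    rw [Real.norm_eq_abs] at this
    linarith [abs_nonneg M0]

lemma BallKernel.mul_apply {η : E3 → ℝ} {M : ℝ} (hη : BallKernel η M) (i : Fin 3) :
    Smooth (fun z => η z * z i) ∧ HasCompactSupport (fun z => η z * z i) ∧
    (∀ z, 1 < ‖z‖ → η z * z i = 0) ∧ (∀ j z, 1 < ‖z‖ → pd j (fun z => η z * z i) z = 0) ∧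
    (∀ j z, |pd j (fun z => η z * z i) z| ≤ 2 * M) := by
  have e : ∀ j z, pd j (fun z => η z * z i) z = pd j η z * z i + η z * pd j (fun z => z i) z :=
    fun j z => pd_mul hη.smooth (smooth_apply i) j z
  refine ⟨hη.smooth.mul (smooth_apply i), hη.compact.mul_right, fun z hz => ?_, fun j z hz => ?_,
    fun j z => ?_⟩
  · rw [hη.zero z hz, zero_mul]
  · rw [e, hη.zero z hz, hη.pd_zero j z hz]
    simp
  · rw [e]
    rcases lt_or_ge 1 ‖z‖ with hz | hz
    · rw [hη.zero z hz, hη.pd_zero j z hz]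
      simpa using (abs_nonneg _).trans (hη.bound z)
    · have h1 : |pd j η z * z i| ≤ M := by
        rw [abs_mul]
        calc _ ≤ M * 1 := mul_le_mul (hη.pd_bound j z) ((abs_coord_le_norm z i).trans hz)
              (abs_nonneg _) ((abs_nonneg _).trans (hη.bound z))
          _ = M := mul_one M
      have h2 : |η z * pd j (fun z => z i) z| ≤ M := by
        rw [abs_mul]
        calc _ ≤ M * 1 := mul_le_mul (hη.bound z) (abs_pd_apply_le i j z)
              (abs_nonneg _) ((abs_nonneg _).trans (hη.bound z))
          _ = M := mul_one M
      linarith [abs_add_le (pd j η z * z i) (η z * pd j (fun z => z i) z)]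

/-- The derivative in `-t` of the average of `p` over a ball of radius `t`. -/
def avgDeriv (η p : E3 → ℝ) (t : ℝ) (x : E3) : ℝ :=
  ∫ z in closedBall (0 : E3) 1, η z * ∑ i, z i * pd i p (x - t • z)

lemma continuous_avgDeriv {η p : E3 → ℝ} (hη : Smooth η) (hp : Smooth p) :
    Continuous (Function.uncurry (avgDeriv η p)) := by
  have h : ∀ i, Continuous (pd i p) := fun i => (hp.pd i).continuous
  have h' := hη.continuous
  have := continuous_setIntegral (ν := (volume : Measure E3)) (isCompact_closedBall (0 : E3) 1)
    (g := fun (q : ℝ × E3) z => η z * ∑ i, z i * pd i p (q.2 - q.1 • z)) (by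
      simp only [Function.uncurry_def]
      refine (h'.comp continuous_snd).mul (continuous_finsetSum _ fun i _ => ?_)
      refine ((smooth_apply i).continuous.comp continuous_snd).mul ((h i).comp ?_)
      fun_prop)
  exact this

lemma sub_avg_eq {η p : E3 → ℝ} (hη : Smooth η) (h1 : ∫ z in closedBall (0 : E3) 1, η z = 1)
    (hp : Smooth p) {δ : ℝ} (hδ : 0 ≤ δ) (x : E3) :
    p x - ∫ z in closedBall (0 : E3) 1, η z * p (x - δ • z) =
      ∫ t in Set.Icc 0 δ, avgDeriv η p t x := by
  have h : ∀ i, Continuous (pd i p) := fun i => (hp.pd i).continuous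
  have h' := hη.continuous
  have h'' := hp.continuous
  have hB := isCompact_closedBall (0 : E3) 1
  unfold avgDeriv
  rw [setIntegral_setIntegral_swap (μ := volume) (ν := volume)
    (g := fun t z => η z * ∑ i, z i * pd i p (x - t • z)) isCompact_Icc hB]
  · have e1 : p x = ∫ z in closedBall (0 : E3) 1, η z * p x := by
      rw [integral_mul_const, h1, one_mul]
    have c1 : Continuous fun z => η z * p x := by fun_prop
    have c2 : Continuous fun z => η z * p (x - δ • z) := by fun_prop
    conv_lhs => rw [e1]
    rw [← integral_sub (c1.continuousOn.integrableOn_compact hB)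
      (c2.continuousOn.integrableOn_compact hB)]
    congr 1
    funext z
    have := sub_eq_integral_pd hp x (-z) δ
    rw [integral_const_mul, integral_Icc_eq_integral_Ioc, ← intervalIntegral.integral_of_le hδ,
      ← mul_sub]
    congr 1
    rw [show x - δ • z = x + δ • (-z) by simp [sub_eq_add_neg], ← neg_sub, this,
      ← intervalIntegral.integral_neg]
    congr 1
    funext t
    simp [sub_eq_add_neg]
  · simp only [Function.uncurry_def]
    refine (h'.comp continuous_snd).mul (continuous_finsetSum _ fun i _ => ?_)
    refine ((smooth_apply i).continuous.comp continuous_snd).mul ((h i).comp ?_)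
    fun_prop

namespace SmoothNS

variable {u : E3 → E3} {p : E3 → ℝ}

lemma setIntegral_mul_pd_pressure (h : SmoothNS u p) {k : E3 → ℝ} (hk : Smooth k)
    (hc : HasCompactSupport k) (h0 : ∀ z, 1 < ‖z‖ → k z = 0)
    (h1 : ∀ j z, 1 < ‖z‖ → pd j k z = 0) (i : Fin 3) (y : E3) {t : ℝ} (ht : t ≠ 0) :
    ∫ z in closedBall (0 : E3) 1, k z * pd i p (y - t • z) =
      ∫ z in closedBall (0 : E3) 1, t⁻¹ * ∑ j, pd j k z * stress u i j (y - t • z) := by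
  rw [setIntegral_closedBall_eq fun z hz => by simp [h0 z hz],
    setIntegral_closedBall_eq fun z hz => by simp [h1 _ z hz],
    h.integral_mul_pd_pressure hk hc i y ht]

lemma avgDeriv_eq (h : SmoothNS u p) {η : E3 → ℝ} {M : ℝ} (hη : BallKernel η M) {t : ℝ}
    (ht : t ≠ 0) (x : E3) : avgDeriv η p t x = ∫ z in closedBall (0 : E3) 1,
      t⁻¹ * ∑ i, ∑ j, pd j (fun z => η z * z i) z * stress u i j (x - t • z) := by
  have hB := isCompact_closedBall (0 : E3) 1
  have e : ∀ z, η z * ∑ i, z i * pd i p (x - t • z) = ∑ i, (η z * z i) * pd i p (x - t • z) := by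
    intro z
    rw [Finset.mul_sum]
    simp only [mul_assoc]
  unfold avgDeriv
  simp only [e, Finset.mul_sum _ _ t⁻¹]
  rw [integral_finsetSum, integral_finsetSum]
  · refine Finset.sum_congr rfl fun i _ => ?_
    obtain ⟨a1, a2, a3, a4, -⟩ := hη.mul_apply i
    rw [h.setIntegral_mul_pd_pressure a1 a2 a3 a4 i x ht]
    simp only [Finset.mul_sum]
  · intro i _
    obtain ⟨a1, -⟩ := hη.mul_apply i
    refine Continuous.continuousOn ?_ |>.integrableOn_compact hB
    refine continuous_finsetSum _ fun j _ => continuous_const.mul ((a1.pd j).continuous.mul ?_)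
    exact ((h.smooth_stress i j).comp_sub_smul x t).continuous
  · intro i _
    obtain ⟨a1, -⟩ := hη.mul_apply i
    refine Continuous.continuousOn ?_ |>.integrableOn_compact hB
    exact a1.continuous.mul ((h.smooth_p.pd i).comp_sub_smul x t).continuous

end SmoothNS

/-- A smooth function supported in a spherical shell with bounds in terms of a vector field. -/
structure ShellFun (u : E3 → E3) (f : E3 → ℝ) (ρ r c₁ c₂ : ℝ) : Prop where
  smooth : Smooth f
  zero : ∀ x, x ∉ shell ρ r → f x = 0
  pd_zero : ∀ j x, x ∉ shell ρ r → pd j f x = 0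
  bound : ∀ x, |f x| ≤ c₁ * ‖u x‖
  pd_bound : ∀ j x, |pd j f x| ≤ c₂ * (‖u x‖ + √(gradSq u x))

lemma ShellFun.compact {u : E3 → E3} {f : E3 → ℝ} {ρ r c₁ c₂ : ℝ} (hf : ShellFun u f ρ r c₁ c₂) :
    HasCompactSupport f :=
  HasCompactSupport.intro (isCompact_shell ρ r) hf.zero

lemma setIntegral_shell_eq {g : E3 → ℝ} {ρ r : ℝ} (hg : ∀ x, x ∉ shell ρ r → g x = 0) :
    ∫ x in shell ρ r, g x = ∫ x, g x :=
  setIntegral_eq_integral_of_forall_compl_eq_zero fun x hx => hg x hx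

namespace SmoothNS

variable {u : E3 → E3} {p : E3 → ℝ}

lemma abs_integral_mul_avgDeriv_le_div (h : SmoothNS u p) {η f : E3 → ℝ} {M ρ r δ t c₁ c₂ κ : ℝ}
    (hη : BallKernel η M) (hM : 0 < M) (hf : ShellFun u f ρ r c₁ c₂) (hc : 0 ≤ c₁) (hκ : 0 < κ)
    (ht : 0 < t) (htδ : t ≤ δ) :
    |∫ x in shell ρ r, f x * avgDeriv η p t x| ≤
      (36 * M * volume.real (closedBall (0 : E3) 1) * c₁ *
        ∫ x in shell (ρ - δ) (r + δ), energyDensity κ u x) / t := by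
  conv_lhs => simp only [h.avgDeriv_eq hη ht.ne', ← integral_const_mul (f _)]
  refine (abs_setIntegral_shell_le (h.continuous_energyDensity κ)
    (energyDensity_nonneg hκ u) (by linarith) ht.le htδ (c := 18 * M * c₁ / t) (by positivity)
    fun x _ z _ => ?_).trans (le_of_eq (by ring))
  rw [abs_mul, abs_mul, abs_of_pos (inv_pos.2 ht)]
  have k1 := abs_sum_sum_mul_stress_le (u := u) (y := x - t • z)
    (fun i j => (hη.mul_apply i).2.2.2.2 j z)
  have k2 := norm_mul_stressAbs_le hκ u x (x - t • z)
  have k3 := hf.bound x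
  calc _ ≤ (c₁ * ‖u x‖) * (t⁻¹ * (2 * M * stressAbs u (x - t • z))) := by gcongr
    _ = c₁ * t⁻¹ * (2 * M) * (‖u x‖ * stressAbs u (x - t • z)) := by ring
    _ ≤ c₁ * t⁻¹ * (2 * M) * (9 * (energyDensity κ u x + energyDensity κ u (x - t • z))) := by
        gcongr
    _ = _ := by ring

lemma abs_integral_mul_avgDeriv_le (h : SmoothNS u p) {η f : E3 → ℝ} {M ρ r δ t c₁ c₂ : ℝ}
    (hη : BallKernel η M) (hM : 0 < M) (hf : ShellFun u f ρ r c₁ c₂) (hc : 0 ≤ c₂)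
    (ht : 0 < t) (htδ : t ≤ δ) :
    |∫ x in shell ρ r, f x * avgDeriv η p t x| ≤
      18 * M * volume.real (closedBall (0 : E3) 1) * c₂ *
        ∫ x in shell (ρ - δ) (r + δ), highDensity u x := by
  have hS := isCompact_shell ρ r
  have hB := isCompact_closedBall (0 : E3) 1
  have cη := hη.smooth.continuous
  have cf := hf.smooth.continuous
  have cs : ∀ i j, Continuous fun q : E3 × E3 => stress u i j (q.2 - t • q.1) := fun i j =>
    (h.continuous_stress i j).comp (by fun_prop)
  have cs' : ∀ i j, Continuous fun q : E3 × E3 => stress u i j (q.1 - t • q.2) := fun i j =>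
    (h.continuous_stress i j).comp (by fun_prop)
  have cp : ∀ i, Continuous fun q : E3 × E3 => pd i p (q.1 - t • q.2) := fun i =>
    (h.smooth_p.pd i).continuous.comp (by fun_prop)
  have e1 : ∫ x in shell ρ r, f x * avgDeriv η p t x =
      ∫ x in shell ρ r, ∫ z in closedBall (0 : E3) 1,
        -∑ i, ∑ j, (η z * z i * pd j f x) * stress u i j (x - t • z) := by
    unfold avgDeriv
    simp only [← integral_const_mul]
    rw [setIntegral_setIntegral_swap (μ := volume) (ν := volume) hS hB
      (g := fun x z => f x * (η z * ∑ i, z i * pd i p (x - t • z))),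
      setIntegral_setIntegral_swap (μ := volume) (ν := volume) hS hB
      (g := fun x z => -∑ i, ∑ j, (η z * z i * pd j f x) * stress u i j (x - t • z))]
    · congr 1
      funext z
      have a1 : ∀ x, f x * (η z * ∑ i, z i * pd i p (x - t • z)) =
          ∑ i, (η z * z i) * (f x * pd i p (x - t • z)) := by
        intro x
        simp only [Finset.mul_sum]
        exact Finset.sum_congr rfl fun i _ => by ring
      have a2 : ∀ x, -∑ i, ∑ j, (η z * z i * pd j f x) * stress u i j (x - t • z) =
          ∑ i, (η z * z i) * (-∑ j, pd j f x * stress u i j (x - t • z)) := by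
        intro x
        simp only [Fin.sum_univ_three]
        ring
      simp only [a1, a2]
      rw [integral_finsetSum, integral_finsetSum]
      · refine Finset.sum_congr rfl fun i _ => ?_
        rw [integral_const_mul, integral_const_mul,
          setIntegral_shell_eq fun x hx => by simp [hf.zero x hx],
          setIntegral_shell_eq fun x hx => by simp [hf.pd_zero _ x hx],
          h.integral_mul_pd_pressure_sub hf.smooth hf.compact i (t • z)]
      · intro i _
        refine Continuous.continuousOn ?_ |>.integrableOn_compact hS
        refine continuous_const.mul (continuous_finsetSum _ fun j _ => ?_).neg
        exact (hf.smooth.pd j).continuous.mul ((h.smooth_stress i j).sub_const (t • z)).continuous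
      · intro i _
        refine Continuous.continuousOn ?_ |>.integrableOn_compact hS
        exact continuous_const.mul (cf.mul ((h.smooth_p.pd i).sub_const (t • z)).continuous)
    · simp only [Function.uncurry_def]
      refine (continuous_finsetSum _ fun i _ => continuous_finsetSum _ fun j _ => ?_).neg
      exact (((cη.comp continuous_snd).mul ((smooth_apply i).continuous.comp continuous_snd)).mul
        ((hf.smooth.pd j).continuous.comp continuous_fst)).mul (cs' i j)
    · simp only [Function.uncurry_def]
      exact (cf.comp continuous_fst).mul ((cη.comp continuous_snd).mul
        (continuous_finsetSum _ fun i _ =>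
          ((smooth_apply i).continuous.comp continuous_snd).mul (cp i)))
  rw [e1]
  refine (abs_setIntegral_shell_le h.continuous_highDensity
    (highDensity_nonneg u) (by linarith) ht.le htδ (c := 9 * M * c₂) (by positivity)
    fun x _ z hz => ?_).trans (le_of_eq (by ring))
  rw [abs_neg]
  have k1 := abs_sum_sum_mul_stress_le (u := u) (y := x - t • z)
    (a := fun i j => η z * z i * pd j f x) (M := M * 1 * (c₂ * (‖u x‖ + √(gradSq u x))))
    (fun i j => by
      rw [abs_mul, abs_mul]
      have b1 := hη.bound z
      have b2 := (abs_coord_le_norm z i).trans hz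
      have b3 := hf.pd_bound j x
      gcongr)
  have k2 := add_sqrt_mul_stressAbs_le u x (x - t • z)
  calc _ ≤ _ := k1
    _ = M * c₂ * ((‖u x‖ + √(gradSq u x)) * stressAbs u (x - t • z)) := by ring
    _ ≤ M * c₂ * (9 * (highDensity u x + highDensity u (x - t • z))) := by gcongr
    _ = _ := by ring

/-- The pressure tested against the difference of a shell function and its mollification. -/
lemma abs_integral_mul_sub_avg_le (h : SmoothNS u p) {η f : E3 → ℝ} {M ρ r δ c₁ c₂ κ ε : ℝ}
    (hη : BallKernel η M) (hM : 0 < M) (hη1 : ∫ z, η z = 1)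
    (hf : ShellFun u f ρ r c₁ c₂) (hc₁ : 0 ≤ c₁) (hc₂ : 0 ≤ c₂) (hκ : 0 < κ) (hε : 0 < ε)
    (hε1 : ε ≤ 1) (hδ : 0 < δ) (hδ1 : δ ≤ 1) :
    |∫ x in shell ρ r, f x * (p x - ∫ z in closedBall (0 : E3) 1, η z * p (x - δ • z))| ≤
      (36 * M * volume.real (closedBall (0 : E3) 1) * c₁ *
        ∫ x in shell (ρ - δ) (r + δ), energyDensity κ u x) ^ (1 - ε) *
      (18 * M * volume.real (closedBall (0 : E3) 1) * c₂ *
        ∫ x in shell (ρ - δ) (r + δ), highDensity u x) ^ ε / ε := by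
  have hη1' : ∫ z in closedBall (0 : E3) 1, η z = 1 := by
    rw [setIntegral_closedBall_eq hη.zero, hη1]
  conv_lhs => simp only [sub_avg_eq hη.smooth hη1' h.smooth_p hδ.le, ← integral_const_mul (f _)]
  rw [setIntegral_setIntegral_swap (μ := volume) (ν := volume) (isCompact_shell ρ r) isCompact_Icc
    (g := fun x t => f x * avgDeriv η p t x)]
  · refine abs_setIntegral_Icc_le hδ hδ1 hε hε1 ?_ ?_
      (fun t ht htδ => h.abs_integral_mul_avgDeriv_le_div hη hM hf hc₁ hκ ht htδ)
      (fun t ht htδ => h.abs_integral_mul_avgDeriv_le hη hM hf hc₂ ht htδ)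
    · have : 0 ≤ ∫ x in shell (ρ - δ) (r + δ), energyDensity κ u x :=
        integral_nonneg fun x => energyDensity_nonneg hκ u x
      positivity
    · have : 0 ≤ ∫ x in shell (ρ - δ) (r + δ), highDensity u x :=
        integral_nonneg fun x => highDensity_nonneg u x
      positivity
  · simp only [Function.uncurry_def]
    exact (hf.smooth.continuous.comp continuous_fst).mul
      ((continuous_avgDeriv hη.smooth h.smooth_p).comp (continuous_snd.prodMk continuous_fst))

end SmoothNS

lemma setIntegral_comp_sub_smul_le {g : E3 → ℝ} (hg : Continuous g) (hg0 : ∀ x, 0 ≤ g x)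
    {B : Set E3} (hB : IsCompact B) {y : E3} {δ : ℝ} (hδ : 0 < δ)
    (hy : ∀ z : E3, ‖z‖ ≤ 1 → y - δ • z ∈ B) :
    ∫ z in closedBall (0 : E3) 1, g (y - δ • z) ≤ (δ ^ 3)⁻¹ * ∫ x in B, g x := by
  have iB : Integrable (B.indicator g) :=
    (integrable_indicator_iff hB.measurableSet).2 (hg.continuousOn.integrableOn_compact hB)
  have i1 : Integrable fun z => B.indicator g (y - δ • z) :=
    (iB.comp_sub_left y).comp_smul hδ.ne'
  have e1 : ∫ z, B.indicator g (y - δ • z) = (δ ^ 3)⁻¹ * ∫ x in B, g x := by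
    rw [Measure.integral_comp_smul volume (fun w => B.indicator g (y - w)) δ,
      integral_sub_left_eq_self (B.indicator g) volume y, integral_indicator hB.measurableSet]
    simp [abs_of_pos hδ]
  rw [← e1]
  have e2 : ∫ z in closedBall (0 : E3) 1, g (y - δ • z) =
      ∫ z in closedBall (0 : E3) 1, B.indicator g (y - δ • z) :=
    setIntegral_congr_fun isClosed_closedBall.measurableSet fun z hz =>
      (Set.indicator_of_mem (hy z (by simpa using hz)) g).symm
  rw [e2]
  exact setIntegral_le_integral i1 (ae_of_all _ fun z => Set.indicator_nonneg (fun x _ => hg0 x) _)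

lemma exists_orthogonal_norm_eq (x y : E3) (a : ℝ) (ha : 0 ≤ a) :
    ∃ w : E3, ‖w‖ = a ∧ inner ℝ x w = 0 ∧ inner ℝ y w = 0 := by
  set S := Submodule.span ℝ ({x, y} : Set E3)
  have h1 : Module.finrank ℝ S ≤ 2 := by
    classical
    have := finrank_span_finset_le_card (R := ℝ) ({x, y} : Finset E3)
    simp only [Finset.coe_insert, Finset.coe_singleton] at this
    exact this.trans Finset.card_le_two
  have h2 := Submodule.finrank_add_finrank_orthogonal S
  rw [finrank_euclideanSpace_fin] at h2
  have h3 : Sᗮ ≠ ⊥ := by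
    intro h
    rw [h, finrank_bot] at h2
    omega
  obtain ⟨w, hw, hw0⟩ := Submodule.exists_mem_ne_zero_of_ne_bot h3
  have hn : ‖w‖ ≠ 0 := norm_ne_zero_iff.2 hw0
  have hx : inner ℝ x w = 0 := hw x (Submodule.subset_span (by simp))
  have hy : inner ℝ y w = 0 := hw y (Submodule.subset_span (by simp))
  refine ⟨(a / ‖w‖) • w, ?_, ?_, ?_⟩
  · rw [norm_smul, norm_div, norm_norm, Real.norm_eq_abs, abs_of_nonneg ha]
    field_simp
  · rw [inner_smul_right, hx, mul_zero]
  · rw [inner_smul_right, hy, mul_zero]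

lemma segment_mem_shell {x w : E3} {r τ : ℝ} (hx : 3 / 4 ≤ ‖x‖) (hxr : ‖x‖ ≤ r)
    (hw : ‖w‖ = 3 / 4) (hxw : inner ℝ x w = 0) (h0 : 0 ≤ τ) (h1 : τ ≤ 1) :
    (1 - τ) • x + τ • w ∈ shell (53 / 100) r := by
  have e : ‖(1 - τ) • x + τ • w‖ ^ 2 = (1 - τ) ^ 2 * ‖x‖ ^ 2 + τ ^ 2 * (3 / 4) ^ 2 := by
    rw [norm_add_sq_real, inner_smul_left, inner_smul_right, hxw, norm_smul, norm_smul, hw]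
    simp [mul_pow]
  have hs : (1 - τ) ^ 2 + τ ^ 2 ≤ 1 := by nlinarith
  have hl : 1 / 2 ≤ (1 - τ) ^ 2 + τ ^ 2 := by nlinarith [sq_nonneg (1 - 2 * τ)]
  have hr : 3 / 4 ≤ r := hx.trans hxr
  constructor
  · refine le_of_sq_le_sq ?_ (norm_nonneg _)
    rw [e]
    have : (1 - τ) ^ 2 * (3 / 4) ^ 2 ≤ (1 - τ) ^ 2 * ‖x‖ ^ 2 := by gcongr
    nlinarith
  · refine le_of_sq_le_sq ?_ (by linarith)
    rw [e]
    have a1 : (1 - τ) ^ 2 * ‖x‖ ^ 2 ≤ (1 - τ) ^ 2 * r ^ 2 := by gcongr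
    have a2 : τ ^ 2 * (3 / 4) ^ 2 ≤ τ ^ 2 * r ^ 2 := by gcongr
    nlinarith [sq_nonneg r]

/-- The average of `p` at scale `δ` with kernel `η`. -/
def avg (η p : E3 → ℝ) (δ : ℝ) (x : E3) : ℝ := ∫ z in closedBall (0 : E3) 1, η z * p (x - δ • z)

lemma continuous_avg {η p : E3 → ℝ} (hη : Continuous η) (hp : Continuous p) (δ : ℝ) :
    Continuous (avg η p δ) := by
  refine continuous_setIntegral (ν := (volume : Measure E3)) (isCompact_closedBall (0 : E3) 1)
    (g := fun x z => η z * p (x - δ • z)) ?_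
  simp only [Function.uncurry_def]
  fun_prop

lemma avg_add_sub {η p : E3 → ℝ} (hη : Smooth η) (hp : Smooth p) (δ : ℝ) (x v : E3) :
    avg η p δ (x + v) - avg η p δ x = ∫ τ in Set.Icc (0 : ℝ) 1, ∑ i, v i *
      ∫ z in closedBall (0 : E3) 1, η z * pd i p ((x + τ • v) - δ • z) := by
  have h : ∀ i, Continuous (pd i p) := fun i => (hp.pd i).continuous
  have h' := hη.continuous
  have h'' := hp.continuous
  have hB := isCompact_closedBall (0 : E3) 1
  have e1 : ∀ τ : ℝ, ∑ i, v i * ∫ z in closedBall (0 : E3) 1, η z * pd i p ((x + τ • v) - δ • z) =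
      ∫ z in closedBall (0 : E3) 1, η z * ∑ i, v i * pd i p ((x + τ • v) - δ • z) := by
    intro τ
    simp only [← integral_const_mul (v _), Finset.mul_sum]
    rw [← integral_finsetSum]
    · congr 1
      funext z
      exact Finset.sum_congr rfl fun i _ => by ring
    · intro i _
      have := h i
      refine Continuous.continuousOn ?_ |>.integrableOn_compact hB
      fun_prop
  simp only [e1]
  rw [setIntegral_setIntegral_swap (μ := volume) (ν := volume)
    (g := fun (τ : ℝ) z => η z * ∑ i, v i * pd i p ((x + τ • v) - δ • z)) isCompact_Icc hB]
  · unfold avg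
    have c1 : Continuous fun z => η z * p (x + v - δ • z) := by fun_prop
    have c2 : Continuous fun z => η z * p (x - δ • z) := by fun_prop
    rw [← integral_sub (c1.continuousOn.integrableOn_compact hB)
      (c2.continuousOn.integrableOn_compact hB)]
    congr 1
    funext z
    have := sub_eq_integral_pd hp (x - δ • z) v 1
    rw [integral_const_mul, integral_Icc_eq_integral_Ioc,
      ← intervalIntegral.integral_of_le zero_le_one, ← mul_sub]
    congr 1
    rw [one_smul] at this
    rw [add_sub_right_comm, this]
    congr 1
    funext t
    simp only [add_sub_right_comm]
  · simp only [Function.uncurry_def]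
    refine (h'.comp continuous_snd).mul (continuous_finsetSum _ fun i _ => ?_)
    refine continuous_const.mul ((h i).comp ?_)
    fun_prop

namespace SmoothNS

variable {u : E3 → E3} {p : E3 → ℝ}

lemma abs_avg_pd_le (h : SmoothNS u p) {η : E3 → ℝ} {M δ r : ℝ} (hη : BallKernel η M)
    (hM : 0 < M) (hδ : 0 < δ) (hδ1 : δ ≤ 1 / 64) {y : E3} (hy : y ∈ shell (53 / 100) r)
    (i : Fin 3) :
    |∫ z in closedBall (0 : E3) 1, η z * pd i p (y - δ • z)| ≤
      M / δ ^ 4 * ∫ x in shell (51 / 100) (r + δ), stressAbs u x := by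
  have hB := isCompact_closedBall (0 : E3) 1
  rw [h.setIntegral_mul_pd_pressure hη.smooth hη.compact hη.zero hη.pd_zero i y hδ.ne',
    integral_const_mul, abs_mul, abs_of_pos (inv_pos.2 hδ), ← Real.norm_eq_abs]
  have cs : Continuous fun z => M * stressAbs u (y - δ • z) :=
    continuous_const.mul (h.continuous_stressAbs.comp (by fun_prop))
  have k1 : ‖∫ z in closedBall (0 : E3) 1, ∑ j, pd j η z * stress u i j (y - δ • z)‖ ≤
      ∫ z in closedBall (0 : E3) 1, M * stressAbs u (y - δ • z) := by
    refine norm_integral_le_of_norm_le (cs.continuousOn.integrableOn_compact hB)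
      (ae_of_all _ fun z => ?_)
    rw [Real.norm_eq_abs]
    calc _ ≤ ∑ j, M * |stress u i j (y - δ • z)| := by
          refine (Finset.abs_sum_le_sum_abs _ _).trans (Finset.sum_le_sum fun j _ => ?_)
          rw [abs_mul]
          exact mul_le_mul_of_nonneg_right (hη.pd_bound j z) (abs_nonneg _)
      _ ≤ _ := by
          rw [← Finset.mul_sum, stressAbs]
          refine mul_le_mul_of_nonneg_left ?_ hM.le
          exact Finset.single_le_sum (f := fun i => ∑ j, |stress u i j (y - δ • z)|)
            (fun _ _ => Finset.sum_nonneg fun _ _ => abs_nonneg _) (Finset.mem_univ i)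
  have k2 := setIntegral_comp_sub_smul_le h.continuous_stressAbs (stressAbs_nonneg u)
    (isCompact_shell (51 / 100) (r + δ)) (y := y) hδ (fun z hz => by
      have := sub_smul_mem_shell hy hz hδ.le le_rfl
      exact ⟨by linarith [this.1], this.2⟩)
  rw [integral_const_mul] at k1
  calc _ ≤ δ⁻¹ * (M * ((δ ^ 3)⁻¹ * ∫ x in shell (51 / 100) (r + δ), stressAbs u x)) := by
        gcongr
        exact k1.trans (by gcongr)
    _ = _ := by
        field_simp

lemma abs_avg_add_sub_le (h : SmoothNS u p) {η : E3 → ℝ} {M δ r : ℝ} (hη : BallKernel η M)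
    (hM : 0 < M) (hδ : 0 < δ) (hδ1 : δ ≤ 1 / 64) (x v : E3)
    (hy : ∀ τ : ℝ, 0 ≤ τ → τ ≤ 1 → x + τ • v ∈ shell (53 / 100) r) :
    |avg η p δ (x + v) - avg η p δ x| ≤
      3 * ‖v‖ * (M / δ ^ 4 * ∫ x in shell (51 / 100) (r + δ), stressAbs u x) := by
  rw [avg_add_sub hη.smooth h.smooth_p, ← Real.norm_eq_abs]
  refine (norm_setIntegral_le_of_norm_le_const (C := 3 * ‖v‖ * (M / δ ^ 4 *
    ∫ x in shell (51 / 100) (r + δ), stressAbs u x)) (by simp) fun τ hτ => ?_).trans (by simp)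
  rw [Real.norm_eq_abs]
  set I := M / δ ^ 4 * ∫ x in shell (51 / 100) (r + δ), stressAbs u x
  calc _ ≤ ∑ _i : Fin 3, ‖v‖ * I := by
        refine (Finset.abs_sum_le_sum_abs _ _).trans (Finset.sum_le_sum fun i _ => ?_)
        rw [abs_mul]
        exact mul_le_mul (abs_coord_le_norm v i)
          (h.abs_avg_pd_le hη hM hδ hδ1 (hy τ hτ.1 hτ.2) i) (abs_nonneg _) (norm_nonneg _)
    _ = 3 * ‖v‖ * I := by simp; ring

lemma abs_avg_sub_avg_le (h : SmoothNS u p) {η : E3 → ℝ} {M δ r : ℝ} (hη : BallKernel η M)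
    (hM : 0 < M) (hδ : 0 < δ) (hδ1 : δ ≤ 1 / 64) (hr : r ≤ 1) {x y : E3}
    (hx : x ∈ shell (3 / 4) r) (hy : y ∈ shell (3 / 4) r) :
    |avg η p δ x - avg η p δ y| ≤
      12 * (M / δ ^ 4 * ∫ x in shell (51 / 100) (r + δ), stressAbs u x) := by
  set I := M / δ ^ 4 * ∫ x in shell (51 / 100) (r + δ), stressAbs u x with hI
  have hI0 : 0 ≤ I := by
    have : 0 ≤ ∫ x in shell (51 / 100) (r + δ), stressAbs u x :=
      integral_nonneg fun x => stressAbs_nonneg u x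
    positivity
  obtain ⟨w, hw, hxw, hyw⟩ := exists_orthogonal_norm_eq x y (3 / 4) (by norm_num)
  have key : ∀ x, x ∈ shell (3 / 4) r → inner ℝ x w = 0 → |avg η p δ w - avg η p δ x| ≤ 6 * I := by
    intro x hx hxw
    have := h.abs_avg_add_sub_le (r := r) hη hM hδ hδ1 x (w - x) (fun τ h0 h1 => by
      rw [show x + τ • (w - x) = (1 - τ) • x + τ • w by module]
      exact segment_mem_shell hx.1 hx.2 hw hxw h0 h1)
    rw [add_sub_cancel] at this
    refine this.trans ?_
    have hn : ‖w - x‖ ≤ 2 := (norm_sub_le _ _).trans (by linarith [hx.2])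
    gcongr
    linarith
  have k1 := key x hx hxw
  have k2 := key y hy hyw
  rw [abs_le] at *
  constructor <;> linarith [k1.1, k1.2, k2.1, k2.2]

end SmoothNS

lemma setIntegral_shell_mono {e : E3 → ℝ} (he : Continuous e) (he0 : ∀ x, 0 ≤ e x)
    {a b a' b' : ℝ} (ha : a' ≤ a) (hb : b ≤ b') :
    ∫ x in shell a b, e x ≤ ∫ x in shell a' b', e x :=
  setIntegral_mono_set (he.continuousOn.integrableOn_compact (isCompact_shell _ _))
    (ae_of_all _ he0) (LE.le.eventuallyLE fun _ hx => ⟨ha.trans hx.1, hx.2.trans hb⟩)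

lemma volume_shell_le {a r : ℝ} (hr : r ≤ 1) :
    volume.real (shell a r) ≤ volume.real (closedBall (0 : E3) 1) :=
  measureReal_mono (fun x hx => by simpa using hx.2.trans hr)
    (isCompact_closedBall (0 : E3) 1).measure_lt_top.ne

namespace SmoothNS

variable {u : E3 → E3} {p : E3 → ℝ}

lemma setIntegral_norm_mul_setIntegral_stressAbs_le (h : SmoothNS u p) {κ : ℝ} (hκ : 0 < κ)
    {a b a' b' : ℝ} (ha : a' ≤ a) (hb : b ≤ b') (hb' : b' ≤ 1) :
    (∫ x in shell a b, ‖u x‖) * ∫ y in shell a' b', stressAbs u y ≤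
      18 * volume.real (closedBall (0 : E3) 1) * ∫ x in shell a' b', energyDensity κ u x := by
  have cE := h.continuous_energyDensity κ
  have cu := h.continuous
  have cs := h.continuous_stressAbs
  have hS := isCompact_shell a b
  have hT := isCompact_shell a' b'
  set V := volume.real (closedBall (0 : E3) 1)
  set I := ∫ x in shell a' b', energyDensity κ u x with hI
  have hI0 : 0 ≤ I := integral_nonneg fun x => energyDensity_nonneg hκ u x
  have inner_le : ∀ x, ‖u x‖ * ∫ y in shell a' b', stressAbs u y ≤
      9 * (V * energyDensity κ u x + I) := by
    intro x
    rw [← integral_const_mul]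
    have c1 : Continuous fun y => ‖u x‖ * stressAbs u y := by fun_prop
    have c2 : Continuous fun y => 9 * (energyDensity κ u x + energyDensity κ u y) := by fun_prop
    calc _ ≤ ∫ y in shell a' b', 9 * (energyDensity κ u x + energyDensity κ u y) :=
          integral_mono (c1.continuousOn.integrableOn_compact hT)
            (c2.continuousOn.integrableOn_compact hT) fun y => norm_mul_stressAbs_le hκ u x y
      _ = 9 * (volume.real (shell a' b') * energyDensity κ u x + I) := by
          rw [integral_const_mul, integral_add (continuousOn_const.integrableOn_compact hT)
            (cE.continuousOn.integrableOn_compact hT), setIntegral_const, smul_eq_mul]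
      _ ≤ _ := by
          have := energyDensity_nonneg hκ u x
          have := volume_shell_le (a := a') hb'
          gcongr
  rw [← integral_mul_const]
  have c1 : Continuous fun x => ‖u x‖ * ∫ y in shell a' b', stressAbs u y := by fun_prop
  have c2 : Continuous fun x => 9 * (V * energyDensity κ u x + I) := by fun_prop
  have c3 : Continuous fun x => V * energyDensity κ u x := by fun_prop
  calc _ ≤ ∫ x in shell a b, 9 * (V * energyDensity κ u x + I) :=
        integral_mono (c1.continuousOn.integrableOn_compact hS)
          (c2.continuousOn.integrableOn_compact hS) inner_le
    _ = 9 * (V * (∫ x in shell a b, energyDensity κ u x) + volume.real (shell a b) * I) := by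
        rw [integral_const_mul, integral_add (c3.continuousOn.integrableOn_compact hS)
          (continuousOn_const.integrableOn_compact hS), setIntegral_const, smul_eq_mul,
          integral_const_mul]
    _ ≤ 9 * (V * I + V * I) := by
        have k1 := setIntegral_shell_mono cE (energyDensity_nonneg hκ u) ha hb
        have k2 := volume_shell_le (a := a) (hb.trans hb')
        gcongr
    _ = _ := by ring

/-- The pressure tested against a mean-zero function supported in a spherical shell. -/
lemma abs_integral_mul_pressure_le (h : SmoothNS u p) {η f : E3 → ℝ} {M ρ δ c₁ c₂ κ ε : ℝ}
    (hη : BallKernel η M) (hM : 0 < M) (hη1 : ∫ z, η z = 1) (hρ : 3 / 4 ≤ ρ)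
    (hδ : 0 < δ) (hδ1 : δ ≤ 1 / 64) (hρδ : ρ + 2 * δ ≤ 1)
    (hf : ShellFun u f ρ (ρ + δ) c₁ c₂) (hf0 : ∫ x, f x = 0) (hc₁ : 0 ≤ c₁) (hc₂ : 0 ≤ c₂)
    (hκ : 0 < κ) (hε : 0 < ε) (hε1 : ε ≤ 1) :
    |∫ x, f x * p x| ≤
      216 * M * volume.real (closedBall (0 : E3) 1) * (c₁ / δ ^ 4) *
        (∫ x in shell (51 / 100) (ρ + 2 * δ), energyDensity κ u x) +
      (36 * M * volume.real (closedBall (0 : E3) 1) * c₁ *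
        ∫ x in shell (51 / 100) (ρ + 2 * δ), energyDensity κ u x) ^ (1 - ε) *
      (18 * M * volume.real (closedBall (0 : E3) 1) * c₂ *
        ∫ x in shell (51 / 100) (ρ + 2 * δ), highDensity u x) ^ ε / ε := by
  have cE := h.continuous_energyDensity κ
  have cu := h.continuous
  have cf := hf.smooth.continuous
  have cp := h.smooth_p.continuous
  have ca := continuous_avg hη.smooth.continuous cp δ
  have hS := isCompact_shell ρ (ρ + δ)
  set V := volume.real (closedBall (0 : E3) 1)
  set S := avg η p δ
  set x₀ : E3 := EuclideanSpace.single 0 ρ with hx₀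
  have hx₀m : x₀ ∈ shell (3 / 4) (ρ + δ) := by
    have : ‖x₀‖ = ρ := by rw [hx₀]; simp; linarith
    exact ⟨by linarith, by linarith⟩
  have hsplit : ∫ x, f x * p x = (∫ x in shell ρ (ρ + δ), f x * (p x - S x)) +
      ∫ x in shell ρ (ρ + δ), f x * (S x - S x₀) := by
    have c1 : Continuous fun x => f x * (p x - S x) := by fun_prop
    have c2 : Continuous fun x => f x * (S x - S x₀) := by fun_prop
    have c3 : Continuous fun x => f x * p x := by fun_prop
    have c4 : Continuous fun x => f x * S x₀ := by fun_prop
    rw [← integral_add (c1.continuousOn.integrableOn_compact hS)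
      (c2.continuousOn.integrableOn_compact hS)]
    have e : ∀ x, f x * (p x - S x) + f x * (S x - S x₀) = f x * p x - f x * S x₀ := by
      intro x; ring
    simp only [e]
    rw [integral_sub (c3.continuousOn.integrableOn_compact hS)
      (c4.continuousOn.integrableOn_compact hS), integral_mul_const,
      setIntegral_shell_eq (fun x hx => by simp [hf.zero x hx]),
      setIntegral_shell_eq (fun x hx => by simp [hf.zero x hx]), hf0]
    ring
  have b1 : |∫ x in shell ρ (ρ + δ), f x * (S x - S x₀)| ≤
      216 * M * V * (c₁ / δ ^ 4) * ∫ x in shell (51 / 100) (ρ + 2 * δ), energyDensity κ u x := by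
    have k := h.setIntegral_norm_mul_setIntegral_stressAbs_le hκ (a := ρ) (b := ρ + δ)
      (a' := 51 / 100) (b' := ρ + 2 * δ) (by linarith) (by linarith) hρδ
    set J := ∫ y in shell (51 / 100) (ρ + 2 * δ), stressAbs u y with hJ
    have hJ0 : 0 ≤ J := integral_nonneg fun x => stressAbs_nonneg u x
    have c1 : Continuous fun x => ‖u x‖ * (c₁ * (12 * (M / δ ^ 4 * J))) := by fun_prop
    rw [← Real.norm_eq_abs]
    refine (norm_integral_le_of_norm_le (c1.continuousOn.integrableOn_compact hS)
      ((ae_restrict_iff' hS.measurableSet).2 (ae_of_all _ fun x hx => ?_))).trans ?_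
    · rw [norm_mul, Real.norm_eq_abs, Real.norm_eq_abs]
      have k1 := hf.bound x
      have k2 := h.abs_avg_sub_avg_le hη hM hδ hδ1 (r := ρ + δ) (by linarith)
        (x := x) (y := x₀) ⟨hρ.trans hx.1, hx.2⟩ hx₀m
      rw [show ρ + δ + δ = ρ + 2 * δ by ring, ← hJ] at k2
      calc _ ≤ (c₁ * ‖u x‖) * (12 * (M / δ ^ 4 * J)) :=
            mul_le_mul k1 k2 (abs_nonneg _) (by positivity)
        _ = _ := by ring
    · rw [integral_mul_const]
      calc _ = 12 * c₁ * (M / δ ^ 4) * ((∫ x in shell ρ (ρ + δ), ‖u x‖) * J) := by ring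
        _ ≤ 12 * c₁ * (M / δ ^ 4) * (18 * V *
            ∫ x in shell (51 / 100) (ρ + 2 * δ), energyDensity κ u x) := by gcongr
        _ = _ := by ring
  have b2 := h.abs_integral_mul_sub_avg_le hη hM hη1 hf hc₁ hc₂ hκ hε hε1 hδ (by linarith)
  have m1 := setIntegral_shell_mono cE (energyDensity_nonneg hκ u)
    (a := ρ - δ) (b := ρ + δ + δ) (a' := 51 / 100) (b' := ρ + 2 * δ) (by linarith) (by linarith)
  have m2 := setIntegral_shell_mono h.continuous_highDensity (highDensity_nonneg u)
    (a := ρ - δ) (b := ρ + δ + δ) (a' := 51 / 100) (b' := ρ + 2 * δ) (by linarith) (by linarith)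
  have n1 : 0 ≤ ∫ x in shell (ρ - δ) (ρ + δ + δ), energyDensity κ u x :=
    integral_nonneg fun x => energyDensity_nonneg hκ u x
  have n2 : 0 ≤ ∫ x in shell (ρ - δ) (ρ + δ + δ), highDensity u x :=
    integral_nonneg fun x => highDensity_nonneg u x
  rw [hsplit, add_comm]
  refine (abs_add_le _ _).trans (add_le_add b1 (b2.trans ?_))
  have n3 : 0 ≤ ∫ x in shell (51 / 100) (ρ + 2 * δ), energyDensity κ u x := n1.trans m1
  have hV : 0 ≤ V := measureReal_nonneg
  have hε2 : 0 ≤ 1 - ε := by linarith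
  gcongr

end SmoothNS

/-- The Dirichlet integral over the closed ball of radius `ρ`. -/
def dirichlet (u : E3 → E3) (ρ : ℝ) : ℝ := ∫ x in closedBall (0 : E3) ρ, gradSq u x

namespace SmoothNS

variable {u : E3 → E3} {p : E3 → ℝ}

/-- A Caccioppoli type inequality. -/
lemma exists_dirichlet_le : ∃ K : ℝ, 1 ≤ K ∧ ∀ (u : E3 → E3) (p : E3 → ℝ), SmoothNS u p →
    ∀ ρ δ κ ε : ℝ, 3 / 4 ≤ ρ → 0 < δ → δ ≤ 1 / 64 → ρ + 2 * δ ≤ 1 → 0 < κ → 0 < ε → ε ≤ 1 →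
    dirichlet u ρ ≤ 2 / ε *
      (K / δ ^ 5 * (1 + ∫ x in shell (51 / 100) (ρ + 2 * δ), energyDensity κ u x)) *
      (K / δ ^ 2 * (1 + ∫ x in shell (51 / 100) (ρ + 2 * δ), highDensity u x)) ^ ε := by
  obtain ⟨η, M, hM, hη, hη1⟩ := exists_ballKernel
  obtain ⟨C, hC, hcut⟩ := exists_cutoff
  set V := volume.real (closedBall (0 : E3) 1)
  refine ⟨1 + 648 * M * V * C + 9 * C, by
    have : 0 ≤ V := measureReal_nonneg
    nlinarith [mul_nonneg (mul_nonneg hM.le this) hC.le],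
    fun u p h ρ δ κ ε hρ hδ hδ1 hρδ hκ hε hε1 => ?_⟩
  have hV : 0 ≤ V := measureReal_nonneg
  set K := 1 + 648 * M * V * C + 9 * C with hK
  have hMVC : 0 ≤ M * V * C := by positivity
  have hK1 : 1 ≤ K := by rw [hK]; nlinarith
  obtain ⟨φ, hφ, φ0, φ1, φone, φzero, φb, φbb, φs, φss⟩ := hcut ρ δ (by linarith) hδ (by linarith)
  have hδle : δ ≤ 1 := by linarith
  have cE := h.continuous_energyDensity κ
  have cu := h.continuous
  have hφc : HasCompactSupport φ := HasCompactSupport.intro (isCompact_closedBall (0 : E3) (ρ + δ))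
    fun x hx => φzero x (by simp only [mem_closedBall, dist_zero_right, not_le] at hx; exact hx.le)
  set f : E3 → ℝ := fun x => ∑ i, pd i φ x * coord u i x with hf
  have hpdf : ∀ j x, pd j f x = ∑ i, (pd j (pd i φ) x * coord u i x + pd i φ x * pd j (coord u i) x) := by
    intro j x
    rw [hf, pd_sum _ fun i => (hφ.pd i).mul (h.smooth i)]
    exact Finset.sum_congr rfl fun i _ => pd_mul (hφ.pd i) (h.smooth i) j x
  have hpd0 : ∀ j x, x ∉ shell ρ (ρ + δ) → pd j φ x = 0 := fun j x hx => by
    by_contra hc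
    exact hx (φs j x hc)
  have hpdpd0 : ∀ i j x, x ∉ shell ρ (ρ + δ) → pd i (pd j φ) x = 0 := fun i j x hx => by
    by_contra hc
    exact hx (φss i j x hc)
  have hfS : ShellFun u f ρ (ρ + δ) (3 * C / δ) (3 * C / δ ^ 2) := by
    refine ⟨h.smooth_flux hφ, fun x hx => ?_, fun j x hx => ?_, fun x => ?_, fun j x => ?_⟩
    · simp [hf, hpd0 _ x hx]
    · simp [hpdf, hpd0 _ x hx, hpdpd0 _ _ x hx]
    · calc |f x| ≤ ∑ _i : Fin 3, C / δ * ‖u x‖ := by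
            refine (Finset.abs_sum_le_sum_abs _ _).trans (Finset.sum_le_sum fun i _ => ?_)
            rw [abs_mul]
            exact mul_le_mul (φb i x) (abs_coord_le_norm _ _) (abs_nonneg _) (by positivity)
        _ = _ := by simp; ring
    · rw [hpdf]
      calc _ ≤ ∑ _i : Fin 3, C / δ ^ 2 * (‖u x‖ + √(gradSq u x)) := by
            refine (Finset.abs_sum_le_sum_abs _ _).trans (Finset.sum_le_sum fun i _ => ?_)
            refine (abs_add_le _ _).trans ?_
            rw [abs_mul, abs_mul, mul_add]
            refine add_le_add (mul_le_mul (φbb j i x) (abs_coord_le_norm _ _) (abs_nonneg _)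
              (by positivity)) (mul_le_mul ((φb i x).trans ?_) (abs_pd_le_sqrt u x i j)
              (abs_nonneg _) (by positivity))
            rw [div_le_div_iff₀ hδ (by positivity)]
            nlinarith [mul_pos hC hδ]
        _ = _ := by simp; ring
  have hpress := h.abs_integral_mul_pressure_le hη hM hη1 hρ hδ hδ1 hρδ hfS
    (h.integral_flux_eq_zero hφ hφc) (by positivity) (by positivity) hκ hε hε1
  set g : E3 → ℝ := fun x => (∑ i, pd i φ x * coord u i x) * (∑ i, coord u i x ^ 2) / 2
        - ∑ j, pd j φ x * ∑ i, coord u i x * pd j (coord u i) x with hg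
  have cpd : ∀ i, Continuous (pd i φ) := fun i => (hφ.pd i).continuous
  have cco : ∀ i, Continuous (coord u i) := fun i => (h.smooth i).continuous
  have cpc : ∀ i j, Continuous (pd j (coord u i)) := fun i j => h.continuous_pd_coord i j
  have cf : Continuous f := hfS.smooth.continuous
  have cg : Continuous g := by
    rw [hg]
    fun_prop
  have g0 : ∀ x, x ∉ shell ρ (ρ + δ) → g x = 0 := fun x hx => by simp [hg, hpd0 _ x hx]
  have gb : ∀ x, |g x| ≤ 9 * C / δ * energyDensity κ u x := by
    intro x
    have hsq : ∑ i, coord u i x ^ 2 = ‖u x‖ ^ 2 := by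
      rw [EuclideanSpace.norm_sq_eq]
      simp [coord]
    have t1 : |f x * (∑ i, coord u i x ^ 2) / 2| ≤ 3 * C / δ * ‖u x‖ * ‖u x‖ ^ 2 / 2 := by
      rw [hsq, abs_div, abs_mul, abs_of_nonneg (sq_nonneg ‖u x‖), abs_two]
      have := hfS.bound x
      gcongr
    have t2 : |∑ j, pd j φ x * ∑ i, coord u i x * pd j (coord u i) x| ≤
        9 * (C / δ * (‖u x‖ * √(gradSq u x))) := by
      calc _ ≤ ∑ _j : Fin 3, C / δ * (3 * (‖u x‖ * √(gradSq u x))) := by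
            refine (Finset.abs_sum_le_sum_abs _ _).trans (Finset.sum_le_sum fun j _ => ?_)
            rw [abs_mul]
            refine mul_le_mul (φb j x) ?_ (abs_nonneg _) (by positivity)
            calc _ ≤ ∑ _i : Fin 3, ‖u x‖ * √(gradSq u x) := by
                  refine (Finset.abs_sum_le_sum_abs _ _).trans (Finset.sum_le_sum fun i _ => ?_)
                  rw [abs_mul]
                  exact mul_le_mul (abs_coord_le_norm _ _) (abs_pd_le_sqrt u x i j)
                    (abs_nonneg _) (norm_nonneg _)
              _ = _ := by simp
        _ = _ := by simp; ring
    have t3 := mul_sqrt_le (a := ‖u x‖) hκ (gradSq_nonneg u x)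
    have t4 : 0 ≤ C / δ := by positivity
    calc |g x| ≤ 3 * C / δ * ‖u x‖ * ‖u x‖ ^ 2 / 2 + 9 * (C / δ * (‖u x‖ * √(gradSq u x))) :=
          (abs_sub _ _).trans (add_le_add t1 t2)
      _ ≤ 9 * C / δ * ‖u x‖ ^ 3 + 9 * (C / δ * (κ * gradSq u x + κ⁻¹ * ‖u x‖ ^ 2)) := by
          refine add_le_add ?_ (by gcongr)
          rw [show 3 * C / δ * ‖u x‖ * ‖u x‖ ^ 2 / 2 = 3 / 2 * (C / δ * ‖u x‖ ^ 3) by ring,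
            show 9 * C / δ * ‖u x‖ ^ 3 = 9 * (C / δ * ‖u x‖ ^ 3) by ring]
          have : 0 ≤ C / δ * ‖u x‖ ^ 3 := by positivity
          linarith
      _ = _ := by unfold energyDensity; ring
  set E := ∫ x in shell (51 / 100) (ρ + 2 * δ), energyDensity κ u x with hE
  set F := ∫ x in shell (51 / 100) (ρ + 2 * δ), highDensity u x with hF
  have hE0 : 0 ≤ E := integral_nonneg fun x => energyDensity_nonneg hκ u x
  have hF0 : 0 ≤ F := integral_nonneg fun x => highDensity_nonneg u x
  have gint : |∫ x, g x| ≤ 9 * C / δ * E := by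
    rw [← setIntegral_shell_eq g0, ← Real.norm_eq_abs]
    refine (norm_integral_le_of_norm_le
      ((cE.const_mul (9 * C / δ)).continuousOn.integrableOn_compact (isCompact_shell _ _))
      (ae_of_all _ gb)).trans ?_
    rw [integral_const_mul]
    have := setIntegral_shell_mono cE (energyDensity_nonneg hκ u)
      (a := ρ) (b := ρ + δ) (a' := 51 / 100) (b' := ρ + 2 * δ) (by linarith) (by linarith)
    gcongr
  have hZ : dirichlet u ρ ≤ ∫ x, φ x * gradSq u x := by
    have i1 : Integrable fun x => φ x * gradSq u x :=
      (hφ.continuous.mul h.continuous_gradSq).integrable_of_hasCompactSupport hφc.mul_right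
    calc dirichlet u ρ = ∫ x in closedBall (0 : E3) ρ, φ x * gradSq u x :=
          setIntegral_congr_fun isClosed_closedBall.measurableSet fun x hx => by
            rw [φone x (by simpa using hx), one_mul]
      _ ≤ _ := setIntegral_le_integral i1
          (ae_of_all _ fun x => mul_nonneg (φ0 x) (gradSq_nonneg u x))
  have hen := h.energy_identity hφ hφc
  rw [integral_add] at hen
  rotate_left
  · exact (cf.mul h.smooth_p.continuous).integrable_of_hasCompactSupport hfS.compact.mul_right
  · exact cg.integrable_of_hasCompactSupport
      (HasCompactSupport.intro (isCompact_shell ρ (ρ + δ)) g0)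
  have hmain : dirichlet u ρ ≤ 216 * M * V * (3 * C / δ / δ ^ 4) * E +
      (36 * M * V * (3 * C / δ) * E) ^ (1 - ε) * (18 * M * V * (3 * C / δ ^ 2) * F) ^ ε / ε +
      9 * C / δ * E := by
    have a1 := le_abs_self (∫ x, f x * p x)
    have a2 := le_abs_self (∫ x, g x)
    calc _ ≤ (∫ x, f x * p x) + ∫ x, g x := hZ.trans hen.le
      _ ≤ _ := by linarith
  set a := K / δ ^ 5 * (1 + E) with ha
  set b := K / δ ^ 2 * (1 + F) with hb
  have hδ5 : 1 ≤ 1 / δ ^ 5 := by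
    rw [le_div_iff₀ (by positivity), one_mul]
    exact pow_le_one₀ hδ.le hδle
  have hδ2 : 1 ≤ 1 / δ ^ 2 := by
    rw [le_div_iff₀ (by positivity), one_mul]
    exact pow_le_one₀ hδ.le hδle
  have ha1 : 1 ≤ a := by
    have : 1 * 1 * 1 ≤ K * (1 / δ ^ 5) * (1 + E) := by gcongr; linarith
    rw [ha]; calc 1 = 1 * 1 * 1 := by ring
      _ ≤ _ := this
      _ = _ := by ring
  have hb1 : 1 ≤ b := by
    have : 1 * 1 * 1 ≤ K * (1 / δ ^ 2) * (1 + F) := by gcongr; linarith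
    rw [hb]; calc 1 = 1 * 1 * 1 := by ring
      _ ≤ _ := this
      _ = _ := by ring
  have hinv : 1 / δ ≤ 1 / δ ^ 5 := by
    apply one_div_le_one_div_of_le (by positivity)
    calc δ ^ 5 ≤ δ ^ 1 := pow_le_pow_of_le_one hδ.le hδle (by norm_num)
      _ = δ := pow_one δ
  have l1 : 216 * M * V * (3 * C / δ / δ ^ 4) * E + 9 * C / δ * E ≤ a := by
    calc _ = 648 * (M * V * C) * (1 / δ ^ 5) * E + 9 * C * (1 / δ) * E := by field_simp; ring
      _ ≤ 648 * (M * V * C) * (1 / δ ^ 5) * E + 9 * C * (1 / δ ^ 5) * E := by gcongr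
      _ = (K - 1) * (1 / δ ^ 5) * E := by rw [hK]; ring
      _ ≤ K * (1 / δ ^ 5) * (1 + E) := by gcongr <;> linarith
      _ = a := by rw [ha]; ring
  have l2 : 36 * M * V * (3 * C / δ) * E ≤ a := by
    calc _ = 108 * (M * V * C) * (1 / δ) * E := by ring
      _ ≤ 108 * (M * V * C) * (1 / δ ^ 5) * E := by gcongr
      _ ≤ K * (1 / δ ^ 5) * (1 + E) := by
          gcongr <;> linarith
      _ = a := by rw [ha]; ring
  have l3 : 18 * M * V * (3 * C / δ ^ 2) * F ≤ b := by
    calc _ = 54 * (M * V * C) * (1 / δ ^ 2) * F := by ring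
      _ ≤ K * (1 / δ ^ 2) * (1 + F) := by
          gcongr <;> linarith
      _ = b := by rw [hb]; ring
  have hbε : 1 ≤ b ^ ε := Real.one_le_rpow hb1 hε.le
  have hε2 : 0 ≤ 1 - ε := by linarith
  have l4 : (36 * M * V * (3 * C / δ) * E) ^ (1 - ε) * (18 * M * V * (3 * C / δ ^ 2) * F) ^ ε / ε
      ≤ a * b ^ ε / ε := by
    have : a ^ (1 - ε) ≤ a := by
      calc a ^ (1 - ε) ≤ a ^ (1 : ℝ) := Real.rpow_le_rpow_of_exponent_le ha1 (by linarith)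
        _ = a := Real.rpow_one a
    have h' : (36 * M * V * (3 * C / δ) * E) ^ (1 - ε) ≤ a :=
      (Real.rpow_le_rpow (by positivity) l2 hε2).trans this
    gcongr
  have l5 : a ≤ a * b ^ ε / ε := by
    rw [le_div_iff₀ hε]
    calc a * ε ≤ a * 1 := by gcongr
      _ ≤ a * b ^ ε := by gcongr
  calc dirichlet u ρ ≤ a + a * b ^ ε / ε := by linarith
    _ ≤ a * b ^ ε / ε + a * b ^ ε / ε := by linarith
    _ = _ := by ring

end SmoothNS

/-- The Sobolev inequality for scalar functions on `ℝ³`. -/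
lemma exists_sobolev : ∃ S : ℝ, 0 ≤ S ∧ ∀ w : E3 → ℝ, Smooth w → HasCompactSupport w →
    ∫ x, |w x| ^ 6 ≤ S * (∫ x, ∑ j, pd j w x ^ 2) ^ 3 := by
  set c : NNReal := eLpNormLESNormFDerivOfEqInnerConst (volume : Measure E3) ((2 : NNReal) : ℝ)
  have hc0 : (0 : ℝ) ≤ c := NNReal.coe_nonneg _
  refine ⟨(c : ℝ) ^ 6 * 27, by positivity, fun w hw hwc => ?_⟩
  have hw1 : ContDiff ℝ 1 w := hw.of_le (by simp)
  have hcd : Continuous (fderiv ℝ w) := hw1.continuous_fderiv (by simp)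
  have hfc : HasCompactSupport (fderiv ℝ w) := hwc.fderiv ℝ
  have key : eLpNorm w ((6 : NNReal) : ℝ≥0∞) volume ≤
      c * eLpNorm (fderiv ℝ w) ((2 : NNReal) : ℝ≥0∞) volume :=
    eLpNorm_le_eLpNorm_fderiv_of_eq_inner (volume : Measure E3) hw1 hwc
    (p := 2) (p' := 6) (by norm_num) (by simp) (by simp; norm_num)
  have m1 : MemLp w ((6 : NNReal) : ℝ≥0∞) := hw.continuous.memLp_of_hasCompactSupport hwc
  have m2 : MemLp (fderiv ℝ w) ((2 : NNReal) : ℝ≥0∞) := hcd.memLp_of_hasCompactSupport hfc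
  rw [m1.eLpNorm_eq_integral_rpow_norm (by simp) (by simp),
    m2.eLpNorm_eq_integral_rpow_norm (by simp) (by simp), ← ENNReal.ofReal_coe_nnreal (p := c),
    ← ENNReal.ofReal_mul (NNReal.coe_nonneg _), ENNReal.ofReal_le_ofReal_iff (by positivity)] at key
  simp only [ENNReal.coe_toReal, NNReal.coe_ofNat, Real.rpow_ofNat, Real.norm_eq_abs] at key
  set A := ∫ x, |w x| ^ 6 with hA
  set B := ∫ x, ‖fderiv ℝ w x‖ ^ 2 with hB
  have hA0 : 0 ≤ A := integral_nonneg fun x => by positivity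
  have hB0 : 0 ≤ B := integral_nonneg fun x => by positivity
  have hBD : B ≤ 3 * ∫ x, ∑ j, pd j w x ^ 2 := by
    rw [← integral_const_mul]
    refine integral_mono ?_ ?_ fun x => ?_
    · have hc2 : HasCompactSupport fun x => ‖fderiv ℝ w x‖ ^ 2 :=
        hfc.mono fun x hx hx0 => hx (by simp [hx0])
      have cc : Continuous fun x => ‖fderiv ℝ w x‖ ^ 2 := hcd.norm.pow 2
      exact cc.integrable_of_hasCompactSupport hc2
    · refine Integrable.const_mul (integrable_finsetSum _ fun j _ => ?_) 3
      have hc2 : HasCompactSupport fun x => pd j w x ^ 2 :=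
        (hwc.pd j).mono fun x hx hx0 => hx (by simp [hx0])
      exact ((hw.pd j).continuous.pow 2).integrable_of_hasCompactSupport hc2
    · have k := norm_fderiv_le_sum w x
      calc ‖fderiv ℝ w x‖ ^ 2 ≤ (∑ i, |pd i w x|) ^ 2 := by gcongr
        _ ≤ 3 * ∑ i, |pd i w x| ^ 2 := by
          have := sq_sum_le_card_mul_sum_sq (s := (Finset.univ : Finset (Fin 3)))
            (f := fun i => |pd i w x|)
          simpa using this
        _ = _ := by simp
  calc A = (A ^ ((6 : ℝ)⁻¹)) ^ 6 := by
        rw [← Real.rpow_natCast, ← Real.rpow_mul hA0]; norm_num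
    _ ≤ (c * B ^ ((2 : ℝ)⁻¹)) ^ 6 := by gcongr
    _ = c ^ 6 * B ^ 3 := by
        rw [mul_pow, ← Real.rpow_natCast (B ^ _), ← Real.rpow_mul hB0, ← Real.rpow_natCast B 3]
        norm_num
    _ ≤ c ^ 6 * (3 * ∫ x, ∑ j, pd j w x ^ 2) ^ 3 := by gcongr
    _ = _ := by ring

lemma norm_sq_eq_sum_coord (u : E3 → E3) (x : E3) : ‖u x‖ ^ 2 = ∑ i, coord u i x ^ 2 := by
  rw [EuclideanSpace.norm_sq_eq]
  simp [coord]

namespace SmoothNS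

/-- The local `L⁶` norm of the velocity is controlled by its Dirichlet integral. -/
lemma exists_setIntegral_norm_pow_six_le : ∃ K : ℝ, 1 ≤ K ∧
    ∀ (u : E3 → E3) (p : E3 → ℝ), SmoothNS u p → ∀ ρ δ : ℝ, 3 / 4 ≤ ρ → 0 < δ → δ ≤ 1 / 64 →
      ρ + 3 * δ ≤ 9 / 10 →
      ∫ x in shell (51 / 100) (ρ + 2 * δ), ‖u x‖ ^ 6 ≤
        K / δ ^ 6 * (dirichlet u (ρ + 3 * δ) + ∫ x in shell (1 / 2) (9 / 10), ‖u x‖ ^ 2) ^ 3 := by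
  obtain ⟨C, hC, hcut⟩ := exists_cutoff
  obtain ⟨S, hS, hsob⟩ := exists_sobolev
  obtain ⟨ψ, hψ, ψ0, ψ1, ψone, ψzero, ψb, -, -, -⟩ := hcut (1 / 2) (1 / 100) (by norm_num)
    (by norm_num) (by norm_num)
  set L := 6 * (101 * C) ^ 2 + 2 with hL
  have hL0 : 0 ≤ L := by positivity
  have hSL : 0 ≤ 27 * S * L ^ 3 := by positivity
  refine ⟨1 + 27 * S * L ^ 3, by linarith, fun u p h ρ δ hρ hδ hδ1 hρδ => ?_⟩
  obtain ⟨φ, hφ, φ0, φ1, φone, φzero, φb, -, φs, -⟩ := hcut (ρ + 2 * δ) δ (by linarith) hδ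
    (by linarith)
  have cu := h.continuous
  have cG := h.continuous_gradSq
  have cu2 : Continuous fun x => ‖u x‖ ^ 2 := cu.norm.pow 2
  set χ : E3 → ℝ := fun x => φ x * (1 - ψ x) with hχ
  have hsub : Smooth fun x => 1 - ψ x := contDiff_const.sub hψ
  have hχs : Smooth χ := hφ.mul hsub
  have hφc : HasCompactSupport φ := HasCompactSupport.intro
    (isCompact_closedBall (0 : E3) (ρ + 2 * δ + δ))
    fun x hx => φzero x (by simp only [mem_closedBall, dist_zero_right, not_le] at hx; exact hx.le)
  have hpd1 : ∀ j x, pd j (fun x => 1 - ψ x) x = - pd j ψ x := fun j x => by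
    rw [pd_sub contDiff_const hψ]
    simp [pd]
  have χ0 : ∀ x, x ∉ shell (1 / 2) (ρ + 3 * δ) → χ x = 0 := by
    intro x hx
    by_cases hx1 : ‖x‖ ≤ 1 / 2
    · simp [hχ, ψone x hx1]
    · have : ρ + 2 * δ + δ ≤ ‖x‖ := by
        by_contra hc
        exact hx ⟨(not_le.1 hx1).le, by linarith⟩
      simp [hχ, φzero x this]
  have χpd0 : ∀ j x, x ∉ shell (1 / 2) (ρ + 3 * δ) → pd j χ x = 0 := fun j x hx =>
    pd_eq_zero_of_eventuallyEq (c := 0) (by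
      filter_upwards [(isCompact_shell (1 / 2) (ρ + 3 * δ)).isClosed.isOpen_compl.mem_nhds hx]
        with y hy using χ0 y hy) j
  have hδ' : 1 ≤ 1 / δ := by rw [le_div_iff₀ hδ]; linarith
  have χ1 : ∀ x, |χ x| ≤ 1 := fun x => by
    rw [hχ, abs_of_nonneg (mul_nonneg (φ0 x) (by linarith [ψ1 x]))]
    exact mul_le_one₀ (φ1 x) (by linarith [ψ1 x]) (by linarith [ψ0 x])
  have χpd : ∀ j x, |pd j χ x| ≤ 101 * C / δ := fun j x => by
    rw [hχ, pd_mul hφ hsub, hpd1]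
    refine (abs_add_le _ _).trans ?_
    rw [abs_mul, abs_mul, abs_neg]
    have e1 : |1 - ψ x| ≤ 1 := by
      rw [abs_of_nonneg (by linarith [ψ1 x])]; linarith [ψ0 x]
    have e2 : |φ x| ≤ 1 := by rw [abs_of_nonneg (φ0 x)]; exact φ1 x
    calc _ ≤ C / δ * 1 + 1 * (C / (1 / 100)) :=
          add_le_add (mul_le_mul (φb j x) e1 (abs_nonneg _) (by positivity))
            (mul_le_mul e2 (ψb j x) (abs_nonneg _) zero_le_one)
      _ = C / δ + 100 * C * 1 := by ring
      _ ≤ C / δ + 100 * C * (1 / δ) := by gcongr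
      _ = _ := by ring
  have hw : ∀ i, Smooth fun x => χ x * coord u i x := fun i => hχs.mul (h.smooth i)
  have hwc : ∀ i, HasCompactSupport fun x => χ x * coord u i x := fun i =>
    HasCompactSupport.intro (isCompact_shell (1 / 2) (ρ + 3 * δ)) fun x hx => by simp [χ0 x hx]
  set D := dirichlet u (ρ + 3 * δ) + ∫ x in shell (1 / 2) (9 / 10), ‖u x‖ ^ 2 with hD
  have hgrad : ∀ i, ∫ x, ∑ j, pd j (fun x => χ x * coord u i x) x ^ 2 ≤ L / δ ^ 2 * D := by
    intro i
    have hpt : ∀ x, ∑ j, pd j (fun x => χ x * coord u i x) x ^ 2 ≤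
        L / δ ^ 2 * (‖u x‖ ^ 2 + gradSq u x) := by
      intro x
      have hterm : ∀ j, pd j (fun x => χ x * coord u i x) x ^ 2 ≤
          2 * (101 * C / δ) ^ 2 * ‖u x‖ ^ 2 + 2 * pd j (coord u i) x ^ 2 := by
        intro j
        rw [pd_mul hχs (h.smooth i)]
        have e1 : |pd j χ x * coord u i x| ≤ 101 * C / δ * ‖u x‖ := by
          rw [abs_mul]
          exact mul_le_mul (χpd j x) (abs_coord_le_norm _ _) (abs_nonneg _) (by positivity)
        have e2 : |χ x * pd j (coord u i) x| ≤ |pd j (coord u i) x| := by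
          rw [abs_mul]
          exact mul_le_of_le_one_left (abs_nonneg _) (χ1 x)
        have e3 := sq_le_sq' (by linarith [abs_nonneg (pd j χ x * coord u i x)]) e1
        have e4 := pow_le_pow_left₀ (abs_nonneg _) e2 2
        rw [sq_abs] at e3
        rw [sq_abs, sq_abs] at e4
        have e5 := sq_nonneg (pd j χ x * coord u i x - χ x * pd j (coord u i) x)
        nlinarith only [e3, e4, e5]
      have hG : ∑ j, pd j (coord u i) x ^ 2 ≤ gradSq u x :=
        Finset.single_le_sum (f := fun i => ∑ j, pd j (coord u i) x ^ 2)
          (fun k _ => Finset.sum_nonneg fun _ _ => sq_nonneg _) (Finset.mem_univ i)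
      have hG0 := gradSq_nonneg u x
      have hδ2 : 1 ≤ 1 / δ ^ 2 := by
        rw [← one_div_pow]; exact one_le_pow₀ hδ'
      calc _ ≤ ∑ j, (2 * (101 * C / δ) ^ 2 * ‖u x‖ ^ 2 + 2 * pd j (coord u i) x ^ 2) :=
            Finset.sum_le_sum fun j _ => hterm j
        _ = 6 * (101 * C) ^ 2 * (1 / δ ^ 2) * ‖u x‖ ^ 2 + 2 * ∑ j, pd j (coord u i) x ^ 2 := by
            simp only [Finset.sum_add_distrib, ← Finset.mul_sum, Finset.sum_const,
              Finset.card_univ, Fintype.card_fin, nsmul_eq_mul]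
            push_cast
            ring
        _ ≤ L * (1 / δ ^ 2) * ‖u x‖ ^ 2 + L * (1 / δ ^ 2) * gradSq u x := by
            have l1 : 6 * (101 * C) ^ 2 ≤ L := by rw [hL]; linarith
            have l2 : 2 ≤ L := by rw [hL]; linarith [show 0 ≤ 6 * (101 * C) ^ 2 by positivity]
            have l3 : 2 * 1 ≤ L * (1 / δ ^ 2) := by gcongr
            refine add_le_add (by gcongr) ?_
            calc _ ≤ 2 * 1 * gradSq u x := by rw [mul_one]; gcongr
              _ ≤ _ := by gcongr
        _ = _ := by ring
    have ct : Continuous fun x => ∑ j, pd j (fun x => χ x * coord u i x) x ^ 2 :=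
      continuous_finsetSum _ fun j _ => ((hw i).pd j).continuous.pow 2
    have hz : ∀ x, x ∉ shell (1 / 2) (ρ + 3 * δ) →
        ∑ j, pd j (fun x => χ x * coord u i x) x ^ 2 = 0 := fun x hx => by
      refine Finset.sum_eq_zero fun j _ => ?_
      rw [pd_mul hχs (h.smooth i), χ0 x hx, χpd0 j x hx]
      simp
    rw [← setIntegral_shell_eq hz]
    have hK := isCompact_shell (1 / 2) (ρ + 3 * δ)
    calc _ ≤ ∫ x in shell (1 / 2) (ρ + 3 * δ), L / δ ^ 2 * (‖u x‖ ^ 2 + gradSq u x) :=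
          integral_mono (ct.continuousOn.integrableOn_compact hK)
            ((cu2.add cG).const_mul _ |>.continuousOn.integrableOn_compact hK) hpt
      _ = L / δ ^ 2 * ((∫ x in shell (1 / 2) (ρ + 3 * δ), gradSq u x) +
          ∫ x in shell (1 / 2) (ρ + 3 * δ), ‖u x‖ ^ 2) := by
          rw [integral_const_mul, integral_add (cu2.continuousOn.integrableOn_compact hK)
            (cG.continuousOn.integrableOn_compact hK), add_comm]
      _ ≤ _ := by
          refine mul_le_mul_of_nonneg_left (add_le_add ?_ ?_) (by positivity)
          · exact setIntegral_mono_set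
              (cG.continuousOn.integrableOn_compact (isCompact_closedBall _ _))
              (ae_of_all _ (gradSq_nonneg u))
              (LE.le.eventuallyLE fun x hx => by simpa using hx.2)
          · exact setIntegral_shell_mono cu2 (fun x => by positivity) le_rfl hρδ
  have hD0 : 0 ≤ D := add_nonneg (integral_nonneg fun x => gradSq_nonneg u x)
    (integral_nonneg fun x => by positivity)
  have h6 : ∀ i, ∫ x, |χ x * coord u i x| ^ 6 ≤ S * (L / δ ^ 2 * D) ^ 3 := fun i =>
    (hsob _ (hw i) (hwc i)).trans (by
      have : 0 ≤ ∫ x, ∑ j, pd j (fun x => χ x * coord u i x) x ^ 2 :=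
        integral_nonneg fun x => Finset.sum_nonneg fun _ _ => sq_nonneg _
      have := hgrad i
      gcongr)
  have hint : ∀ i, Integrable fun x => |χ x * coord u i x| ^ 6 := fun i =>
    ((hw i).continuous.abs.pow 6).integrable_of_hasCompactSupport
      ((hwc i).mono fun x hx (hx0 : χ x * coord u i x = 0) => hx (by
        show |χ x * coord u i x| ^ 6 = 0
        rw [hx0]
        norm_num))
  have hsum : Integrable fun x => ∑ i, 9 * |χ x * coord u i x| ^ 6 :=
    integrable_finsetSum _ fun i _ => (hint i).const_mul 9
  calc ∫ x in shell (51 / 100) (ρ + 2 * δ), ‖u x‖ ^ 6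
      ≤ ∫ x in shell (51 / 100) (ρ + 2 * δ), ∑ i, 9 * |χ x * coord u i x| ^ 6 := by
        refine setIntegral_mono_on ((cu.norm.pow 6).continuousOn.integrableOn_compact
          (isCompact_shell _ _)) hsum.integrableOn (isCompact_shell _ _).measurableSet
          fun x hx => ?_
        have hχ1 : χ x = 1 := by
          simp only [hχ]
          rw [φone x hx.2, ψzero x (by linarith [hx.1])]
          norm_num
        simp only [hχ1, one_mul]
        rw [← Finset.mul_sum, show ‖u x‖ ^ 6 = (‖u x‖ ^ 2) ^ 3 by ring, norm_sq_eq_sum_coord]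
        have hp := pow_sum_le_card_mul_sum_pow (s := (Finset.univ : Finset (Fin 3)))
          (f := fun i => coord u i x ^ 2) (fun i _ => sq_nonneg _) 2
        refine hp.trans (le_of_eq ?_)
        simp only [Finset.card_univ, Fintype.card_fin]
        norm_num
        refine Finset.sum_congr rfl fun i _ => ?_
        rw [← pow_mul, Even.pow_abs (by decide)]
    _ ≤ ∫ x, ∑ i, 9 * |χ x * coord u i x| ^ 6 :=
        setIntegral_le_integral hsum (ae_of_all _ fun x => Finset.sum_nonneg fun i _ => by
          positivity)
    _ = ∑ i, 9 * ∫ x, |χ x * coord u i x| ^ 6 := by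
        rw [integral_finsetSum _ fun i _ => (hint i).const_mul 9]
        simp_rw [integral_const_mul]
    _ ≤ ∑ _i : Fin 3, 9 * (S * (L / δ ^ 2 * D) ^ 3) := Finset.sum_le_sum fun i _ =>
        mul_le_mul_of_nonneg_left (h6 i) (by norm_num)
    _ = 27 * S * L ^ 3 / δ ^ 6 * D ^ 3 := by simp; field_simp; ring
    _ ≤ _ := by gcongr; linarith

end SmoothNS

/-- The Young inequality with a small parameter. -/
lemma exists_mul_rpow_le {b θ : ℝ} (hb : 0 < b) (hb1 : b < 1) (hθ : 0 < θ) : ∃ C : ℝ, 0 ≤ C ∧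
    ∀ x W : ℝ, 0 ≤ x → 0 ≤ W → x * W ^ b ≤ θ * W + C * x ^ (1 - b)⁻¹ := by
  have h1 : 0 < 1 - b := by linarith
  refine ⟨(θ ^ (-b)) ^ (1 - b)⁻¹, by positivity, fun x W hx hW => ?_⟩
  have key := Real.geom_mean_le_arith_mean2_weighted hb.le h1.le
    (mul_nonneg hθ.le hW) (show 0 ≤ (θ ^ (-b) * x) ^ (1 - b)⁻¹ by positivity) (by ring)
  rw [← Real.rpow_mul (by positivity), inv_mul_cancel₀ h1.ne', Real.rpow_one,
    Real.mul_rpow hθ.le hW] at key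
  have e : θ ^ b * W ^ b * (θ ^ (-b) * x) = x * W ^ b := by
    rw [Real.rpow_neg hθ.le]
    field_simp
  rw [e, Real.mul_rpow (by positivity) hx] at key
  have k1 : b * (θ * W) ≤ 1 * (θ * W) := by gcongr
  have k2 : (1 - b) * ((θ ^ (-b)) ^ (1 - b)⁻¹ * x ^ (1 - b)⁻¹) ≤
      1 * ((θ ^ (-b)) ^ (1 - b)⁻¹ * x ^ (1 - b)⁻¹) := by
    gcongr; linarith
  linarith

/-- Absorption of a small multiple of a quantity on a slightly larger ball. -/
lemma le_of_hole_filling {Z : ℝ → ℝ} {A B : ℝ} (N : ℕ) (hB : ∀ ρ ≤ 9 / 10, Z ρ ≤ B)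
    (hstep : ∀ ρ δ, 3 / 4 ≤ ρ → 0 < δ → δ ≤ 1 / 64 → ρ + 3 * δ ≤ 9 / 10 →
      Z ρ ≤ (1 / 2) ^ (N + 1) * Z (ρ + 3 * δ) + A / δ ^ N) :
    Z (3 / 4) ≤ A * 64 ^ N * 2 := by
  have key : ∀ k : ℕ, Z (3 / 4) ≤ ((1 / 2) ^ (N + 1)) ^ k * Z (3 / 4 + 3 / 32 * (1 - (1 / 2) ^ k)) +
      A * 64 ^ N * (2 * (1 - (1 / 2) ^ k)) := by
    intro k
    induction k with
    | zero => simp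
    | succ k ih =>
      have hk0 : (0 : ℝ) < (1 / 2) ^ k := by positivity
      have hk1 : ((1 : ℝ) / 2) ^ k ≤ 1 := pow_le_one₀ (by norm_num) (by norm_num)
      have hs := hstep (3 / 4 + 3 / 32 * (1 - (1 / 2) ^ k)) ((1 / 2) ^ k / 64) (by nlinarith)
        (by positivity) (by linarith) (by linarith)
      have e : 3 / 4 + 3 / 32 * (1 - (1 / 2) ^ k) + 3 * ((1 / 2) ^ k / 64) =
          3 / 4 + 3 / 32 * (1 - ((1 : ℝ) / 2) ^ (k + 1)) := by ring
      rw [e] at hs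
      refine ih.trans ?_
      have h2 : ((1 / 2) ^ (N + 1)) ^ k * (A / ((1 / 2) ^ k / 64) ^ N) =
          A * 64 ^ N * ((1 : ℝ) / 2) ^ k := by
        have h3 : (((1 : ℝ) / 2) ^ (N + 1)) ^ k = ((1 / 2) ^ k) ^ N * (1 / 2) ^ k := by
          rw [← pow_mul, ← pow_mul, ← pow_add]; ring_nf
        rw [h3]
        generalize ((1 : ℝ) / 2) ^ k = t at hk0
        rw [div_pow t]
        field_simp
      calc _ ≤ ((1 / 2) ^ (N + 1)) ^ k * ((1 / 2) ^ (N + 1) *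
            Z (3 / 4 + 3 / 32 * (1 - (1 / 2) ^ (k + 1))) + A / ((1 / 2) ^ k / 64) ^ N) +
            A * 64 ^ N * (2 * (1 - (1 / 2) ^ k)) := by gcongr
        _ = _ := by rw [mul_add, h2]; ring
  have hlim : Tendsto (fun k : ℕ => (((1 : ℝ) / 2) ^ (N + 1)) ^ k * B +
      A * 64 ^ N * (2 * (1 - (1 / 2) ^ k))) atTop (nhds (0 * B + A * 64 ^ N * (2 * (1 - 0)))) := by
    have t1 : Tendsto (fun k : ℕ => (((1 : ℝ) / 2) ^ (N + 1)) ^ k) atTop (nhds 0) :=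
      tendsto_pow_atTop_nhds_zero_of_lt_one (by positivity)
        (pow_lt_one₀ (by norm_num) (by norm_num) (by simp))
    have t2 : Tendsto (fun k : ℕ => ((1 : ℝ) / 2) ^ k) atTop (nhds 0) :=
      tendsto_pow_atTop_nhds_zero_of_lt_one (by norm_num) (by norm_num)
    exact (t1.mul_const B).add (((tendsto_const_nhds.sub t2).const_mul 2).const_mul _)
  have := ge_of_tendsto' hlim fun k => (key k).trans (by
    have hk0 : (0 : ℝ) < (1 / 2) ^ k := by positivity
    have := hB (3 / 4 + 3 / 32 * (1 - (1 / 2) ^ k)) (by linarith)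
    gcongr)
  linarith

/-- Interpolation of `L³` between `L^q` and `L⁶`. -/
lemma setIntegral_cube_le {v : E3 → ℝ} (hv : Continuous v) (hv0 : ∀ x, 0 ≤ v x) {S : Set E3}
    (hS : IsCompact S) {q : ℝ} (hq : 0 < q) (hq3 : q < 3) :
    ∫ x in S, v x ^ 3 ≤
      (∫ x in S, v x ^ q) ^ (3 / (6 - q)) * (∫ x in S, v x ^ 6) ^ (1 - 3 / (6 - q)) := by
  set s := 3 / (6 - q) with hs
  have h6 : 0 < 6 - q := by linarith
  have hs0 : 0 < s := by positivity
  have hs1 : s < 1 := by rw [hs, div_lt_one h6]; linarith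
  have h1s : 0 < 1 - s := by linarith
  have hc : ∀ a : ℝ, 0 ≤ a → Continuous fun x => v x ^ a := fun a ha =>
    hv.rpow_const fun x => Or.inr ha
  have hm : ∀ (a : ℝ) (P : ℝ≥0∞), 0 ≤ a → MemLp (fun x => v x ^ a) P (volume.restrict S) := by
    intro a P ha
    have : IsFiniteMeasure (volume.restrict S) := ⟨by simpa using hS.measure_lt_top⟩
    obtain ⟨C, hC⟩ := hS.exists_bound_of_continuousOn (hc a ha).continuousOn
    exact MemLp.of_bound (hc a ha).aestronglyMeasurable C
      ((ae_restrict_iff' hS.measurableSet).2 (ae_of_all _ hC))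
  have hconj : Real.HolderConjugate s⁻¹ (1 - s)⁻¹ :=
    Real.holderConjugate_iff.2 ⟨(one_lt_inv₀ hs0).2 hs1, by simp⟩
  have key := integral_mul_le_Lp_mul_Lq_of_nonneg hconj (μ := volume.restrict S)
    (f := fun x => v x ^ (q * s)) (g := fun x => v x ^ (6 * (1 - s)))
    (ae_of_all _ fun x => Real.rpow_nonneg (hv0 x) _)
    (ae_of_all _ fun x => Real.rpow_nonneg (hv0 x) _)
    (hm _ _ (by positivity)) (hm _ _ (by positivity))
  have e : q * s + 6 * (1 - s) = 3 := by rw [hs]; field_simp; ring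
  have e1 : ∀ x, v x ^ (q * s) * v x ^ (6 * (1 - s)) = v x ^ 3 := fun x => by
    rw [← Real.rpow_add_of_nonneg (hv0 x) (by positivity) (by positivity), e]
    norm_cast
  have e2 : ∀ x, (v x ^ (q * s)) ^ s⁻¹ = v x ^ q := fun x => by
    rw [← Real.rpow_mul (hv0 x), mul_inv_cancel_right₀ hs0.ne']
  have e3 : ∀ x, (v x ^ (6 * (1 - s))) ^ (1 - s)⁻¹ = v x ^ 6 := fun x => by
    rw [← Real.rpow_mul (hv0 x), mul_inv_cancel_right₀ h1s.ne']
    norm_cast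
  simp only [e1, e2, e3, one_div, inv_inv] at key
  exact key

namespace SmoothNS

set_option maxHeartbeats 1000000 in
/-- One step of the local energy estimate, in terms of the `L^q` norm on a fixed shell. -/
lemma exists_dirichlet_le_rpow {q : ℝ} (hq : 12 / 5 < q) (hq3 : q < 3) : ∃ K : ℝ, 0 < K ∧
    ∀ (u : E3 → E3) (p : E3 → ℝ), SmoothNS u p → ∀ ρ δ ε P W : ℝ, 3 / 4 ≤ ρ → 0 < δ →
      δ ≤ 1 / 64 → ρ + 3 * δ ≤ 9 / 10 → 0 < ε → ε ≤ 1 →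
      P = 1 + ∫ x in shell (1 / 2) (9 / 10), ‖u x‖ ^ q → W = dirichlet u (ρ + 3 * δ) + P →
      dirichlet u ρ ≤ K / ε / δ ^ 19 * (P ^ (1 / 2 : ℝ) * W ^ (1 / 2 + 3 * ε) +
        P ^ (3 / (6 - q)) * W ^ (3 * (1 - 3 / (6 - q)) + 3 * ε)) := by
  obtain ⟨K₁, hK₁, hdir⟩ := exists_dirichlet_le
  obtain ⟨K₂, hK₂, hsix⟩ := exists_setIntegral_norm_pow_six_le
  set V := volume.real (closedBall (0 : E3) 1)
  have hV : 0 ≤ V := measureReal_nonneg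
  set c := 2 + V with hc
  have hc0 : 0 < c := by positivity
  refine ⟨2 * K₁ ^ 2 * (2 + c) * (2 + 2 * c) * (K₂ * c ^ 3) ^ 2, by positivity, ?_⟩
  intro u p h ρ δ ε P W hρ hδ hδ1 hρδ hε hε1 hP hW
  set s := 3 / (6 - q) with hs
  have h6 : 0 < 6 - q := by linarith
  have hs0 : 0 < s := by positivity
  have hs1 : s < 1 := by rw [hs, div_lt_one h6]; linarith
  have h1s : 0 < 1 - s := by linarith
  have cu := h.continuous
  have cG := h.continuous_gradSq
  have cn : Continuous fun x => ‖u x‖ := cu.norm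
  have c2 : Continuous fun x => ‖u x‖ ^ 2 := cn.pow 2
  have c3 : Continuous fun x => ‖u x‖ ^ 3 := cn.pow 3
  have c6 : Continuous fun x => ‖u x‖ ^ 6 := cn.pow 6
  have cq : Continuous fun x => ‖u x‖ ^ q := cn.rpow_const fun x => Or.inr (by linarith)
  have hA := isCompact_shell (1 / 2) (9 / 10)
  have hR := isCompact_shell (51 / 100) (ρ + 2 * δ)
  set m := ∫ x in shell (1 / 2) (9 / 10), ‖u x‖ ^ q with hm
  have hm0 : 0 ≤ m := integral_nonneg fun x => by positivity
  set Z := dirichlet u (ρ + 3 * δ) with hZ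
  have hZ0 : 0 ≤ Z := integral_nonneg fun x => gradSq_nonneg u x
  have hP1 : 1 ≤ P := by linarith
  have hW1 : 1 ≤ W := by linarith
  have hPW : P ≤ W := by linarith
  have hW3 : W ≤ W ^ 3 := le_self_pow₀ hW1 (by norm_num)
  have hL2 : ∫ x in shell (1 / 2) (9 / 10), ‖u x‖ ^ 2 ≤ c * P := by
    have hpt : ∀ x, ‖u x‖ ^ 2 ≤ 1 + ‖u x‖ ^ q := by
      intro x
      rcases le_total ‖u x‖ 1 with h1 | h1
      · have : ‖u x‖ ^ 2 ≤ 1 := pow_le_one₀ (norm_nonneg _) h1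
        linarith [Real.rpow_nonneg (norm_nonneg (u x)) q]
      · have : ‖u x‖ ^ (2 : ℝ) ≤ ‖u x‖ ^ q := Real.rpow_le_rpow_of_exponent_le h1 (by linarith)
        rw [Real.rpow_two] at this
        linarith
    calc _ ≤ ∫ x in shell (1 / 2) (9 / 10), (1 + ‖u x‖ ^ q) :=
          integral_mono (c2.continuousOn.integrableOn_compact hA)
            ((continuous_const.add cq).continuousOn.integrableOn_compact hA) hpt
      _ = volume.real (shell (1 / 2) (9 / 10)) + m := by
          rw [integral_add (continuousOn_const.integrableOn_compact hA)
            (cq.continuousOn.integrableOn_compact hA), setIntegral_const, smul_eq_mul,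
            mul_one]
      _ ≤ V + m := by
          have := volume_shell_le (a := 1 / 2) (r := 9 / 10) (by norm_num)
          gcongr
      _ ≤ c * P := by rw [hc]; nlinarith
  set L := ∫ x in shell (51 / 100) (ρ + 2 * δ), ‖u x‖ ^ 2 with hL
  have hLc : L ≤ c * P := (setIntegral_shell_mono c2 (fun x => by positivity) (by norm_num)
    (by linarith)).trans hL2
  set D := K₂ * c ^ 3 / δ ^ 6 with hD
  have hc1 : 1 ≤ c := by linarith
  have hδ6 : δ ^ 6 ≤ 1 := pow_le_one₀ hδ.le (by linarith)
  have hD1 : 1 ≤ D := by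
    rw [hD, le_div_iff₀ (by positivity), one_mul]
    refine hδ6.trans (one_le_mul_of_one_le_of_one_le hK₂ (one_le_pow₀ hc1))
  set I := ∫ x in shell (51 / 100) (ρ + 2 * δ), ‖u x‖ ^ 6 with hI
  have hI0 : 0 ≤ I := integral_nonneg fun x => by positivity
  have hI6 : I ≤ D * W ^ 3 := by
    have h2 : 0 ≤ ∫ x in shell (1 / 2) (9 / 10), ‖u x‖ ^ 2 := integral_nonneg fun x => by positivity
    calc I ≤ _ := hsix u p h ρ δ hρ hδ hδ1 hρδ
      _ ≤ K₂ / δ ^ 6 * (c * W) ^ 3 := by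
          gcongr
          rw [hW]; nlinarith
      _ = _ := by rw [hD]; ring
  have hI3 : ∫ x in shell (51 / 100) (ρ + 2 * δ), ‖u x‖ ^ 3 ≤ D * (P ^ s * W ^ (3 * (1 - s))) := by
    have k1 : ∫ x in shell (51 / 100) (ρ + 2 * δ), ‖u x‖ ^ q ≤ P := by
      have : ∫ x in shell (51 / 100) (ρ + 2 * δ), ‖u x‖ ^ q ≤ m :=
        setIntegral_shell_mono cq (fun x => by positivity) (by norm_num) (by linarith)
      linarith
    have k0 : 0 ≤ ∫ x in shell (51 / 100) (ρ + 2 * δ), ‖u x‖ ^ q :=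
      integral_nonneg fun x => by positivity
    calc _ ≤ _ := setIntegral_cube_le cn (fun x => norm_nonneg _) hR (by linarith) hq3
      _ ≤ P ^ s * (D * W ^ 3) ^ (1 - s) := by gcongr
      _ = P ^ s * (D ^ (1 - s) * W ^ (3 * (1 - s))) := by
          rw [Real.mul_rpow (by positivity) (by positivity), ← Real.rpow_natCast W 3,
            ← Real.rpow_mul (by positivity)]
          norm_num
      _ ≤ P ^ s * (D ^ (1 : ℝ) * W ^ (3 * (1 - s))) := by gcongr; linarith
      _ = _ := by rw [Real.rpow_one]; ring
  have hG : ∫ x in shell (51 / 100) (ρ + 2 * δ), gradSq u x ≤ Z :=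
    setIntegral_mono_set (cG.continuousOn.integrableOn_compact (isCompact_closedBall _ _))
      (ae_of_all _ (gradSq_nonneg u)) (LE.le.eventuallyLE fun x hx => by
        simpa using hx.2.trans (by linarith))
  have hsP : 0 < √P := Real.sqrt_pos.2 (by linarith)
  have hsW : 0 < √W := Real.sqrt_pos.2 (by linarith)
  set κ := √P / √W with hκ
  have hκ0 : 0 < κ := by positivity
  have hκ1 : κ * W = √P * √W := by
    rw [hκ]; field_simp; rw [Real.sq_sqrt (by linarith)]
  have hκ2 : κ⁻¹ * P = √P * √W := by
    rw [hκ, inv_div]; field_simp; rw [Real.sq_sqrt (by linarith)]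
  set T := √P * √W + P ^ s * W ^ (3 * (1 - s)) with hT
  have hT1 : 1 ≤ √P * √W := one_le_mul_of_one_le_of_one_le (Real.one_le_sqrt.2 hP1)
    (Real.one_le_sqrt.2 hW1)
  have hT2 : 0 ≤ P ^ s * W ^ (3 * (1 - s)) := by positivity
  have hE : 1 + ∫ x in shell (51 / 100) (ρ + 2 * δ), energyDensity κ u x ≤ (2 + c) * D * T := by
    have e : ∫ x in shell (51 / 100) (ρ + 2 * δ), energyDensity κ u x =
        κ * (∫ x in shell (51 / 100) (ρ + 2 * δ), gradSq u x) + κ⁻¹ * L +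
          ∫ x in shell (51 / 100) (ρ + 2 * δ), ‖u x‖ ^ 3 := by
      simp only [energyDensity]
      have ca : Continuous fun x => κ * gradSq u x + κ⁻¹ * ‖u x‖ ^ 2 :=
        (cG.const_mul κ).add (c2.const_mul κ⁻¹)
      rw [integral_add (ca.continuousOn.integrableOn_compact hR)
        (c3.continuousOn.integrableOn_compact hR),
        integral_add ((cG.const_mul κ).continuousOn.integrableOn_compact hR)
        ((c2.const_mul κ⁻¹).continuousOn.integrableOn_compact hR), integral_const_mul,
        integral_const_mul]
    have e1 : κ * (∫ x in shell (51 / 100) (ρ + 2 * δ), gradSq u x) ≤ √P * √W := by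
      rw [← hκ1]; gcongr; linarith
    have e2 : κ⁻¹ * L ≤ c * (√P * √W) := by
      calc _ ≤ κ⁻¹ * (c * P) := by gcongr
        _ = c * (κ⁻¹ * P) := by ring
        _ = _ := by rw [hκ2]
    rw [e]
    have e3 : (2 + c) * (√P * √W) ≤ (2 + c) * D * (√P * √W) := by
      have : (2 + c) * 1 ≤ (2 + c) * D := by gcongr
      rw [mul_one] at this
      gcongr
    have e4 : D * (P ^ s * W ^ (3 * (1 - s))) ≤ (2 + c) * D * (P ^ s * W ^ (3 * (1 - s))) := by
      rw [mul_assoc (2 + c)]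
      exact le_mul_of_one_le_left (by positivity) (by linarith)
    rw [hT]
    linarith
  have hF : 1 + ∫ x in shell (51 / 100) (ρ + 2 * δ), highDensity u x ≤
      (2 + 2 * c) * D * W ^ 3 := by
    have c22 : Continuous fun x => 2 * ‖u x‖ ^ 2 := c2.const_mul 2
    have e : ∫ x in shell (51 / 100) (ρ + 2 * δ), highDensity u x ≤
        2 * L + (∫ x in shell (51 / 100) (ρ + 2 * δ), gradSq u x) + I := by
      calc _ ≤ ∫ x in shell (51 / 100) (ρ + 2 * δ), (2 * ‖u x‖ ^ 2 + gradSq u x + ‖u x‖ ^ 6) := by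
            refine integral_mono (h.continuous_highDensity.continuousOn.integrableOn_compact hR)
              (((c22.add cG).add c6).continuousOn.integrableOn_compact hR) fun x => ?_
            simp only [highDensity]
            nlinarith [sq_nonneg (‖u x‖ * (‖u x‖ ^ 2 - 1)), sq_nonneg ‖u x‖,
              sq_nonneg (‖u x‖ ^ 3)]
        _ = _ := by
            have ca : Continuous fun x => 2 * ‖u x‖ ^ 2 + gradSq u x := c22.add cG
            rw [integral_add (ca.continuousOn.integrableOn_compact hR)
              (c6.continuousOn.integrableOn_compact hR),
              integral_add (c22.continuousOn.integrableOn_compact hR)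
              (cG.continuousOn.integrableOn_compact hR), integral_const_mul]
    have e1 : 1 * W ^ 3 ≤ D * W ^ 3 := by gcongr
    have e2 : c * P ≤ c * (D * W ^ 3) := by gcongr; linarith
    have e3 : (2 + 2 * c) * D * W ^ 3 = 2 * (D * W ^ 3) + 2 * (c * (D * W ^ 3)) := by ring
    rw [e3]
    linarith
  have hE0 : 0 ≤ ∫ x in shell (51 / 100) (ρ + 2 * δ), energyDensity κ u x :=
    integral_nonneg fun x => energyDensity_nonneg hκ0 u x
  have hF0 : 0 ≤ ∫ x in shell (51 / 100) (ρ + 2 * δ), highDensity u x :=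
    integral_nonneg fun x => highDensity_nonneg u x
  have hT0 : 0 ≤ T := by linarith
  set G := K₁ / δ ^ 2 * ((2 + 2 * c) * D) with hGdef
  have hG1 : 1 ≤ G := by
    have d1 : 1 ≤ K₁ / δ ^ 2 := by
      rw [le_div_iff₀ (by positivity), one_mul]
      exact (pow_le_one₀ hδ.le (by linarith)).trans hK₁
    refine one_le_mul_of_one_le_of_one_le d1 (one_le_mul_of_one_le_of_one_le (by linarith) hD1)
  calc dirichlet u ρ ≤ _ := hdir u p h ρ δ κ ε hρ hδ hδ1 (by linarith) hκ0 hε hε1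
    _ ≤ 2 / ε * (K₁ / δ ^ 5 * ((2 + c) * D * T)) * (G * W ^ 3) ^ ε := by
        have : K₁ / δ ^ 2 * (1 + ∫ x in shell (51 / 100) (ρ + 2 * δ), highDensity u x) ≤
            G * W ^ 3 := by
          calc _ ≤ K₁ / δ ^ 2 * ((2 + 2 * c) * D * W ^ 3) := by gcongr
            _ = _ := by rw [hGdef]; ring
        gcongr
    _ = 2 / ε * (K₁ / δ ^ 5 * ((2 + c) * D * T)) * (G ^ ε * W ^ (3 * ε)) := by
        rw [Real.mul_rpow (by positivity) (by positivity), ← Real.rpow_natCast W 3,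
            ← Real.rpow_mul (by positivity)]
        norm_num
    _ ≤ 2 / ε * (K₁ / δ ^ 5 * ((2 + c) * D * T)) * (G ^ (1 : ℝ) * W ^ (3 * ε)) := by
        gcongr
    _ = 2 * K₁ ^ 2 * (2 + c) * (2 + 2 * c) * (K₂ * c ^ 3) ^ 2 / ε / δ ^ 19 *
        (T * W ^ (3 * ε)) := by
        rw [Real.rpow_one, hGdef, hD]
        field_simp
    _ = _ := by
        rw [hT, add_mul, Real.sqrt_eq_rpow, Real.sqrt_eq_rpow, Real.rpow_add (by linarith),
          Real.rpow_add (by linarith)]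
        ring

end SmoothNS

/-- The Young inequality for a product of powers, with a prescribed power of the large quantity. -/
lemma exists_mul_rpow_mul_rpow_le {a b m θ : ℝ} (hb : 0 < b) (hb1 : b < 1) (hθ : 0 < θ)
    (hm : a / (1 - b) ≤ m) : ∃ C : ℝ, 0 ≤ C ∧ ∀ k P W : ℝ, 0 ≤ k → 1 ≤ P → 0 ≤ W →
      k * (P ^ a * W ^ b) ≤ θ * W + C * k ^ (1 - b)⁻¹ * P ^ m := by
  obtain ⟨C, hC, hY⟩ := exists_mul_rpow_le hb hb1 hθ
  refine ⟨C, hC, fun k P W hk hP hW => ?_⟩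
  have hP0 : 0 < P := by linarith
  have := hY (k * P ^ a) W (by positivity) hW
  rw [Real.mul_rpow hk (by positivity), ← Real.rpow_mul hP0.le, ← div_eq_mul_inv a] at this
  have h2 : P ^ (a / (1 - b)) ≤ P ^ m := Real.rpow_le_rpow_of_exponent_le hP hm
  calc _ = k * P ^ a * W ^ b := by ring
    _ ≤ _ := this
    _ = θ * W + C * k ^ (1 - b)⁻¹ * P ^ (a / (1 - b)) := by ring
    _ ≤ _ := by gcongr

namespace SmoothNS

/-- The Dirichlet integral on an inner ball is controlled by the `L^q` norm on a shell. -/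
lemma exists_dirichlet_le_rpow_shell {q m : ℝ} (hq : 12 / 5 < q) (hq3 : q < 3)
    (hm : 3 / (2 * q - 3) < m) : ∃ C : ℝ, ∀ (u : E3 → E3) (p : E3 → ℝ), SmoothNS u p →
      dirichlet u (3 / 4) ≤ C * (1 + ∫ x in shell (1 / 2) (9 / 10), ‖u x‖ ^ q) ^ m := by
  obtain ⟨K, hK, hstep⟩ := exists_dirichlet_le_rpow hq hq3
  set s := 3 / (6 - q) with hs
  have h6 : 0 < 6 - q := by linarith
  have hs0 : 0 < s := by positivity
  have hs1 : s < 1 := by rw [hs, div_lt_one h6]; linarith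
  have hs2 : 2 / 3 < s := by rw [hs, lt_div_iff₀ h6]; linarith
  have hm1 : 1 < m := by
    refine lt_of_le_of_lt ?_ hm
    rw [le_div_iff₀ (by linarith)]; linarith
  have hsm : s / (1 - 3 * (1 - s)) < m := by
    convert hm using 1
    rw [hs]
    have : 2 * q - 3 ≠ 0 := by linarith
    have : 1 - 3 * (1 - 3 / (6 - q)) ≠ 0 := by
      rw [← hs]; linarith
    rw [div_eq_div_iff this (by assumption)]
    field_simp
    ring
  have t0 : Tendsto (fun ε : ℝ => 3 * ε) (nhds 0) (nhds 0) := by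
    have : Continuous fun ε : ℝ => 3 * ε := by fun_prop
    simpa using this.tendsto 0
  have hden : ∀ᶠ ε : ℝ in nhdsWithin 0 (Set.Ioi 0), 0 < ε ∧ ε ≤ 1 ∧ 1 / 2 + 3 * ε < 1 ∧
      3 * (1 - s) + 3 * ε < 1 ∧ (1 / 2) / (1 - (1 / 2 + 3 * ε)) ≤ m ∧
      s / (1 - (3 * (1 - s) + 3 * ε)) ≤ m := by
    have c1 : ContinuousAt (fun ε : ℝ => (1 / 2) / (1 - (1 / 2 + 3 * ε))) 0 :=
      ContinuousAt.div (by fun_prop) (by fun_prop) (by norm_num)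
    have c2 : ContinuousAt (fun ε : ℝ => s / (1 - (3 * (1 - s) + 3 * ε))) 0 :=
      ContinuousAt.div (by fun_prop) (by fun_prop) (by linarith)
    have c3 : ContinuousAt (fun ε : ℝ => 1 / 2 + 3 * ε) 0 := by fun_prop
    have c4 : ContinuousAt (fun ε : ℝ => 3 * (1 - s) + 3 * ε) 0 := by fun_prop
    have k1 := c1.eventually (gt_mem_nhds (show _ < m by norm_num; exact hm1))
    have k2 := c2.eventually (gt_mem_nhds (show _ < m by simpa using hsm))
    have k3 := c3.eventually (gt_mem_nhds (show _ < 1 by norm_num))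
    have k4 := c4.eventually (gt_mem_nhds (show _ < 1 by linarith))
    have k5 : ∀ᶠ ε : ℝ in nhds 0, ε < 1 := gt_mem_nhds one_pos
    filter_upwards [self_mem_nhdsWithin, nhdsWithin_le_nhds k1, nhdsWithin_le_nhds k2,
      nhdsWithin_le_nhds k3, nhdsWithin_le_nhds k4, nhdsWithin_le_nhds k5] with
      ε e0 e1 e2 e3 e4 e5
    exact ⟨e0, e5.le, e3, e4, e1.le, e2.le⟩
  obtain ⟨ε, hε, hε1, hb1, hb2, hm2, hm3⟩ := hden.exists
  set b₁ := 1 / 2 + 3 * ε with hb₁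
  set b₂ := 3 * (1 - s) + 3 * ε with hb₂
  have hb10 : 0 < b₁ := by positivity
  have hb20 : 0 < b₂ := by rw [hb₂]; linarith
  have h1b1 : 0 < 1 - b₁ := by linarith
  have h1b2 : 0 < 1 - b₂ := by linarith
  obtain ⟨N₁, hN₁⟩ := exists_nat_ge ((19 : ℝ) * (1 - b₁)⁻¹)
  obtain ⟨N₂, hN₂⟩ := exists_nat_ge ((19 : ℝ) * (1 - b₂)⁻¹)
  set N := N₁ + N₂ with hN
  set θ : ℝ := (1 / 2) ^ (N + 1) / 2 with hθ
  have hθ0 : 0 < θ := by positivity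
  obtain ⟨C₁, hC₁, hY₁⟩ := exists_mul_rpow_mul_rpow_le hb10 hb1 hθ0 hm2
  obtain ⟨C₂, hC₂, hY₂⟩ := exists_mul_rpow_mul_rpow_le hb20 hb2 hθ0 hm3
  set G := 1 + C₁ * (K / ε) ^ (1 - b₁)⁻¹ + C₂ * (K / ε) ^ (1 - b₂)⁻¹ with hG
  refine ⟨G * 64 ^ N * 2, fun u p h => ?_⟩
  set P := 1 + ∫ x in shell (1 / 2) (9 / 10), ‖u x‖ ^ q with hP
  have hm0 : 0 ≤ ∫ x in shell (1 / 2) (9 / 10), ‖u x‖ ^ q := integral_nonneg fun x => by positivity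
  have hP1 : 1 ≤ P := by linarith
  have cG := h.continuous_gradSq
  have hfin := le_of_hole_filling (Z := dirichlet u) (A := G * P ^ m) (B := dirichlet u (9 / 10)) N
    (fun ρ hρ => setIntegral_mono_set
      (cG.continuousOn.integrableOn_compact (isCompact_closedBall _ _))
      (ae_of_all _ (gradSq_nonneg u)) (closedBall_subset_closedBall hρ).eventuallyLE) ?_
  · calc _ ≤ _ := hfin
      _ = _ := by ring
  intro ρ δ hρ hδ hδ1 hρδ
  have hZ0 : 0 ≤ dirichlet u (ρ + 3 * δ) := integral_nonneg fun x => gradSq_nonneg u x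
  set W := dirichlet u (ρ + 3 * δ) + P with hW
  have hW0 : 0 ≤ W := by linarith
  have hδ1' : δ ≤ 1 := by linarith
  set k := K / ε / δ ^ 19 with hk
  have hk0 : 0 ≤ k := by positivity
  have hkp : ∀ b : ℝ, 0 < 1 - b → (19 : ℝ) * (1 - b)⁻¹ ≤ N →
      k ^ (1 - b)⁻¹ ≤ (K / ε) ^ (1 - b)⁻¹ / δ ^ N := by
    intro b hb hbN
    rw [hk, Real.div_rpow (by positivity) (by positivity), ← Real.rpow_natCast δ 19,
      ← Real.rpow_natCast δ N, ← Real.rpow_mul hδ.le]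
    have := Real.rpow_le_rpow_of_exponent_ge hδ hδ1' hbN
    have h0 : 0 < δ ^ (N : ℝ) := by positivity
    push_cast
    gcongr
  have y1 := hY₁ k P W hk0 hP1 hW0
  have y2 := hY₂ k P W hk0 hP1 hW0
  have z1 := hkp b₁ h1b1 (hN₁.trans (by rw [hN]; push_cast; linarith [Nat.cast_nonneg (α := ℝ) N₂]))
  have z2 := hkp b₂ h1b2 (hN₂.trans (by rw [hN]; push_cast; linarith [Nat.cast_nonneg (α := ℝ) N₁]))
  have hPm : P ≤ P ^ m := by
    calc P = P ^ (1 : ℝ) := (Real.rpow_one P).symm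
      _ ≤ _ := Real.rpow_le_rpow_of_exponent_le hP1 hm1.le
  have hPm0 : 0 ≤ P ^ m := by positivity
  have hδN : 1 ≤ 1 / δ ^ N := by
    rw [le_div_iff₀ (by positivity), one_mul]; exact pow_le_one₀ hδ.le hδ1'
  have hθ1 : 2 * θ ≤ 1 := by
    rw [hθ]
    have : ((1 : ℝ) / 2) ^ (N + 1) ≤ 1 := pow_le_one₀ (by norm_num) (by norm_num)
    linarith
  have hθP : 2 * θ * P ≤ P ^ m * (1 / δ ^ N) := by
    calc 2 * θ * P ≤ 1 * P ^ m := by gcongr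
      _ = P ^ m * 1 := by ring
      _ ≤ _ := by gcongr
  calc dirichlet u ρ ≤ k * (P ^ (1 / 2 : ℝ) * W ^ b₁ + P ^ s * W ^ b₂) :=
        hstep u p h ρ δ ε P W hρ hδ hδ1 hρδ hε hε1 hP hW
    _ ≤ (θ * W + C₁ * k ^ (1 - b₁)⁻¹ * P ^ m) + (θ * W + C₂ * k ^ (1 - b₂)⁻¹ * P ^ m) := by
        rw [mul_add]; exact add_le_add y1 y2
    _ ≤ (θ * W + C₁ * ((K / ε) ^ (1 - b₁)⁻¹ / δ ^ N) * P ^ m) +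
        (θ * W + C₂ * ((K / ε) ^ (1 - b₂)⁻¹ / δ ^ N) * P ^ m) := by gcongr
    _ = 2 * θ * dirichlet u (ρ + 3 * δ) + 2 * θ * P + (G - 1) * P ^ m * (1 / δ ^ N) := by
        rw [hW, hG]; ring
    _ ≤ 2 * θ * dirichlet u (ρ + 3 * δ) + P ^ m * (1 / δ ^ N) +
        (G - 1) * P ^ m * (1 / δ ^ N) := by gcongr
    _ = _ := by rw [hθ]; ring

end SmoothNS

lemma Smooth.const_mul_comp_smul {f : E3 → ℝ} (hf : Smooth f) (c R : ℝ) :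
    Smooth (fun x => c * f (R • x)) :=
  contDiff_const.mul (hf.comp (contDiff_const_smul R))

lemma pd_const_mul_comp_smul {f : E3 → ℝ} (hf : Smooth f) (c R : ℝ) (j : Fin 3) :
    pd j (fun x => c * f (R • x)) = fun x => (c * R) * pd j f (R • x) := by
  funext x
  have h1 : HasFDerivAt (fun x : E3 => R • x) (R • ContinuousLinearMap.id ℝ E3) x :=
    (hasFDerivAt_id x).const_smul R
  have h2 := ((hf.differentiableAt (R • x)).hasFDerivAt.comp x h1).const_mul c
  have h3 : fderiv ℝ (fun x => c * f (R • x)) x = _ := h2.fderiv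
  rw [pd, h3]
  simp [pd, mul_assoc]

/-- The Navier–Stokes rescaling of a vector field. -/
def rescale (R : ℝ) (u : E3 → E3) (x : E3) : E3 := R • u (R • x)

lemma coord_rescale (R : ℝ) (u : E3 → E3) (i : Fin 3) :
    coord (rescale R u) i = fun x => R * coord u i (R • x) := by
  funext x
  simp [coord, rescale]

lemma SmoothNS.rescale {u : E3 → E3} {p : E3 → ℝ} (h : SmoothNS u p) (R : ℝ) :
    SmoothNS (rescale R u) (fun x => R ^ 2 * p (R • x)) := by
  refine ⟨fun i => ?_, h.smooth_p.const_mul_comp_smul _ _, fun x => ?_, fun i x => ?_⟩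
  · rw [coord_rescale]
    exact (h.smooth i).const_mul_comp_smul _ _
  · simp only [coord_rescale, pd_const_mul_comp_smul (h.smooth _), ← Finset.mul_sum, h.div, mul_zero]
  · have h1 := h.mom i (R • x)
    simp only [coord_rescale, pd_const_mul_comp_smul (h.smooth _),
      pd_const_mul_comp_smul ((h.smooth _).pd _), pd_const_mul_comp_smul h.smooth_p,
      Fin.sum_univ_three] at *
    linear_combination R ^ 3 * h1

lemma SmoothNS.gradSq_rescale {u : E3 → E3} {p : E3 → ℝ} (h : SmoothNS u p) (R : ℝ) (x : E3) :
    gradSq (_root_.rescale R u) x = R ^ 4 * gradSq u (R • x) := by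
  simp only [gradSq, coord_rescale, pd_const_mul_comp_smul (h.smooth _), Finset.mul_sum]
  refine Finset.sum_congr rfl fun i _ => Finset.sum_congr rfl fun j _ => ?_
  ring

open scoped Pointwise in
lemma SmoothNS.dirichlet_rescale {u : E3 → E3} {p : E3 → ℝ} (h : SmoothNS u p) {R ρ : ℝ}
    (hR : 0 < R) (hρ : 0 ≤ ρ) :
    dirichlet (_root_.rescale R u) ρ = R * dirichlet u (R * ρ) := by
  have e : R • closedBall (0 : E3) ρ = closedBall 0 (R * ρ) := by
    rw [_root_.smul_closedBall _ _ hρ, smul_zero, Real.norm_of_nonneg hR.le]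
  simp only [dirichlet, h.gradSq_rescale]
  rw [integral_const_mul, Measure.setIntegral_comp_smul_of_pos _ _ _ hR, e]
  simp only [finrank_euclideanSpace, Fintype.card_fin, smul_eq_mul]
  field_simp

open scoped Pointwise in
lemma smul_shell {R a b : ℝ} (hR : 0 < R) : R • shell a b = shell (R * a) (R * b) := by
  ext x
  rw [Set.mem_smul_set_iff_inv_smul_mem₀ hR.ne']
  simp only [shell, Set.mem_ofPred_eq, norm_smul, norm_inv, Real.norm_of_nonneg hR.le]
  rw [inv_mul_eq_div, le_div_iff₀ hR, div_le_iff₀ hR, mul_comm a, mul_comm b]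

open scoped Pointwise in
lemma setIntegral_shell_rescale (u : E3 → E3) {R a b q : ℝ} (hR : 0 < R) :
    ∫ x in shell a b, ‖rescale R u x‖ ^ q
      = R ^ (q - 3) * ∫ x in shell (R * a) (R * b), ‖u x‖ ^ q := by
  have e : ∀ x, ‖rescale R u x‖ ^ q = R ^ q * ‖u (R • x)‖ ^ q := fun x => by
    rw [rescale, norm_smul, Real.norm_of_nonneg hR.le, Real.mul_rpow hR.le (norm_nonneg _)]
  simp only [e]
  rw [integral_const_mul,
    Measure.setIntegral_comp_smul_of_pos volume (fun x => ‖u x‖ ^ q) _ hR, smul_shell hR,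
    Real.rpow_sub hR]
  simp only [finrank_euclideanSpace, Fintype.card_fin, smul_eq_mul]
  rw [show (3 : ℝ) = ((3 : ℕ) : ℝ) by norm_num, Real.rpow_natCast]
  ring

lemma SmoothNS.exists_dirichlet_le_rpow_ann {q m : ℝ} (hq : 12 / 5 < q) (hq3 : q < 3)
    (hm : 3 / (2 * q - 3) < m) : ∃ C : ℝ, 0 ≤ C ∧ ∀ u p, SmoothNS u p → ∀ R : ℝ, 0 < R →
      dirichlet u (R * (3 / 4)) ≤ C * R⁻¹ * (1 + R ^ (q - 3) * ∫ x in ann R, ‖u x‖ ^ q) ^ m := by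
  obtain ⟨C, hC⟩ := SmoothNS.exists_dirichlet_le_rpow_shell hq hq3 hm
  refine ⟨|C|, abs_nonneg C, fun u p h R hR => ?_⟩
  have h1 := hC _ _ (h.rescale R)
  rw [h.dirichlet_rescale hR (by norm_num), setIntegral_shell_rescale u hR] at h1
  have hm0 : 0 ≤ m := le_trans (div_nonneg (by norm_num) (by linarith)) hm.le
  have hcont : Continuous fun x => ‖u x‖ ^ q :=
    h.continuous.norm.rpow_const fun x => Or.inr (by linarith)
  have h2 : ∫ x in shell (R * (1 / 2)) (R * (9 / 10)), ‖u x‖ ^ q ≤ ∫ x in ann R, ‖u x‖ ^ q := by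
    refine setIntegral_mono_set ?_ (.of_forall fun x => by positivity) ?_
    · exact (hcont.continuousOn.integrableOn_compact (isCompact_closedBall (0 : E3) R)).mono_set
        (Set.sdiff_subset.trans ball_subset_closedBall)
    · refine LE.le.eventuallyLE fun x hx => ?_
      simp only [ann, shell, Set.mem_ofPred_eq, Set.mem_sdiff, mem_ball, dist_zero_right] at *
      constructor <;> linarith [hx.1, hx.2]
  have h0 : 0 ≤ ∫ x in shell (R * (1 / 2)) (R * (9 / 10)), ‖u x‖ ^ q :=
    integral_nonneg fun x => by positivity
  have hRp : 0 < R ^ (q - 3) := Real.rpow_pos_of_pos hR _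
  have h3 : R * dirichlet u (R * (3 / 4))
      ≤ |C| * (1 + R ^ (q - 3) * ∫ x in ann R, ‖u x‖ ^ q) ^ m := by
    refine h1.trans ?_
    gcongr
    exact le_abs_self C
  rw [mul_right_comm, ← div_eq_mul_inv, le_div_iff₀ hR, mul_comm]
  exact h3

lemma ofReal_mul_rpow_meas_le_lorentzNorm {α F : Type*} [MeasurableSpace α] [NormedAddCommGroup F]
    (μ : Measure α) {q : ℝ} (hq : 0 < q) {ℓ : ℝ≥0∞} (hℓ : 1 ≤ ℓ) (f : α → F) (Ω : Set α) {t : ℝ}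
    (ht : 0 < t) :
    ENNReal.ofReal (t / 2) * μ {x | x ∈ Ω ∧ t < ‖f x‖} ^ (1 / q)
      ≤ lorentzNorm μ (ENNReal.ofReal q) ℓ f Ω := by
  have hqq : (1 / ENNReal.ofReal q).toReal = 1 / q := by
    rw [ENNReal.toReal_div, ENNReal.toReal_ofReal hq.le, ENNReal.toReal_one]
  unfold lorentzNorm
  split_ifs with h
  · rw [hqq]
    refine le_trans ?_ (le_iSup _ t.toNNReal)
    rw [Real.coe_toNNReal _ ht.le]
    gcongr
    exact ENNReal.ofReal_le_ofReal (by linarith)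
  · set l := ℓ.toReal with hl
    have hl1 : 1 ≤ l := by
      rw [hl, ← ENNReal.toReal_one]
      exact ENNReal.toReal_mono h hℓ
    have hl0 : 0 < l := by linarith
    have h1 : (1 / ℓ).toReal = 1 / l := by rw [ENNReal.toReal_div, ENNReal.toReal_one]
    have h2 : (ℓ / ENNReal.ofReal q).toReal = l / q := by
      rw [ENNReal.toReal_div, ENNReal.toReal_ofReal hq.le]
    rw [h1, h2]
    set d : ℝ → ℝ≥0∞ := fun s => μ {x | x ∈ Ω ∧ s < ‖f x‖} with hd
    have key : ENNReal.ofReal (t / 2) ^ l * d t ^ (l / q)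
        ≤ ∫⁻ s in Set.Ioi (0 : ℝ), ENNReal.ofReal (s ^ (l - 1)) * d s ^ (l / q) := by
      calc ENNReal.ofReal (t / 2) ^ l * d t ^ (l / q)
          = ∫⁻ _ in Set.Ioc (t / 2) t, ENNReal.ofReal ((t / 2) ^ (l - 1)) * d t ^ (l / q) := by
            rw [setLIntegral_const, Real.volume_Ioc, mul_right_comm,
              ← ENNReal.ofReal_mul (by positivity), show t - t / 2 = t / 2 by ring,
              ENNReal.ofReal_rpow_of_pos (by positivity)]
            congr 2
            rw [← Real.rpow_add_one (by positivity)]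
            congr 1
            ring
        _ ≤ ∫⁻ s in Set.Ioc (t / 2) t, ENNReal.ofReal (s ^ (l - 1)) * d s ^ (l / q) := by
            refine setLIntegral_mono' measurableSet_Ioc fun s hs => ?_
            gcongr
            · exact hs.1.le
            · exact measure_mono fun x hx => ⟨hx.1, hs.2.trans_lt hx.2⟩
        _ ≤ _ := lintegral_mono_set fun s hs => lt_trans (by positivity) hs.1
    have h3 := ENNReal.rpow_le_rpow key (show 0 ≤ 1 / l by positivity)
    refine le_trans (le_of_eq ?_) h3
    rw [ENNReal.mul_rpow_of_nonneg _ _ (by positivity), ← ENNReal.rpow_mul, ← ENNReal.rpow_mul,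
      mul_one_div_cancel hl0.ne', ENNReal.rpow_one]
    congr 2
    field_simp

lemma lintegral_Ioc_rpow {s r : ℝ} (hs : 0 ≤ s) (hr : 0 < r) :
    ∫⁻ t in Set.Ioc 0 s, ENNReal.ofReal (t ^ (r - 1)) = ENNReal.ofReal (s ^ r / r) := by
  have hi : IntervalIntegrable (fun t : ℝ => t ^ (r - 1)) volume 0 s :=
    intervalIntegral.intervalIntegrable_rpow' (by linarith)
  rw [← ofReal_integral_eq_lintegral_ofReal, ← intervalIntegral.integral_of_le hs,
    integral_rpow (Or.inl (by linarith))]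
  · simp [Real.zero_rpow hr.ne']
  · exact (intervalIntegrable_iff_integrableOn_Ioc_of_le hs).1 hi
  · filter_upwards [ae_restrict_mem measurableSet_Ioc] with t ht
    exact Real.rpow_nonneg ht.1.le _

lemma lintegral_Ioi_rpow {s r : ℝ} (hs : 0 < s) (hr : 0 < r) :
    ∫⁻ t in Set.Ioi s, ENNReal.ofReal (t ^ (-r - 1)) = ENNReal.ofReal (s ^ (-r) / r) := by
  rw [← ofReal_integral_eq_lintegral_ofReal, integral_Ioi_rpow_of_lt (by linarith) hs]
  · rw [sub_add_cancel, neg_div_neg_eq]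
  · exact integrableOn_Ioi_rpow_of_lt (by linarith) hs
  · filter_upwards [ae_restrict_mem measurableSet_Ioi] with t ht
    exact Real.rpow_nonneg (hs.trans ht).le _

lemma lintegral_rpow_le_of_meas_lt_le {α : Type*} [MeasurableSpace α] (μ : Measure α) {f : α → ℝ}
    (hf : Measurable f) (hf0 : ∀ x, 0 ≤ f x) {q r A B s : ℝ} (hr : 0 < r) (hrq : r < q)
    (hA : 0 ≤ A) (hB : 0 ≤ B) (hs : 0 < s) (hμ : μ Set.univ ≤ ENNReal.ofReal A)
    (hd : ∀ t, 0 < t → μ {x | t < f x} ≤ ENNReal.ofReal (B * t ^ (-q))) :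
    ∫⁻ x, ENNReal.ofReal (f x ^ r) ∂μ
      ≤ ENNReal.ofReal (A * s ^ r + r / (q - r) * B * s ^ (r - q)) := by
  have hqr : 0 < q - r := by linarith
  have h1 : ∫⁻ t in Set.Ioc 0 s, μ {x | t < f x} * ENNReal.ofReal (t ^ (r - 1))
      ≤ ENNReal.ofReal (A * (s ^ r / r)) := by
    rw [ENNReal.ofReal_mul hA, ← lintegral_Ioc_rpow hs.le hr,
      ← lintegral_const_mul' _ _ ENNReal.ofReal_ne_top]
    exact lintegral_mono fun t => by
      gcongr
      exact (measure_mono (Set.subset_univ _)).trans hμ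
  have h2 : ∫⁻ t in Set.Ioi s, μ {x | t < f x} * ENNReal.ofReal (t ^ (r - 1))
      ≤ ENNReal.ofReal (B * (s ^ (-(q - r)) / (q - r))) := by
    rw [ENNReal.ofReal_mul hB, ← lintegral_Ioi_rpow hs hqr,
      ← lintegral_const_mul' _ _ ENNReal.ofReal_ne_top]
    refine setLIntegral_mono' measurableSet_Ioi fun t ht => ?_
    have ht0 : 0 < t := hs.trans ht
    refine (mul_le_mul_left (hd t ht0) _).trans_eq ?_
    rw [← ENNReal.ofReal_mul (by positivity), ← ENNReal.ofReal_mul hB, mul_assoc,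
      ← Real.rpow_add ht0]
    congr 3
    ring
  rw [lintegral_rpow_eq_lintegral_meas_lt_mul μ (.of_forall hf0) hf.aemeasurable hr,
    ← Set.Ioc_union_Ioi_eq_Ioi hs.le,
    lintegral_union measurableSet_Ioi (Set.Ioc_disjoint_Ioi le_rfl)]
  refine (mul_le_mul_right (add_le_add h1 h2) _).trans_eq ?_
  rw [← ENNReal.ofReal_add (by positivity) (by positivity), ← ENNReal.ofReal_mul hr.le, neg_sub]
  congr 1
  field_simp

lemma volume_ann_le (R : ℝ) (hR : 0 ≤ R) :
    volume (ann R) ≤ ENNReal.ofReal (R ^ 3 * (volume (ball (0 : E3) 1)).toReal) := by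
  refine (measure_mono Set.sdiff_subset).trans_eq ?_
  rw [Measure.addHaar_ball _ _ hR, ENNReal.ofReal_mul (by positivity),
    ENNReal.ofReal_toReal measure_ball_lt_top.ne]
  simp

lemma measurableSet_ann (R : ℝ) : MeasurableSet (ann R) :=
  measurableSet_ball.diff measurableSet_ball

/-- A power bound for the Lorentz norm on an annulus controls a slightly lower Lebesgue norm. -/
lemma exists_setIntegral_ann_le {q r γ M : ℝ} (hr : 0 < r) (hrq : r < q) (hM : 0 ≤ M) :
    ∃ C : ℝ, 0 ≤ C ∧ ∀ (u : E3 → E3), Continuous u → ∀ (ℓ : ℝ≥0∞), 1 ≤ ℓ → ∀ R : ℝ, 0 < R →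
      ENNReal.ofReal (R ^ (γ - 3 / q)) * lorentzNorm volume (ENNReal.ofReal q) ℓ u (ann R)
        ≤ ENNReal.ofReal M →
      ∫ x in ann R, ‖u x‖ ^ r ≤ C * R ^ (3 - r * γ) := by
  have hq : 0 < q := hr.trans hrq
  have hqr : 0 < q - r := by linarith
  set V := (volume (ball (0 : E3) 1)).toReal with hV
  have hV0 : 0 ≤ V := ENNReal.toReal_nonneg
  refine ⟨V + r / (q - r) * (2 * M) ^ q, by positivity, fun u hu ℓ hℓ R hR hN => ?_⟩
  have hd : ∀ t, 0 < t → (volume.restrict (ann R)) {x | t < ‖u x‖}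
      ≤ ENNReal.ofReal ((2 * M * R ^ (3 / q - γ)) ^ q * t ^ (-q)) := by
    intro t ht
    rw [Measure.restrict_apply' (measurableSet_ann R)]
    have e : {x | t < ‖u x‖} ∩ ann R = {x | x ∈ ann R ∧ t < ‖u x‖} := by
      ext x
      exact and_comm
    rw [e]
    have h1 := ofReal_mul_rpow_meas_le_lorentzNorm volume hq hℓ u (ann R) ht
    set D := volume {x | x ∈ ann R ∧ t < ‖u x‖} with hD
    have h2 : ENNReal.ofReal (R ^ (γ - 3 / q) * (t / 2)) * D ^ (1 / q) ≤ ENNReal.ofReal M := by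
      rw [ENNReal.ofReal_mul (by positivity), mul_assoc]
      exact (mul_le_mul_right h1 _).trans hN
    have hDt : D ≠ ⊤ := ((measure_mono fun x hx => hx.1).trans_lt
      ((volume_ann_le R hR.le).trans_lt ENNReal.ofReal_lt_top)).ne
    obtain ⟨a, ha⟩ : ∃ a : ℝ, D = ENNReal.ofReal a ∧ 0 ≤ a :=
      ⟨D.toReal, (ENNReal.ofReal_toReal hDt).symm, ENNReal.toReal_nonneg⟩
    rw [ha.1, ENNReal.ofReal_rpow_of_nonneg ha.2 (by positivity),
      ← ENNReal.ofReal_mul (by positivity), ENNReal.ofReal_le_ofReal_iff hM] at h2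
    rw [ha.1]
    refine ENNReal.ofReal_le_ofReal ?_
    have h3 : a ^ (1 / q) ≤ 2 * M * R ^ (3 / q - γ) * t⁻¹ := by
      have e1 : R ^ (3 / q - γ) = (R ^ (γ - 3 / q))⁻¹ := by
        rw [← Real.rpow_neg hR.le, neg_sub]
      have e2 : 0 < R ^ (γ - 3 / q) := by positivity
      rw [e1, ← div_eq_mul_inv, ← div_eq_mul_inv, le_div_iff₀ ht, le_div_iff₀ e2]
      linarith
    have h4 := Real.rpow_le_rpow (Real.rpow_nonneg ha.2 _) h3 hq.le
    rwa [← Real.rpow_mul ha.2, one_div_mul_cancel hq.ne', Real.rpow_one,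
      Real.mul_rpow (by positivity) (by positivity), Real.inv_rpow ht.le,
      ← Real.rpow_neg ht.le] at h4
  have h5 := lintegral_rpow_le_of_meas_lt_le (volume.restrict (ann R)) hu.norm.measurable
    (fun x => norm_nonneg _) hr hrq (A := R ^ 3 * V) (by positivity) (by positivity)
    (show 0 < R ^ (-γ) by positivity) (by rw [Measure.restrict_apply_univ]; exact volume_ann_le R hR.le) hd
  rw [integral_eq_lintegral_of_nonneg_ae (.of_forall fun x => by positivity)
    (hu.norm.rpow_const fun x => Or.inr hr.le).aestronglyMeasurable]
  refine (ENNReal.toReal_mono ENNReal.ofReal_ne_top h5).trans_eq ?_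
  rw [ENNReal.toReal_ofReal (by positivity), Real.mul_rpow (by positivity) (by positivity),
    ← Real.rpow_mul hR.le, ← Real.rpow_mul hR.le, ← Real.rpow_mul hR.le,
    show (R : ℝ) ^ 3 = R ^ (3 : ℝ) by norm_cast]
  have e1 : R ^ (3 : ℝ) * R ^ (-γ * r) = R ^ (3 - r * γ) := by
    rw [← Real.rpow_add hR]
    congr 1
    ring
  have e2 : R ^ ((3 / q - γ) * q) * R ^ (-γ * (r - q)) = R ^ (3 - r * γ) := by
    rw [← Real.rpow_add hR]
    congr 1
    field_simp
    ring
  calc _ = V * (R ^ (3 : ℝ) * R ^ (-γ * r))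
        + r / (q - r) * (2 * M) ^ q * (R ^ ((3 / q - γ) * q) * R ^ (-γ * (r - q))) := by ring
    _ = _ := by rw [e1, e2]; ring

lemma volume_real_ann {R : ℝ} (hR : 0 ≤ R) :
    volume.real (ann R) = 7 / 8 * R ^ 3 * volume.real (ball (0 : E3) 1) := by
  have h : ∀ r : ℝ, 0 ≤ r → volume.real (ball (0 : E3) r) = r ^ 3 * volume.real (ball (0 : E3) 1) :=
    fun r hr => by
      rw [Measure.real, Measure.addHaar_ball _ _ hr, ENNReal.toReal_mul,
        ENNReal.toReal_ofReal (by positivity)]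
      simp [Measure.real]
  have h1 := measureReal_sdiff_add_inter (μ := volume) (s := ball (0 : E3) R)
    (measurableSet_ball (x := (0 : E3)) (ε := R / 2)) measure_ball_lt_top.ne
  rw [Set.inter_eq_right.2 (ball_subset_ball (by linarith)), h _ hR, h _ (by positivity)] at h1
  rw [ann]
  linear_combination h1

lemma SmoothNS.dirichlet_mono {u : E3 → E3} {p : E3 → ℝ} (h : SmoothNS u p) :
    Monotone (dirichlet u) := fun _ _ hρ =>
  setIntegral_mono_set
    (h.continuous_gradSq.continuousOn.integrableOn_compact (isCompact_closedBall _ _))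
    (.of_forall fun x => gradSq_nonneg u x) (closedBall_subset_closedBall hρ).eventuallyLE

lemma SmoothNS.eq_const_of_dirichlet_le_zero {u : E3 → E3} {p : E3 → ℝ} (h : SmoothNS u p)
    (hd : ∀ ρ, dirichlet u ρ ≤ 0) (x : E3) : u x = u 0 := by
  have hg : ∀ x, gradSq u x = 0 := by
    intro x
    by_contra hx
    have hi : IntegrableOn (gradSq u) (closedBall 0 (‖x‖ + 1)) :=
      h.continuous_gradSq.continuousOn.integrableOn_compact (isCompact_closedBall _ _)
    have hpos : 0 < volume (Function.support (gradSq u) ∩ closedBall 0 (‖x‖ + 1)) := by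
      refine lt_of_lt_of_le ?_ (measure_mono
        (Set.inter_subset_inter_right _ (ball_subset_closedBall (ε := ‖x‖ + 1))))
      refine (h.continuous_gradSq.isOpen_support.inter isOpen_ball).measure_pos _ ⟨x, hx, ?_⟩
      simp
    have := (setIntegral_pos_iff_support_of_nonneg_ae
      (.of_forall fun x => gradSq_nonneg u x) hi).2 hpos
    exact absurd (hd (‖x‖ + 1)) (not_le.2 this)
  ext i
  refine is_const_of_fderiv_eq_zero (𝕜 := ℝ) (f := coord u i)
    (fun y => (h.smooth i).differentiableAt y) (fun y => ?_) x 0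
  have hp : ∀ j, pd j (coord u i) y = 0 := fun j =>
    pow_eq_zero_iff (two_ne_zero) |>.1
      (le_antisymm ((pd_sq_le_gradSq u y i j).trans (hg y).le) (sq_nonneg _))
  have := norm_fderiv_le_sum (coord u i) y
  simp only [hp, abs_zero, Finset.sum_const_zero, norm_le_zero_iff] at this
  exact this

lemma exists_exponents {q γ : ℝ} (hq1 : 12 / 5 < q) (hq2 : q < 3) (hγ : 1 / 3 + 1 / q < γ) :
    ∃ r m a : ℝ, 12 / 5 < r ∧ r < q ∧ 3 / (2 * r - 3) < m ∧ 0 ≤ a ∧ r * (1 - γ) ≤ a ∧ a * m < 1 := by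
  have hq : 0 < q := by linarith
  have hγ3 : 1 / q < γ - 1 / 3 := by linarith
  have hγ0 : 0 < γ - 1 / 3 := lt_trans (by positivity) hγ3
  have h1 : 1 / (γ - 1 / 3) < q := by
    rw [div_lt_iff₀ hγ0]
    rwa [div_lt_iff₀ hq, mul_comm] at hγ3
  obtain ⟨r, hr1, hr2⟩ := exists_between (max_lt hq1 h1)
  have hr3 := (le_max_left _ _).trans_lt hr1
  have hr4 := (le_max_right _ _).trans_lt hr1
  rw [div_lt_iff₀ hγ0] at hr4
  set a := max (r * (1 - γ)) 0 with ha
  have ha0 : 0 ≤ a := le_max_right _ _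
  have hb : a < (2 * r - 3) / 3 := max_lt (by linarith) (by linarith)
  refine ⟨r, 2 / (a + (2 * r - 3) / 3), a, hr3, hr2, ?_, ha0, le_max_left _ _, ?_⟩
  · rw [div_lt_div_iff₀ (by linarith) (by linarith)]
    linarith
  · rw [mul_div_assoc', div_lt_one (by linarith)]
    linarith

lemma le_zero_of_frequently_le_mul_rpow {a K s : ℝ} (hs : 0 < s)
    (h : ∃ᶠ R : ℝ in atTop, a ≤ K * R ^ (-s)) : a ≤ 0 := by
  by_contra! ha
  have h1 : Tendsto (fun R : ℝ => K * R ^ (-s)) atTop (nhds (K * 0)) :=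
    (tendsto_rpow_neg_atTop hs).const_mul K
  rw [mul_zero] at h1
  obtain ⟨R, hR1, hR2⟩ := (h.and_eventually (h1.eventually (gt_mem_nhds ha))).exists
  linarith

theorem stmt_12 (u : E3 → E3) (p : E3 → ℝ) (hu : ContDiff ℝ (⊤ : ℕ∞) u) (hp : ContDiff ℝ (⊤ : ℕ∞) p)
    (hNS : SteadyNS u p) (q γ : ℝ) (ℓ : ℝ≥0∞) (hq1 : 12 / 5 < q) (hq2 : q < 3)
    (hℓ : 1 ≤ ℓ) (hγ : 1 / 3 + 1 / q < γ)
    (hM : liminf (fun R : ℝ =>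
        ENNReal.ofReal (R ^ (γ - 3 / q)) *
          lorentzNorm volume (ENNReal.ofReal q) ℓ u (ann R)) atTop < ⊤) :
    ∀ x, u x = 0 := by
  have hS := hNS.smoothNS hu hp
  obtain ⟨r, m, a, hr, hrq, hm, ha, hra, ham⟩ := exists_exponents hq1 hq2 hγ
  have hm0 : 0 < m := lt_trans (div_pos (by norm_num) (by linarith)) hm
  have hγ0 : 0 < γ := lt_trans (by positivity) hγ
  obtain ⟨C₁, hC₁, hD⟩ := SmoothNS.exists_dirichlet_le_rpow_ann hr (hrq.trans hq2) hm
  obtain ⟨b, hb, hbt⟩ := exists_between hM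
  obtain ⟨C₂, hC₂, hA⟩ := exists_setIntegral_ann_le (γ := γ) (M := b.toReal)
    (show 0 < r by linarith) hrq ENNReal.toReal_nonneg
  have hfreq : ∃ᶠ R : ℝ in atTop, 1 ≤ R ∧ ∫ x in ann R, ‖u x‖ ^ r ≤ C₂ * R ^ (3 - r * γ) := by
    refine ((frequently_lt_of_liminf_lt (by isBoundedDefault) hb).and_eventually
      (eventually_ge_atTop 1)).mono fun R hR => ⟨hR.2, hA u hS.continuous ℓ hℓ R (by linarith [hR.2]) ?_⟩
    rw [ENNReal.ofReal_toReal hbt.ne]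
    exact hR.1.le
  have hdir : ∀ R : ℝ, 1 ≤ R → ∫ x in ann R, ‖u x‖ ^ r ≤ C₂ * R ^ (3 - r * γ) →
      dirichlet u (R * (3 / 4)) ≤ C₁ * (1 + C₂) ^ m * R ^ (-(1 - a * m)) := by
    intro R hR hI
    have hR0 : 0 < R := by linarith
    have hI0 : 0 ≤ ∫ x in ann R, ‖u x‖ ^ r := integral_nonneg fun x => by positivity
    have h1 : 1 + R ^ (r - 3) * ∫ x in ann R, ‖u x‖ ^ r ≤ (1 + C₂) * R ^ a := by
      have h2 : R ^ (r - 3) * ∫ x in ann R, ‖u x‖ ^ r ≤ C₂ * R ^ a := by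
        calc R ^ (r - 3) * ∫ x in ann R, ‖u x‖ ^ r
            ≤ R ^ (r - 3) * (C₂ * R ^ (3 - r * γ)) := by gcongr
          _ = C₂ * R ^ (r * (1 - γ)) := by
            rw [mul_left_comm, ← Real.rpow_add hR0]
            ring_nf
          _ ≤ C₂ * R ^ a := by gcongr
      linarith [Real.one_le_rpow hR ha]
    calc dirichlet u (R * (3 / 4))
        ≤ C₁ * R⁻¹ * (1 + R ^ (r - 3) * ∫ x in ann R, ‖u x‖ ^ r) ^ m := hD u p hS R hR0
      _ ≤ C₁ * R⁻¹ * ((1 + C₂) * R ^ a) ^ m := by gcongr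
      _ = C₁ * (1 + C₂) ^ m * R ^ (-(1 - a * m)) := by
        rw [Real.mul_rpow (by positivity) (by positivity), ← Real.rpow_mul hR0.le, neg_sub,
          Real.rpow_sub_one hR0.ne']
        ring
  have hconst := hS.eq_const_of_dirichlet_le_zero fun ρ =>
    le_zero_of_frequently_le_mul_rpow (sub_pos.2 ham) <|
      (hfreq.and_eventually (eventually_ge_atTop (ρ * (4 / 3)))).mono fun R hR =>
        (hS.dirichlet_mono (by linarith [hR.2])).trans (hdir R hR.1.1 hR.1.2)
  set V := volume.real (ball (0 : E3) 1) with hV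
  have hV0 : 0 < V := ENNReal.toReal_pos (measure_ball_pos _ _ one_pos).ne' measure_ball_lt_top.ne
  have hzero : 7 / 8 * V * ‖u 0‖ ^ r ≤ 0 := by
    refine le_zero_of_frequently_le_mul_rpow (K := C₂) (s := r * γ) (by nlinarith)
      (hfreq.mono fun R hR => ?_)
    have hR0 : 0 < R := by linarith [hR.1]
    have h1 := hR.2
    simp only [hconst] at h1
    rw [setIntegral_const, volume_real_ann hR0.le, smul_eq_mul, sub_eq_add_neg,
      Real.rpow_add hR0, show R ^ (3 : ℝ) = R ^ 3 by norm_cast] at h1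
    have hR3 : 0 < R ^ 3 := by positivity
    refine le_of_mul_le_mul_left ?_ hR3
    linarith
  intro x
  rw [hconst x]
  by_contra h0
  have : 0 < ‖u 0‖ := norm_pos_iff.2 h0
  have : 0 < 7 / 8 * V * ‖u 0‖ ^ r := by positivity
  linarith
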